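/- Let v ∈ S_k and let A ⊊ [k−1] with |A| = q. Let {λ^{(n)}} be a sequence of partitions of n with no short cycles, i.e. for every i, m_i(λ^{(n)}) → 0 as n → ∞, and let Σ_n be a uniformly random element of K_{λ^{(n)}}. Then there exists a constant σ_{v,A} > 0 such that the random variables (N_{v,A}(Σ_n) − n^{k−q}/(k!(k−q)!)) / n^{k−q−1/2} converge in distribution, as n → ∞, to the normal distribution N(0, σ_{v,A}²). -/

import Mathlib

open Finset Filter
open scoped Classical BigOperators

namespace PaperStmt

/-- One step of the partial injection encoded by the tuples `I`, `J`. -/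
noncomputable def pstep {k : ℕ} (I J : Fin k → ℕ) (x : ℕ) : Option ℕ :=
  if h : ∃ ℓ, I ℓ = x then some (J h.choose) else none

/-- Iterates of the partial injection encoded by `I`, `J`. -/
noncomputable def piter {k : ℕ} (I J : Fin k → ℕ) : ℕ → ℕ → Option ℕ
  | 0, x => some x
  | t + 1, x => (piter I J t x).bind (pstep I J)

/-- The vertex set of the graph `G(I,J)`. -/
def pverts {k : ℕ} (I J : Fin k → ℕ) : Finset ℕ :=
  Finset.image I Finset.univ ∪ Finset.image J Finset.univ

/-- The number of directed cycles of length `i` in the graph `G(I,J)`. -/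
noncomputable def cycleMult {k : ℕ} (I J : Fin k → ℕ) (i : ℕ) : ℕ :=
  ((pverts I J).filter fun x =>
    piter I J i x = some x ∧ ∀ t, 0 < t → t < i → piter I J t x ≠ some x).card / i

/-- The number of directed path components with exactly `ℓ` edges in `G(I,J)`. -/
noncomputable def pathMult {k : ℕ} (I J : Fin k → ℕ) (ℓ : ℕ) : ℕ :=
  ((pverts I J).filter fun x =>
    (∀ a, J a ≠ x) ∧ (piter I J ℓ x).isSome ∧ piter I J (ℓ + 1) x = none).card

/-- The cycle partition `μ` of the partial permutation `(I,J)`. -/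
noncomputable def cyclePart {k : ℕ} (I J : Fin k → ℕ) : Multiset ℕ :=
  ∑ i ∈ Finset.range (k + 1), Multiset.replicate (cycleMult I J i) i

/-- The path partition `ν` of the partial permutation `(I,J)`. -/
noncomputable def pathPart {k : ℕ} (I J : Fin k → ℕ) : Multiset ℕ :=
  ∑ i ∈ Finset.range (k + 1), Multiset.replicate (pathMult I J i) i

/-- The full cycle type of a permutation (including fixed points as parts equal to 1). -/
noncomputable def fullCycleType {n : ℕ} (π : Equiv.Perm (Fin n)) : Multiset ℕ :=
  π.cycleType + Multiset.replicate (n - π.support.card) 1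

/-- The conjugacy class `K_λ` of permutations of cycle type `λ`. -/
noncomputable def KClass {n : ℕ} (lam : Nat.Partition n) : Finset (Equiv.Perm (Fin n)) :=
  Finset.univ.filter fun π => fullCycleType π = lam.parts

/-- Expectation of a statistic over the uniform distribution on `K_λ`. -/
noncomputable def expect {n : ℕ} (lam : Nat.Partition n) (f : Equiv.Perm (Fin n) → ℝ) : ℝ :=
  (∑ π ∈ KClass lam, f π) / (KClass lam).card

/-- The indicator `1_{IJ}` of the partial permutation `(I,J)` in `S_n`. -/
noncomputable def indic {n k : ℕ} (I J : Fin k → Fin n) (π : Equiv.Perm (Fin n)) : ℝ :=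
  if ∀ ℓ, π (I ℓ) = J ℓ then 1 else 0


/-- The vincular pattern count `N_{v,A}(π)`: the number of strictly increasing tuples of
positions `i_0 < ⋯ < i_{k-1}` in `[n]` (0-indexed) with `i_{a+1} = i_a + 1` for `a ∈ A` such
that `(π(i_0), …, π(i_{k-1}))` has the same relative order as `(v(0), …, v(k-1))`. -/
noncomputable def vincularCount {k n : ℕ} (v : Equiv.Perm (Fin k)) (A : Finset ℕ)
    (π : Equiv.Perm (Fin n)) : ℕ :=
  (Finset.univ.filter fun s : Fin k → Fin n =>
    StrictMono s ∧
    (∀ a ∈ A, ∀ h : a + 1 < k,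
      (s ⟨a + 1, h⟩ : ℕ) = (s ⟨a, Nat.lt_of_succ_lt h⟩ : ℕ) + 1) ∧
    (∀ a b : Fin k, π (s a) < π (s b) ↔ v a < v b)).card

/-- Average of `Θ` over the value at the coordinate `x`. -/
noncomputable def avgAt {n : ℕ} (x : Fin n) (Θ : (Fin n → Fin n) → ℂ) (U : Fin n → Fin n) : ℂ :=
  𝔼 b, Θ (Function.update U x b)

/-- Average of `Θ` over the values at the coordinates `≥ m`. -/
noncomputable def tailAvg {n : ℕ} (m : ℕ) (Θ : (Fin n → Fin n) → ℂ) (U : Fin n → Fin n) : ℂ :=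
  𝔼 V : Fin n → Fin n, Θ (fun i => if i.val < m then U i else V i)

lemma norm_expect_le_of_le {ι : Type*} (s : Finset ι) (f : ι → ℂ) (M : ℝ) (hM : 0 ≤ M)
    (h : ∀ i ∈ s, ‖f i‖ ≤ M) : ‖𝔼 i ∈ s, f i‖ ≤ M := by
  rcases s.eq_empty_or_nonempty with rfl | hs
  · simpa using hM
  · exact (RCLike.norm_expect_le (K := ℂ)).trans (Finset.expect_le hs h)

lemma expect_resample {n : ℕ} (Q : Finset (Fin n))
    (F : (Fin n → Fin n) → (Fin n → Fin n) → ℂ) :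
    𝔼 U, 𝔼 V, F U V = 𝔼 U, 𝔼 V, F (Q.piecewise V U) (Q.piecewise U V) := by
  have e : ∀ G : (Fin n → Fin n) → (Fin n → Fin n) → ℂ,
      𝔼 U, 𝔼 V, G U V = 𝔼 p : (Fin n → Fin n) × (Fin n → Fin n), G p.1 p.2 := by
    intro G
    exact (Finset.expect_product' (s := univ) (t := univ) G).symm
  rw [e, e]
  refine Finset.expect_nbij' (fun p => (Q.piecewise p.2 p.1, Q.piecewise p.1 p.2))
    (fun p => (Q.piecewise p.2 p.1, Q.piecewise p.1 p.2)) (by simp) (by simp) ?_ ?_ ?_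
  · rintro ⟨U, V⟩ -
    ext i <;> by_cases hi : i ∈ Q <;> simp [hi]
  · rintro ⟨U, V⟩ -
    ext i <;> by_cases hi : i ∈ Q <;> simp [hi]
  · rintro ⟨U, V⟩ -
    congr 1 <;> ext i <;> by_cases hi : i ∈ Q <;> simp [hi]

lemma expect_resample_one {n : ℕ} (x : Fin n) (F : (Fin n → Fin n) → Fin n → ℂ) :
    𝔼 U, 𝔼 b, F U b = 𝔼 U, 𝔼 b, F (Function.update U x b) (U x) := by
  have e : ∀ G : (Fin n → Fin n) → Fin n → ℂ,
      𝔼 U, 𝔼 V, G U V = 𝔼 p : (Fin n → Fin n) × Fin n, G p.1 p.2 := by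
    intro G
    exact (Finset.expect_product' (s := univ) (t := univ) G).symm
  rw [e, e]
  refine Finset.expect_nbij' (fun p => (Function.update p.1 x p.2, p.1 x))
    (fun p => (Function.update p.1 x p.2, p.1 x)) (by simp) (by simp) ?_ ?_ ?_ <;>
  · rintro ⟨U, V⟩ -
    simp

lemma expect_const_of_pos {n : ℕ} (hn : 0 < n) (c : ℂ) : 𝔼 _b : Fin n, c = c := by
  have : Nonempty (Fin n) := ⟨⟨0, hn⟩⟩
  exact Fintype.expect_const c

lemma expect_fun_const {n : ℕ} (c : ℂ) : 𝔼 _b : Fin n → Fin n, c = c := by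
  have : Nonempty (Fin n → Fin n) := ⟨id⟩
  exact Fintype.expect_const c

lemma expect_update {n : ℕ} (x : Fin n) (F : (Fin n → Fin n) → ℂ) :
    𝔼 U, 𝔼 b, F (Function.update U x b) = 𝔼 U, F U := by
  rw [← expect_resample_one x (fun U _ => F U)]
  exact Finset.expect_congr rfl fun U _ => expect_const_of_pos (x.pos) _

lemma expect_avgAt {n : ℕ} (x : Fin n) (Θ : (Fin n → Fin n) → ℂ) :
    𝔼 U, avgAt x Θ U = 𝔼 U, Θ U := expect_update x Θ

/-- Averaging at `x` is self-adjoint. -/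
lemma expect_avgAt_mul {n : ℕ} (x : Fin n) (Θ Ψ : (Fin n → Fin n) → ℂ) :
    𝔼 U, avgAt x Θ U * Ψ U = 𝔼 U, Θ U * avgAt x Ψ U := by
  simp only [avgAt, Finset.expect_mul, Finset.mul_expect]
  rw [expect_resample_one x]
  simp

lemma tailAvg_zero {n : ℕ} (Θ : (Fin n → Fin n) → ℂ) (U : Fin n → Fin n) :
    tailAvg 0 Θ U = 𝔼 V, Θ V := by
  simp [tailAvg]

lemma tailAvg_top {n : ℕ} (Θ : (Fin n → Fin n) → ℂ) (U : Fin n → Fin n) :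
    tailAvg n Θ U = Θ U := by
  simp [tailAvg, expect_fun_const]

lemma avgAt_tailAvg {n : ℕ} (x : Fin n) (Θ : (Fin n → Fin n) → ℂ) (U : Fin n → Fin n) :
    avgAt x (tailAvg (x.val + 1) Θ) U = tailAvg x.val Θ U := by
  simp only [avgAt, tailAvg]
  rw [Finset.expect_comm, expect_resample_one x]
  calc _ = 𝔼 V : Fin n → Fin n, 𝔼 b : Fin n,
        Θ (fun i => if i.val < x.val then U i else V i) := by
        refine Finset.expect_congr rfl fun V _ => Finset.expect_congr rfl fun b _ => ?_
        congr 1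
        ext i
        by_cases h : i = x
        · subst h; simp
        · have : i.val ≠ x.val := fun e => h (Fin.ext e)
          by_cases h2 : i.val < x.val
          · simp [h2, h, Nat.lt_succ_of_lt h2]
          · have : ¬ i.val < x.val + 1 := by omega
            simp [h, h2, this]
    _ = _ := Finset.expect_congr rfl fun V _ => expect_const_of_pos x.pos _

lemma norm_tailAvg_le {n : ℕ} (m : ℕ) (Θ : (Fin n → Fin n) → ℂ) (M : ℝ) (hM : ∀ U, ‖Θ U‖ ≤ M)
    (U : Fin n → Fin n) : ‖tailAvg m Θ U‖ ≤ M :=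
  norm_expect_le_of_le _ _ _ ((norm_nonneg _).trans (hM U)) fun _ _ => hM _

lemma norm_avgAt_le {n : ℕ} (x : Fin n) (Θ : (Fin n → Fin n) → ℂ) (M : ℝ) (hM : ∀ U, ‖Θ U‖ ≤ M)
    (U : Fin n → Fin n) : ‖avgAt x Θ U‖ ≤ M :=
  norm_expect_le_of_le _ _ _ ((norm_nonneg _).trans (hM U)) fun _ _ => hM _

lemma dependsOn_tailAvg {n : ℕ} (m : ℕ) {Θ : (Fin n → Fin n) → ℂ} {P : Finset (Fin n)}
    (h : DependsOn Θ (P : Set (Fin n))) : DependsOn (tailAvg m Θ) (P : Set (Fin n)) := by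
  intro U U' hU
  refine Finset.expect_congr rfl fun V _ => h fun i hi => ?_
  by_cases him : i.val < m <;> simp [him, hU i hi]

lemma dependsOn_avgAt {n : ℕ} (x : Fin n) {Θ : (Fin n → Fin n) → ℂ} {P : Finset (Fin n)}
    (h : DependsOn Θ (P : Set (Fin n))) : DependsOn (avgAt x Θ) (P : Set (Fin n)) := by
  intro U U' hU
  refine Finset.expect_congr rfl fun b _ => h fun i hi => ?_
  by_cases him : i = x
  · subst him; simp
  · simp [him, hU i hi]

lemma avgAt_of_notMem {n : ℕ} {x : Fin n} {Θ : (Fin n → Fin n) → ℂ} {P : Finset (Fin n)}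
    (h : DependsOn Θ (P : Set (Fin n))) (hx : x ∉ P) (U : Fin n → Fin n) : avgAt x Θ U = Θ U := by
  rw [← expect_const_of_pos x.pos (Θ U)]
  refine Finset.expect_congr rfl fun b _ => h fun i hi => ?_
  have : i ≠ x := fun e => hx (e ▸ hi)
  simp [this]

lemma tailAvg_telescope {n : ℕ} {Θ : (Fin n → Fin n) → ℂ} {P : Finset (Fin n)}
    (h : DependsOn Θ (P : Set (Fin n))) (U : Fin n → Fin n) :
    Θ U - 𝔼 V, Θ V = ∑ x ∈ P, (tailAvg (x.val + 1) Θ U - avgAt x (tailAvg (x.val + 1) Θ) U) := by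
  have h1 : Θ U - 𝔼 V, Θ V = ∑ x : Fin n, (tailAvg (x.val + 1) Θ U - tailAvg x.val Θ U) := by
    rw [Fin.sum_univ_eq_sum_range (fun m => tailAvg (m + 1) Θ U - tailAvg m Θ U),
      Finset.sum_range_sub (fun m => tailAvg m Θ U), tailAvg_top, tailAvg_zero]
  rw [h1]
  symm
  apply Finset.sum_subset_zero_on_sdiff (Finset.subset_univ P)
  · intro x hx
    rw [← avgAt_tailAvg, avgAt_of_notMem (dependsOn_tailAvg _ h) (by simpa using hx), sub_self]
  · intro x _
    rw [avgAt_tailAvg]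

/-- Functions of disjoint sets of coordinates are independent. -/
lemma expect_mul_of_disjoint {n : ℕ} {Θ Ψ : (Fin n → Fin n) → ℂ} {P Q : Finset (Fin n)}
    (hΘ : DependsOn Θ (P : Set (Fin n))) (hΨ : DependsOn Ψ (Q : Set (Fin n)))
    (hPQ : Disjoint P Q) : 𝔼 U, Θ U * Ψ U = (𝔼 U, Θ U) * 𝔼 U, Ψ U := by
  rw [Finset.expect_mul]
  simp_rw [Finset.mul_expect]
  rw [expect_resample Q]
  refine Finset.expect_congr rfl fun U _ => ?_
  rw [← expect_fun_const (n := n) (Θ U * Ψ U)]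
  refine Finset.expect_congr rfl fun V _ => ?_
  congr 1
  · refine hΘ fun i hi => ?_
    have : i ∉ Q := fun hq => Finset.disjoint_left.mp hPQ hi hq
    simp [this]
  · refine hΨ fun i hi => ?_
    have : i ∈ Q := hi
    simp [this]

section

/-- Conjugation of `π` by the transposition of `a` and `b`. -/
noncomputable def cswap {n : ℕ} (π : Equiv.Perm (Fin n)) (a b : Fin n) : Equiv.Perm (Fin n) :=
  Equiv.swap a b * π * Equiv.swap a b

/-- A nonempty, conjugation-invariant set of permutations without fixed points or 2-cycles. -/
structure LongCycles {n : ℕ} (K : Finset (Equiv.Perm (Fin n))) : Prop where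
  nonempty : K.Nonempty
  conj : ∀ π ∈ K, ∀ a b, cswap π a b ∈ K
  ne_fix : ∀ π ∈ K, ∀ x, π x ≠ x
  ne_two : ∀ π ∈ K, ∀ x, π (π x) ≠ x
  six_le : 6 ≤ n

/-- Indicator of a proposition, as a real number. -/
noncomputable def ind (p : Prop) : ℝ := if p then 1 else 0

lemma ind_nonneg (p : Prop) : 0 ≤ ind p := by unfold ind; split_ifs <;> norm_num
lemma ind_le_one (p : Prop) : ind p ≤ 1 := by unfold ind; split_ifs <;> norm_num
lemma ind_true {p : Prop} (h : p) : ind p = 1 := if_pos h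
lemma ind_false {p : Prop} (h : ¬ p) : ind p = 0 := if_neg h
lemma ind_le_ind {p q : Prop} (h : p → q) : ind p ≤ ind q := by
  by_cases hp : p
  · rw [ind_true hp, ind_true (h hp)]
  · rw [ind_false hp]; exact ind_nonneg _

lemma sum_ind_eq' {α : Type*} [Fintype α] (c : α) : ∑ b, ind (c = b) = 1 := by
  rw [Finset.sum_eq_single c (fun b _ hb => ind_false (Ne.symm hb)) (by simp), ind_true rfl]

lemma sum_ind_eq {α : Type*} [Fintype α] (c : α) : ∑ b, ind (b = c) = 1 := by
  rw [Finset.sum_eq_single c (fun b _ hb => ind_false hb) (by simp), ind_true rfl]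

lemma cswap_apply {n : ℕ} (π : Equiv.Perm (Fin n)) (a b z : Fin n) :
    cswap π a b z = Equiv.swap a b (π (Equiv.swap a b z)) := rfl

lemma cswap_cswap {n : ℕ} (π : Equiv.Perm (Fin n)) (a b : Fin n) :
    cswap (cswap π a b) a b = π := by
  ext z; simp [cswap_apply]

lemma cswap_comm {n : ℕ} (π : Equiv.Perm (Fin n)) (a b : Fin n) :
    cswap π a b = cswap π b a := by
  simp [cswap, Equiv.swap_comm]

variable {n : ℕ} {K : Finset (Equiv.Perm (Fin n))}

lemma LongCycles.pos (hK : LongCycles K) : (0 : ℝ) < n := by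
  have := hK.six_le
  exact_mod_cast (by omega : 0 < n)

lemma LongCycles.expect_cswap {E : Type*} [AddCommMonoid E] [Module ℚ≥0 E]
    (hK : LongCycles K) (a b : Fin n)
    (f : Equiv.Perm (Fin n) → E) : 𝔼 π ∈ K, f (cswap π a b) = 𝔼 π ∈ K, f π :=
  Finset.expect_nbij' (fun π => cswap π a b) (fun π => cswap π a b)
    (fun π h => hK.conj π h a b) (fun π h => hK.conj π h a b)
    (fun π _ => cswap_cswap π a b) (fun π _ => cswap_cswap π a b) (fun _ _ => rfl)

lemma LongCycles.edge_spread (hK : LongCycles K) (p q : Fin n) (R : Finset (Fin n))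
    (hp : p ∈ R) (hq : q ∉ R) (g : Equiv.Perm (Fin n) → ℝ) (hg0 : ∀ π, 0 ≤ g π)
    (hg : ∀ π, ∀ a ∉ R, ∀ b ∉ R, g (cswap π a b) = g π) :
    ((n : ℝ) - R.card) * 𝔼 π ∈ K, ind (π p = q) * g π ≤ 𝔼 π ∈ K, g π := by
  have h1 : ∀ b ∈ Rᶜ, 𝔼 π ∈ K, ind (π p = b) * g π = 𝔼 π ∈ K, ind (π p = q) * g π := by
    intro b hb
    have hb : b ∉ R := by simpa using hb
    rw [← hK.expect_cswap q b (fun π => ind (π p = q) * g π)]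
    refine Finset.expect_congr rfl fun π _ => ?_
    rw [hg π q hq b hb]
    congr 2
    have hpq : p ≠ q := fun e => hq (e ▸ hp)
    have hpb : p ≠ b := fun e => hb (e ▸ hp)
    rw [cswap_apply, Equiv.swap_apply_of_ne_of_ne hpq hpb, Equiv.swap_apply_eq_iff]
    simp
  have h2 : ((n : ℝ) - R.card) = ((Rᶜ).card : ℝ) := by
    rw [Finset.card_compl, Fintype.card_fin, Nat.cast_sub]
    simpa using Finset.card_le_univ R
  calc ((n : ℝ) - R.card) * 𝔼 π ∈ K, ind (π p = q) * g π
      = ∑ b ∈ Rᶜ, 𝔼 π ∈ K, ind (π p = b) * g π := by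
        rw [Finset.sum_congr rfl h1, Finset.sum_const, nsmul_eq_mul, h2]
    _ = 𝔼 π ∈ K, ∑ b ∈ Rᶜ, ind (π p = b) * g π := (Finset.expect_sum_comm _ _ _).symm
    _ ≤ 𝔼 π ∈ K, g π := by
        refine Finset.expect_le_expect fun π _ => ?_
        rw [← Finset.sum_mul]
        refine mul_le_of_le_one_left (hg0 π) ?_
        calc ∑ b ∈ Rᶜ, ind (π p = b) ≤ ∑ b, ind (π p = b) :=
              Finset.sum_le_sum_of_subset_of_nonneg (Finset.subset_univ _)
                fun _ _ _ => ind_nonneg _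
          _ = 1 := sum_ind_eq' _

lemma LongCycles.edge_one (hK : LongCycles K) (p q : Fin n) :
    𝔼 π ∈ K, ind (π p = q) ≤ 1 / ((n : ℝ) - 1) := by
  have h6 : (6 : ℝ) ≤ n := by exact_mod_cast hK.six_le
  by_cases hpq : p = q
  · subst hpq
    have : 𝔼 π ∈ K, ind (π p = p) = 0 := by
      rw [← Finset.expect_const_zero (s := K)]
      exact Finset.expect_congr rfl fun π h => ind_false (hK.ne_fix π h p)
    rw [this]
    apply div_nonneg <;> linarith
  · have h := hK.edge_spread p q {p} (by simp) (by simpa using Ne.symm hpq) (fun _ => 1)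
      (by simp) (by simp)
    rw [Finset.expect_const hK.nonempty] at h
    simp only [mul_one, Finset.card_singleton, Nat.cast_one] at h
    rw [le_div_iff₀ (by linarith)]
    linarith

lemma LongCycles.edge_one' (hK : LongCycles K) (p q : Fin n) :
    𝔼 π ∈ K, ind (π p = q) ≤ 2 / (n : ℝ) := by
  have h6 : (6 : ℝ) ≤ n := by exact_mod_cast hK.six_le
  refine (hK.edge_one p q).trans ?_
  rw [div_le_div_iff₀ (by linarith) (by linarith)]
  linarith

lemma LongCycles.edge_two_aux (hK : LongCycles K) {p p' q q' : Fin n}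
    (hq : q ≠ p) (hq1 : q ≠ p') (hq2 : q ≠ q') :
    𝔼 π ∈ K, ind (π p = q) * ind (π p' = q') ≤ 4 / (n : ℝ) ^ 2 := by
  have h6 : (6 : ℝ) ≤ n := by exact_mod_cast hK.six_le
  have h := hK.edge_spread p q {p, p', q'} (by simp) (by simp [hq, hq1, hq2])
    (fun π => ind (π p' = q')) (fun _ => ind_nonneg _) (by
      intro π a ha b hb
      simp only [Finset.mem_insert, Finset.mem_singleton, not_or] at ha hb
      congr 1
      rw [cswap_apply, Equiv.swap_apply_of_ne_of_ne (Ne.symm ha.2.1) (Ne.symm hb.2.1),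
        Equiv.swap_apply_eq_iff, Equiv.swap_apply_of_ne_of_ne (Ne.symm ha.2.2) (Ne.symm hb.2.2)])
  have h3 : (({p, p', q'} : Finset (Fin n)).card : ℝ) ≤ 3 := by
    exact_mod_cast Finset.card_le_three
  have h1 := hK.edge_one p' q'
  set X := 𝔼 π ∈ K, ind (π p = q) * ind (π p' = q') with hX
  have hX0 : 0 ≤ X := Finset.expect_nonneg fun _ _ => mul_nonneg (ind_nonneg _) (ind_nonneg _)
  have h4 : ((n : ℝ) - 3) * X ≤ 1 / ((n : ℝ) - 1) := by nlinarith
  rw [le_div_iff₀ (by linarith)] at h4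
  rw [le_div_iff₀ (by positivity)]
  nlinarith [mul_nonneg hX0 (by nlinarith : (0 : ℝ) ≤ 4 * ((n : ℝ) - 3) * (n - 1) - n ^ 2)]

lemma LongCycles.edge_two (hK : LongCycles K) {p p' q q' : Fin n} (hp : p ≠ p') :
    𝔼 π ∈ K, ind (π p = q) * ind (π p' = q') ≤ 4 / (n : ℝ) ^ 2 := by
  have hz : (∀ π ∈ K, ¬ (π p = q ∧ π p' = q')) →
      𝔼 π ∈ K, ind (π p = q) * ind (π p' = q') ≤ 4 / (n : ℝ) ^ 2 := by
    intro h
    have : 𝔼 π ∈ K, ind (π p = q) * ind (π p' = q') = 0 := by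
      rw [← Finset.expect_const_zero (s := K)]
      refine Finset.expect_congr rfl fun π hπ => ?_
      by_cases h1 : π p = q
      · rw [ind_false (fun h2 => h π hπ ⟨h1, h2⟩), mul_zero]
      · rw [ind_false h1, zero_mul]
    rw [this]; positivity
  by_cases h1 : q = p
  · exact hz fun π hπ h => hK.ne_fix π hπ p (h.1.trans h1)
  by_cases h2 : q = q'
  · exact hz fun π hπ h => hp (π.injective (h.1.trans (h2.trans h.2.symm)))
  by_cases h3 : q = p'
  · by_cases h4 : q' = p
    · exact hz fun π hπ h => hK.ne_two π hπ p (by rw [h.1, h3, h.2, h4])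
    by_cases h5 : q' = p'
    · exact hz fun π hπ h => hK.ne_fix π hπ p' (h.2.trans h5)
    · have := hK.edge_two_aux (p := p') (p' := p) (q := q') (q' := q) h5 h4 (Ne.symm h2)
      simpa only [mul_comm] using this
  · exact hK.edge_two_aux h1 h3 h2

/-- The configurations for which conjugation by the transposition `(π x, b)` acts on the
coordinates in `P` only by changing the value at `x` to `b`. -/
def Good (P : Finset (Fin n)) (x : Fin n) (π : Equiv.Perm (Fin n)) (b : Fin n) : Prop :=
  ∀ z ∈ P, π x ≠ z ∧ b ≠ z ∧ (z ≠ x → π z ≠ b)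

lemma Good.cswap_self {P : Finset (Fin n)} {x b : Fin n} {π : Equiv.Perm (Fin n)}
    (hx : x ∈ P) (h : Good P x π b) : cswap π (π x) b x = b := by
  rw [cswap_apply, Equiv.swap_apply_of_ne_of_ne (h x hx).1.symm (h x hx).2.1.symm,
    Equiv.swap_apply_left]

lemma Good.cswap_of_ne {P : Finset (Fin n)} {x b z : Fin n} {π : Equiv.Perm (Fin n)}
    (h : Good P x π b) (hz : z ∈ P) (hzx : z ≠ x) : cswap π (π x) b z = π z := by
  rw [cswap_apply, Equiv.swap_apply_of_ne_of_ne (h z hz).1.symm (h z hz).2.1.symm,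
    Equiv.swap_apply_of_ne_of_ne (fun e => hzx (π.injective e)) ((h z hz).2.2 hzx)]

lemma Good.cswap_eq {P : Finset (Fin n)} {x b z : Fin n} {π : Equiv.Perm (Fin n)}
    (hx : x ∈ P) (h : Good P x π b) (hz : z ∈ P) :
    cswap π (π x) b z = Function.update (⇑π) x b z := by
  by_cases hzx : z = x
  · subst hzx; rw [h.cswap_self hx]; simp
  · rw [h.cswap_of_ne hz hzx]; simp [hzx]

lemma Good.symm {P : Finset (Fin n)} {x b : Fin n} {π : Equiv.Perm (Fin n)}
    (hx : x ∈ P) (h : Good P x π b) : Good P x (cswap π (π x) b) (π x) := by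
  intro z hz
  refine ⟨by rw [h.cswap_self hx]; exact (h z hz).2.1, (h z hz).1, fun hzx => ?_⟩
  rw [h.cswap_of_ne hz hzx]
  exact fun e => hzx (π.injective e)

lemma LongCycles.expect_good (hK : LongCycles K) {P : Finset (Fin n)} {x : Fin n} (hx : x ∈ P)
    (F : Equiv.Perm (Fin n) → Fin n → ℂ) :
    𝔼 π ∈ K, 𝔼 b, (if Good P x π b then F π b else 0) =
      𝔼 π ∈ K, 𝔼 b, (if Good P x π b then F (cswap π (π x) b) (π x) else 0) := by
  rw [← Finset.expect_product' (s := K) (t := univ), ← Finset.expect_product' (s := K) (t := univ)]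
  have key : ∀ p : Equiv.Perm (Fin n) × Fin n, Good P x p.1 p.2 →
      cswap (cswap p.1 (p.1 x) p.2) (cswap p.1 (p.1 x) p.2 x) (p.1 x) = p.1 := by
    intro p h
    rw [h.cswap_self hx, cswap_comm, cswap_cswap]
  let φ : Equiv.Perm (Fin n) × Fin n → Equiv.Perm (Fin n) × Fin n := fun p =>
    if Good P x p.1 p.2 then (cswap p.1 (p.1 x) p.2, p.1 x) else p
  have hφ : ∀ p, φ (φ p) = p := by
    intro p
    by_cases h : Good P x p.1 p.2
    · simp only [φ, h, h.symm hx, if_true]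
      ext1
      · exact key p h
      · exact h.cswap_self hx
    · simp only [φ, h, if_false]
  have hm : ∀ p ∈ K ×ˢ (univ : Finset (Fin n)), φ p ∈ K ×ˢ (univ : Finset (Fin n)) := by
    intro p hp
    by_cases h : Good P x p.1 p.2
    · simp only [φ, h, if_true, Finset.mem_product, Finset.mem_univ, and_true]
      exact hK.conj _ (Finset.mem_product.mp hp).1 _ _
    · simpa only [φ, h, if_false] using hp
  refine Finset.expect_nbij' φ φ hm hm (fun p _ => hφ p) (fun p _ => hφ p) ?_
  intro p _
  by_cases h : Good P x p.1 p.2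
  · simp only [φ, h, h.symm hx, if_true]
    rw [key p h, h.cswap_self hx]
  · simp only [φ, h, if_false]

lemma ind_not_good_le (P : Finset (Fin n)) (x : Fin n) (π : Equiv.Perm (Fin n)) (b : Fin n) :
    ind (¬ Good P x π b) ≤
      ∑ z ∈ P, (ind (π x = z) + ind (b = z) + ind (z ≠ x ∧ π z = b)) := by
  have h0 : ∀ z ∈ P, 0 ≤ ind (π x = z) + ind (b = z) + ind (z ≠ x ∧ π z = b) := fun z _ =>
    add_nonneg (add_nonneg (ind_nonneg _) (ind_nonneg _)) (ind_nonneg _)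
  by_cases h : Good P x π b
  · rw [ind_false (not_not.mpr h)]
    exact Finset.sum_nonneg h0
  · rw [ind_true h]
    unfold Good at h
    push Not at h
    obtain ⟨z, hz, h⟩ := h
    refine le_trans ?_ (Finset.single_le_sum h0 hz)
    by_cases h1 : π x = z
    · rw [ind_true h1]; linarith [ind_nonneg (b = z), ind_nonneg (z ≠ x ∧ π z = b)]
    by_cases h2 : b = z
    · rw [ind_true h2]; linarith [ind_nonneg (π x = z), ind_nonneg (z ≠ x ∧ π z = b)]
    rw [ind_true (h h1 h2)]
    linarith [ind_nonneg (π x = z), ind_nonneg (b = z)]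

lemma expect_ind_eq (c : Fin n) : 𝔼 b : Fin n, ind (b = c) = 1 / n := by
  rw [Finset.expect_eq_sum_div_card, sum_ind_eq]
  simp

lemma expect_ind_eq' (c : Fin n) : 𝔼 b : Fin n, ind (c = b) = 1 / n := by
  rw [Finset.expect_eq_sum_div_card, sum_ind_eq']
  simp

lemma expect_ind_not_good_le (P : Finset (Fin n)) (x : Fin n) (π : Equiv.Perm (Fin n)) :
    𝔼 b, ind (¬ Good P x π b) ≤ ∑ z ∈ P, (ind (π x = z) + 2 / n) := by
  have : Nonempty (Fin n) := ⟨x⟩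
  refine (Finset.expect_le_expect fun b _ => ind_not_good_le P x π b).trans ?_
  rw [Finset.expect_sum_comm]
  refine Finset.sum_le_sum fun z _ => ?_
  rw [Finset.expect_add_distrib, Finset.expect_add_distrib, Fintype.expect_const, expect_ind_eq,
    add_assoc]
  have : 𝔼 b, ind (z ≠ x ∧ π z = b) ≤ 1 / n := by
    rw [← expect_ind_eq' (π z)]
    exact Finset.expect_le_expect fun b _ => ind_le_ind fun h => h.2
  have h2 : (2 : ℝ) / n = 1 / n + 1 / n := by ring
  rw [h2]
  linarith

lemma LongCycles.norm_expect_le (_hK : LongCycles K) (f : Equiv.Perm (Fin n) → ℂ)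
    (g : Equiv.Perm (Fin n) → ℝ) (h : ∀ π ∈ K, ‖f π‖ ≤ g π) : ‖𝔼 π ∈ K, f π‖ ≤ 𝔼 π ∈ K, g π :=
  (RCLike.norm_expect_le (K := ℂ)).trans (Finset.expect_le_expect h)

/-- Integration by parts: replacing `Θ` by its fluctuation at the coordinate `x`. -/
lemma LongCycles.swap_identity (hK : LongCycles K) {P : Finset (Fin n)} {x : Fin n} (hx : x ∈ P)
    {Θ : (Fin n → Fin n) → ℂ} (hΘ : DependsOn Θ (P : Set (Fin n))) {M : ℝ}
    (hM : ∀ U, ‖Θ U‖ ≤ M) (G : Equiv.Perm (Fin n) → ℂ) :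
    ‖𝔼 π ∈ K, (Θ π - avgAt x Θ π) * G π -
      𝔼 π ∈ K, 𝔼 b, (if Good P x π b then Θ π * (G π - G (cswap π (π x) b)) else 0)‖ ≤
      2 * M * 𝔼 π ∈ K, (∑ z ∈ P, (ind (π x = z) + 2 / n)) * ‖G π‖ := by
  have hM0 : 0 ≤ M := (norm_nonneg _).trans (hM id)
  have : Nonempty (Fin n) := ⟨x⟩
  have h1 : ∀ π : Equiv.Perm (Fin n), (Θ π - avgAt x Θ π) * G π =
      𝔼 b, (Θ π - Θ (Function.update π x b)) * G π := by
    intro π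
    rw [← Finset.expect_mul, Finset.expect_sub_distrib, Fintype.expect_const]
    rfl
  have h2 : 𝔼 π ∈ K, 𝔼 b, (if Good P x π b then Θ π * (G π - G (cswap π (π x) b)) else 0) =
      𝔼 π ∈ K, 𝔼 b,
        (if Good P x π b then (Θ π - Θ (Function.update π x b)) * G π else 0) := by
    have e := hK.expect_good hx (fun π b => Θ π * G (cswap π (π x) b))
    have e1 : 𝔼 π ∈ K, 𝔼 b, (if Good P x π b then Θ π * (G π - G (cswap π (π x) b)) else 0) =
        𝔼 π ∈ K, 𝔼 b, (if Good P x π b then Θ π * G π else 0) -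
        𝔼 π ∈ K, 𝔼 b, (if Good P x π b then Θ π * G (cswap π (π x) b) else 0) := by
      rw [← Finset.expect_sub_distrib]
      refine Finset.expect_congr rfl fun π _ => ?_
      rw [← Finset.expect_sub_distrib]
      refine Finset.expect_congr rfl fun b _ => ?_
      split_ifs <;> ring
    rw [e1, e, ← Finset.expect_sub_distrib]
    refine Finset.expect_congr rfl fun π _ => ?_
    rw [← Finset.expect_sub_distrib]
    refine Finset.expect_congr rfl fun b _ => ?_
    split_ifs with h
    · rw [h.cswap_self hx, cswap_comm _ b, cswap_cswap, hΘ (x := cswap π (π x) b) (y := Function.update π x b)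
        (fun z hz => h.cswap_eq hx hz)]
      ring
    · simp
  rw [h2, ← Finset.expect_sub_distrib, Finset.mul_expect]
  refine hK.norm_expect_le _ _ fun π _ => ?_
  rw [h1, ← Finset.expect_sub_distrib]
  calc _ ≤ 𝔼 b, 2 * M * ‖G π‖ * ind (¬ Good P x π b) := by
        refine (RCLike.norm_expect_le (K := ℂ)).trans (Finset.expect_le_expect fun b _ => ?_)
        by_cases h : Good P x π b
        · simp [h, ind]
        · rw [if_neg h, sub_zero, ind_true h, mul_one, norm_mul]
          refine mul_le_mul_of_nonneg_right ?_ (norm_nonneg _)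
          linarith [norm_sub_le (Θ π) (Θ (Function.update π x b)), hM π,
            hM (Function.update π x b)]
    _ = 2 * M * ‖G π‖ * 𝔼 b, ind (¬ Good P x π b) := by rw [Finset.mul_expect]
    _ ≤ 2 * M * ‖G π‖ * ∑ z ∈ P, (ind (π x = z) + 2 / n) :=
        mul_le_mul_of_nonneg_left (expect_ind_not_good_le P x π) (by positivity)
    _ = _ := by ring

end

section

variable {n : ℕ} {K : Finset (Equiv.Perm (Fin n))}

/-- A bounded statistic which varies by at most `δ` under conjugation by a transposition. -/
structure SlowVar (H : Equiv.Perm (Fin n) → ℂ) (δ : ℝ) : Prop where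
  norm_le : ∀ π, ‖H π‖ ≤ 1
  var_le : ∀ π a b, ‖H π - H (cswap π a b)‖ ≤ δ
  nonneg : 0 ≤ δ

lemma norm_ind (p : Prop) : ‖((ind p : ℝ) : ℂ)‖ = ind p := by
  rw [Complex.norm_real, Real.norm_of_nonneg (ind_nonneg p)]

/-- Conditionally on the value at one coordinate, a function of the other coordinates is close in
mean to its average over all words. -/
lemma LongCycles.edge_fluct (hK : LongCycles K) {P : Finset (Fin n)} {p₀ : Fin n} (hp : p₀ ∉ P)
    (q : Fin n) {Θ : (Fin n → Fin n) → ℂ} (hΘ : DependsOn Θ (P : Set (Fin n))) {M : ℝ}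
    (hM : ∀ U, ‖Θ U‖ ≤ M) {H : Equiv.Perm (Fin n) → ℂ} {δ : ℝ} (hH : SlowVar H δ) :
    ‖𝔼 π ∈ K, ((ind (π p₀ = q) : ℝ) : ℂ) * ((Θ π - 𝔼 U, Θ U) * H π)‖ ≤
      16 * M * ((P.card : ℝ) + 1) ^ 2 * (δ + 1 / n) / n := by
  have hM0 : 0 ≤ M := (norm_nonneg _).trans (hM id)
  have hn := hK.pos
  have hδ := hH.nonneg
  set P' := insert p₀ P with hP'
  have hc : (P'.card : ℝ) = P.card + 1 := by rw [hP', Finset.card_insert_of_notMem hp]; simp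
  have hsub : (P : Set (Fin n)) ⊆ (P' : Set (Fin n)) := by simp [hP']
  set G : Equiv.Perm (Fin n) → ℂ := fun π => ((ind (π p₀ = q) : ℝ) : ℂ) * H π with hG
  have hGn : ∀ π, ‖G π‖ ≤ ind (π p₀ = q) := by
    intro π
    rw [hG]; simp only [norm_mul, norm_ind]
    exact mul_le_of_le_one_right (ind_nonneg _) (hH.norm_le π)
  have hx : ∀ x ∈ P, ‖𝔼 π ∈ K, (tailAvg (x.val + 1) Θ π - avgAt x (tailAvg (x.val + 1) Θ) π) * G π‖
      ≤ 16 * M * ((P.card : ℝ) + 1) * (δ + 1 / n) / n := by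
    intro x hx
    have hxP' : x ∈ P' := by simp [hP', hx]
    have hxp : x ≠ p₀ := fun e => hp (e ▸ hx)
    have : Nonempty (Fin n) := ⟨x⟩
    have hM' := norm_tailAvg_le (x.val + 1) Θ M hM
    have h1 := hK.swap_identity hxP' ((dependsOn_tailAvg (x.val + 1) hΘ).mono hsub) hM' G
    have h2 : 𝔼 π ∈ K, (∑ z ∈ P', (ind (π x = z) + 2 / n)) * ‖G π‖ ≤
        8 * ((P.card : ℝ) + 1) / n ^ 2 := by
      calc _ ≤ 𝔼 π ∈ K, ∑ z ∈ P', (ind (π x = z) * ind (π p₀ = q) + 2 / n * ind (π p₀ = q)) := by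
            refine Finset.expect_le_expect fun π _ => ?_
            rw [Finset.sum_mul]
            refine Finset.sum_le_sum fun z _ => ?_
            rw [← add_mul]
            exact mul_le_mul_of_nonneg_left (hGn π) (add_nonneg (ind_nonneg _) (by positivity))
        _ = ∑ z ∈ P', (𝔼 π ∈ K, ind (π x = z) * ind (π p₀ = q) +
              2 / n * 𝔼 π ∈ K, ind (π p₀ = q)) := by
            rw [Finset.expect_sum_comm]
            refine Finset.sum_congr rfl fun z _ => ?_
            rw [Finset.expect_add_distrib, Finset.mul_expect]
        _ ≤ ∑ z ∈ P', (4 / n ^ 2 + 2 / n * (2 / n) : ℝ) := by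
            refine Finset.sum_le_sum fun z _ => ?_
            gcongr
            · exact hK.edge_two hxp
            · exact hK.edge_one' _ _
        _ = _ := by
            rw [Finset.sum_const, nsmul_eq_mul, hc]; field_simp; ring
    have h3 : ‖𝔼 π ∈ K, 𝔼 b, (if Good P' x π b then
        tailAvg (x.val + 1) Θ π * (G π - G (cswap π (π x) b)) else 0)‖ ≤ M * δ * (2 / n) := by
      calc _ ≤ 𝔼 π ∈ K, M * δ * ind (π p₀ = q) := by
            refine hK.norm_expect_le _ _ fun π _ => ?_
            have h0 : 0 ≤ M * δ * ind (π p₀ = q) :=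
              mul_nonneg (mul_nonneg hM0 hδ) (ind_nonneg _)
            refine norm_expect_le_of_le _ _ _ h0 fun b _ => ?_
            split_ifs with h
            · have e : cswap π (π x) b p₀ = π p₀ :=
                h.cswap_of_ne (by simp [hP']) (Ne.symm hxp)
              rw [hG]
              simp only [e, ← mul_sub, norm_mul, norm_ind]
              have := mul_le_mul (hM' π) (hH.var_le π (π x) b) (norm_nonneg _) hM0
              calc _ = ‖tailAvg (x.val + 1) Θ π‖ * ‖H π - H (cswap π (π x) b)‖ *
                    ind (π p₀ = q) := by ring
                _ ≤ _ := mul_le_mul_of_nonneg_right this (ind_nonneg _)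
            · simpa using h0
        _ = M * δ * 𝔼 π ∈ K, ind (π p₀ = q) := by rw [Finset.mul_expect]
        _ ≤ _ := mul_le_mul_of_nonneg_left (hK.edge_one' _ _) (mul_nonneg hM0 hδ)
    refine (norm_le_norm_add_norm_sub' _ _).trans ((add_comm _ _).le.trans
      ((add_le_add h1 h3).trans ?_))
    have h5 : 2 * M * (8 * ((P.card : ℝ) + 1) / n ^ 2) = 16 * M * ((P.card : ℝ) + 1) * (1 / n) / n := by
      field_simp; ring
    have h6 : M * δ * (2 / n) ≤ 16 * M * ((P.card : ℝ) + 1) * δ / n := by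
      rw [mul_div_assoc', div_le_div_iff_of_pos_right hn]
      have : 0 ≤ M * δ := mul_nonneg hM0 hδ
      have h7 : 0 ≤ M * δ * P.card := by positivity
      nlinarith
    calc _ ≤ 2 * M * (8 * ((P.card : ℝ) + 1) / n ^ 2) + M * δ * (2 / n) := by
          gcongr
      _ ≤ _ := by rw [h5]; linarith [h6, (by ring : 16 * M * ((P.card : ℝ) + 1) * (δ + 1 / n) / n = 16 * M * ((P.card : ℝ) + 1) * δ / n + 16 * M * ((P.card : ℝ) + 1) * (1 / n) / n)]
  have e : 𝔼 π ∈ K, ((ind (π p₀ = q) : ℝ) : ℂ) * ((Θ π - 𝔼 U, Θ U) * H π) =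
      ∑ x ∈ P, 𝔼 π ∈ K,
        (tailAvg (x.val + 1) Θ π - avgAt x (tailAvg (x.val + 1) Θ) π) * G π := by
    rw [← Finset.expect_sum_comm]
    refine Finset.expect_congr rfl fun π _ => ?_
    rw [← Finset.sum_mul, ← tailAvg_telescope hΘ]
    ring
  rw [e]
  refine (norm_sum_le_of_le _ hx).trans ?_
  rw [Finset.sum_const, nsmul_eq_mul]
  have h8 : 0 ≤ 16 * M * ((P.card : ℝ) + 1) * (δ + 1 / n) / n := by positivity
  calc _ ≤ ((P.card : ℝ) + 1) * (16 * M * ((P.card : ℝ) + 1) * (δ + 1 / n) / n) := by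
        gcongr; linarith
    _ = _ := by ring

lemma LongCycles.fluct (hK : LongCycles K) {P : Finset (Fin n)} (hp : P.card < n)
    {Θ : (Fin n → Fin n) → ℂ} (hΘ : DependsOn Θ (P : Set (Fin n))) {M : ℝ}
    (hM : ∀ U, ‖Θ U‖ ≤ M) {H : Equiv.Perm (Fin n) → ℂ} {δ : ℝ} (hH : SlowVar H δ) :
    ‖𝔼 π ∈ K, Θ π * H π - (𝔼 U, Θ U) * 𝔼 π ∈ K, H π‖ ≤
      16 * M * ((P.card : ℝ) + 1) ^ 2 * (δ + 1 / n) := by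
  have hn := hK.pos
  obtain ⟨p₀, hp₀⟩ : ∃ p₀, p₀ ∉ P := by
    by_contra! h
    have : P = univ := by ext x; simp [h x]
    rw [this, Finset.card_univ, Fintype.card_fin] at hp
    exact lt_irrefl _ hp
  have e : 𝔼 π ∈ K, Θ π * H π - (𝔼 U, Θ U) * 𝔼 π ∈ K, H π =
      ∑ q, 𝔼 π ∈ K, ((ind (π p₀ = q) : ℝ) : ℂ) * ((Θ π - 𝔼 U, Θ U) * H π) := by
    rw [← Finset.expect_sum_comm, Finset.mul_expect, ← Finset.expect_sub_distrib]
    refine Finset.expect_congr rfl fun π _ => ?_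
    rw [← Finset.sum_mul, ← Complex.ofReal_sum, sum_ind_eq']
    simp [sub_mul]
  rw [e]
  refine (norm_sum_le_of_le _ fun q _ => hK.edge_fluct hp₀ q hΘ hM hH).trans ?_
  rw [Finset.sum_const, nsmul_eq_mul, Finset.card_univ, Fintype.card_fin]
  exact le_of_eq (by field_simp)

lemma LongCycles.expect_not_good_le (hK : LongCycles K) (P : Finset (Fin n)) (x : Fin n) :
    𝔼 π ∈ K, ∑ z ∈ P, (ind (π x = z) + 2 / n) ≤ 4 * P.card / n := by
  rw [Finset.expect_sum_comm]
  calc _ ≤ ∑ z ∈ P, (4 / n : ℝ) := by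
        refine Finset.sum_le_sum fun z _ => ?_
        rw [Finset.expect_add_distrib, Finset.expect_const hK.nonempty]
        have := hK.edge_one' x z
        have h4 : (4 : ℝ) / n = 2 / n + 2 / n := by ring
        linarith
    _ = _ := by rw [Finset.sum_const, nsmul_eq_mul]; ring

/-- Two pair statistics agreeing on good configurations are close in mean. -/
lemma LongCycles.expect_sub_of_good (hK : LongCycles K) (P : Finset (Fin n)) (x : Fin n)
    (F F' : Equiv.Perm (Fin n) → Fin n → ℂ) {M : ℝ} (hM0 : 0 ≤ M)
    (hM : ∀ π b, ‖F π b - F' π b‖ ≤ M) (h : ∀ π b, Good P x π b → F π b = F' π b) :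
    ‖𝔼 π ∈ K, 𝔼 b, F π b - 𝔼 π ∈ K, 𝔼 b, F' π b‖ ≤ M * (4 * P.card / n) := by
  rw [← Finset.expect_sub_distrib]
  calc _ ≤ 𝔼 π ∈ K, M * ∑ z ∈ P, (ind (π x = z) + 2 / n) := by
        refine hK.norm_expect_le _ _ fun π _ => ?_
        rw [← Finset.expect_sub_distrib]
        calc _ ≤ 𝔼 b, M * ind (¬ Good P x π b) := by
              refine (RCLike.norm_expect_le (K := ℂ)).trans
                (Finset.expect_le_expect fun b _ => ?_)
              by_cases hg : Good P x π b
              · rw [h π b hg, sub_self, norm_zero]; exact mul_nonneg hM0 (ind_nonneg _)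
              · rw [ind_true hg, mul_one]; exact hM π b
          _ ≤ _ := by
              rw [← Finset.mul_expect]
              exact mul_le_mul_of_nonneg_left (expect_ind_not_good_le P x π) hM0
    _ ≤ _ := by
        rw [← Finset.mul_expect]
        exact mul_le_mul_of_nonneg_left (hK.expect_not_good_le P x) hM0

/-- First-order expansion of the covariance of `Θ` and `H`. -/
lemma LongCycles.first_order (hK : LongCycles K) {P : Finset (Fin n)}
    {Θ : (Fin n → Fin n) → ℂ} (hΘ : DependsOn Θ (P : Set (Fin n)))
    (hM : ∀ U, ‖Θ U‖ ≤ 1) {H : Equiv.Perm (Fin n) → ℂ} (hH : ∀ π, ‖H π‖ ≤ 1) :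
    ‖𝔼 π ∈ K, (Θ π - 𝔼 U, Θ U) * H π -
      ∑ x ∈ P, 𝔼 π ∈ K, 𝔼 b, tailAvg (x.val + 1) Θ π * (H π - H (cswap π (π x) b))‖ ≤
      16 * (P.card : ℝ) ^ 2 / n := by
  have hn := hK.pos
  have e : 𝔼 π ∈ K, (Θ π - 𝔼 U, Θ U) * H π =
      ∑ x ∈ P, 𝔼 π ∈ K,
        (tailAvg (x.val + 1) Θ π - avgAt x (tailAvg (x.val + 1) Θ) π) * H π := by
    rw [← Finset.expect_sum_comm]
    refine Finset.expect_congr rfl fun π _ => ?_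
    rw [← Finset.sum_mul, ← tailAvg_telescope hΘ]
  rw [e, ← Finset.sum_sub_distrib]
  calc _ ≤ ∑ x ∈ P, (16 * (P.card : ℝ) / n) := by
        refine norm_sum_le_of_le _ fun x hx => ?_
        have hM' := norm_tailAvg_le (x.val + 1) Θ 1 hM
        have h1 := hK.swap_identity hx (dependsOn_tailAvg (x.val + 1) hΘ) hM' H
        have h2 := hK.expect_sub_of_good P x
          (fun π b => if Good P x π b then
            tailAvg (x.val + 1) Θ π * (H π - H (cswap π (π x) b)) else 0)
          (fun π b => tailAvg (x.val + 1) Θ π * (H π - H (cswap π (π x) b)))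
          (M := 2) (by norm_num) (by
            intro π b
            by_cases h : Good P x π b
            · simp [h]
            · simp only [h, if_false, zero_sub, norm_neg, norm_mul]
              have h3 := hM' π
              have h4 : ‖H π - H (cswap π (π x) b)‖ ≤ 2 :=
                (norm_sub_le _ _).trans (by linarith [hH π, hH (cswap π (π x) b)])
              nlinarith [norm_nonneg (tailAvg (x.val + 1) Θ π),
                norm_nonneg (H π - H (cswap π (π x) b))])
          (by intro π b h; simp [h])
        have h3 : 𝔼 π ∈ K, (∑ z ∈ P, (ind (π x = z) + 2 / n)) * ‖H π‖ ≤ 4 * P.card / n := by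
          refine le_trans (Finset.expect_le_expect fun π _ => ?_) (hK.expect_not_good_le P x)
          refine mul_le_of_le_one_right (Finset.sum_nonneg fun z _ => ?_) (hH π)
          exact add_nonneg (ind_nonneg _) (by positivity)
        refine (norm_sub_le_norm_sub_add_norm_sub _ _ _).trans (add_le_add h1 h2 |>.trans ?_)
        calc _ ≤ 2 * 1 * (4 * P.card / n : ℝ) + 2 * (4 * P.card / n) := by gcongr
          _ = _ := by ring
    _ = _ := by rw [Finset.sum_const, nsmul_eq_mul]; ring

/-- The second-order term for two functions of arbitrary sets of coordinates. -/
lemma LongCycles.second_order (hK : LongCycles K) {P P' : Finset (Fin n)}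
    (hP : (P ∪ P').card < n)
    {Θ Θ' : (Fin n → Fin n) → ℂ} (hΘ : DependsOn Θ (P : Set (Fin n)))
    (hΘ' : DependsOn Θ' (P' : Set (Fin n)))
    (hM : ∀ U, ‖Θ U‖ ≤ 1) (hM' : ∀ U, ‖Θ' U‖ ≤ 1)
    {H : Equiv.Perm (Fin n) → ℂ} {δ : ℝ} (hH : SlowVar H δ) :
    ‖∑ x ∈ P, 𝔼 π ∈ K, 𝔼 b, tailAvg (x.val + 1) Θ π * (Θ' π - Θ' (cswap π (π x) b)) * H π -
      (𝔼 U, Θ U * Θ' U - (𝔼 U, Θ U) * 𝔼 U, Θ' U) * 𝔼 π ∈ K, H π‖ ≤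
      48 * ((P ∪ P').card + 1 : ℝ) ^ 3 * (δ + 1 / n) := by
  have hn := hK.pos
  have hδ := hH.nonneg
  have hnn : 0 < n := by exact_mod_cast hn
  have : Nonempty (Fin n) := ⟨⟨0, hnn⟩⟩
  set R := P ∪ P' with hR
  have hPR : (P : Set (Fin n)) ⊆ (R : Set (Fin n)) := by
    rw [hR]; exact_mod_cast Finset.subset_union_left
  have hPR' : (P' : Set (Fin n)) ⊆ (R : Set (Fin n)) := by
    rw [hR]; exact_mod_cast Finset.subset_union_right
  let Ψ : Fin n → (Fin n → Fin n) → ℂ := fun x U =>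
    tailAvg (x.val + 1) Θ U * (Θ' U - avgAt x Θ' U)
  have hcov : 𝔼 U, Θ U * Θ' U - (𝔼 U, Θ U) * 𝔼 U, Θ' U = ∑ x ∈ P, 𝔼 U, Ψ x U := by
    have e1 : ∀ x, 𝔼 U, Ψ x U =
        𝔼 U, (tailAvg (x.val + 1) Θ U - avgAt x (tailAvg (x.val + 1) Θ) U) * Θ' U := by
      intro x
      simp only [Ψ, mul_sub, sub_mul, Finset.expect_sub_distrib, expect_avgAt_mul]
    simp only [e1]
    rw [← Finset.expect_sum_comm, Finset.mul_expect, ← Finset.expect_sub_distrib]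
    refine Finset.expect_congr rfl fun U _ => ?_
    rw [← Finset.sum_mul, ← tailAvg_telescope hΘ]
    ring
  rw [hcov, Finset.sum_mul, ← Finset.sum_sub_distrib]
  have hx : ∀ x ∈ P, ‖𝔼 π ∈ K, 𝔼 b,
      tailAvg (x.val + 1) Θ π * (Θ' π - Θ' (cswap π (π x) b)) * H π -
      (𝔼 U, Ψ x U) * 𝔼 π ∈ K, H π‖ ≤ 48 * (R.card + 1 : ℝ) ^ 2 * (δ + 1 / n) := by
    intro x hx
    have hxR : x ∈ R := Finset.mem_union_left _ hx
    have ht := norm_tailAvg_le (x.val + 1) Θ 1 hM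
    have h1 := hK.expect_sub_of_good R x
      (fun π b => tailAvg (x.val + 1) Θ π * (Θ' π - Θ' (cswap π (π x) b)) * H π)
      (fun π b => tailAvg (x.val + 1) Θ π * (Θ' π - Θ' (Function.update π x b)) * H π)
      (M := 2) (by norm_num) (by
        intro π b
        have : tailAvg (x.val + 1) Θ π * (Θ' π - Θ' (cswap π (π x) b)) * H π -
          tailAvg (x.val + 1) Θ π * (Θ' π - Θ' (Function.update π x b)) * H π =
          tailAvg (x.val + 1) Θ π * (Θ' (Function.update π x b) - Θ' (cswap π (π x) b)) * H π := by
          ring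
        rw [this, norm_mul, norm_mul]
        have h4 : ‖Θ' (Function.update π x b) - Θ' (cswap π (π x) b)‖ ≤ 2 :=
          (norm_sub_le _ _).trans (add_le_add (hM' _) (hM' _) |>.trans (by norm_num))
        calc _ ≤ 1 * 2 * (1 : ℝ) := by
              gcongr
              · exact ht π
              · exact hH.norm_le π
          _ = 2 := by norm_num)
      (by
        intro π b hg
        have : Θ' (cswap π (π x) b) = Θ' (Function.update π x b) :=
          hΘ' fun z hz => hg.cswap_eq hxR (hPR' hz)
        simp only [this])
    have e : 𝔼 π ∈ K, 𝔼 b, tailAvg (x.val + 1) Θ π * (Θ' π - Θ' (Function.update π x b)) * H π =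
        𝔼 π ∈ K, Ψ x π * H π := by
      refine Finset.expect_congr rfl fun π _ => ?_
      rw [← Finset.expect_mul, ← Finset.mul_expect, Finset.expect_sub_distrib,
        Fintype.expect_const]
      rfl
    have h2 := hK.fluct (P := R) hP (Θ := Ψ x) (M := 2) (by
        intro U V hUV
        simp only [Ψ]
        rw [(dependsOn_tailAvg (x.val + 1) hΘ).mono hPR hUV, hΘ'.mono hPR' hUV,
          (dependsOn_avgAt x hΘ').mono hPR' hUV])
      (by
        intro U
        simp only [Ψ, norm_mul]
        have h4 : ‖Θ' U - avgAt x Θ' U‖ ≤ 2 :=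
          (norm_sub_le _ _).trans (by linarith [hM' U, norm_avgAt_le x Θ' 1 hM' U])
        calc _ ≤ 1 * (2 : ℝ) := by
              gcongr
              exact ht U
          _ = 2 := by norm_num) hH
    rw [e] at h1
    refine (norm_sub_le_norm_sub_add_norm_sub _ _ _).trans (add_le_add h1 h2 |>.trans ?_)
    have h5 : (2 * (4 * R.card / n) : ℝ) ≤ 8 * (R.card + 1 : ℝ) ^ 2 * (δ + 1 / n) := by
      calc (2 * (4 * R.card / n) : ℝ) = 8 * R.card * (0 + 1 / n) := by ring
        _ ≤ _ := by gcongr; nlinarith [(Nat.cast_nonneg R.card : (0 : ℝ) ≤ R.card)]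
    have h6 : 0 ≤ (R.card + 1 : ℝ) ^ 2 * (δ + 1 / n) := by positivity
    nlinarith
  refine (norm_sum_le_of_le _ hx).trans ?_
  rw [Finset.sum_const, nsmul_eq_mul]
  have h7 : (P.card : ℝ) ≤ R.card + 1 := by
    have : P.card ≤ R.card := Finset.card_le_card Finset.subset_union_left
    have : (P.card : ℝ) ≤ R.card := by exact_mod_cast this
    linarith
  calc _ ≤ (R.card + 1 : ℝ) * (48 * (R.card + 1 : ℝ) ^ 2 * (δ + 1 / n)) := by gcongr
    _ = _ := by ring

end

section

variable {n : ℕ} {K : Finset (Equiv.Perm (Fin n))}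

lemma sum_ind_mul (P : Finset (Fin n)) (c : Fin n) (f : Fin n → ℂ) :
    ∑ z ∈ P, ((ind (c = z) : ℝ) : ℂ) * f z = if c ∈ P then f c else 0 := by
  split_ifs with h
  · rw [Finset.sum_eq_single_of_mem c h]
    · simp [ind]
    · intro b _ hb
      simp [ind, Ne.symm hb]
  · refine Finset.sum_eq_zero fun z hz => ?_
    have : c ≠ z := fun e => h (e ▸ hz)
    simp [ind, this]

/-- Configurations in which conjugation by `(π x, b)` meets `P` in two ways at once. -/
noncomputable def coincidence (P : Finset (Fin n)) (x : Fin n) (π : Equiv.Perm (Fin n))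
    (b : Fin n) : ℝ :=
  (∑ z ∈ P, ∑ z' ∈ P, (ind (π z = b) * ind (π x = z') + ind (π z = z') * ind (b = z') +
    ind (π x = z) * ind (b = z'))) +
  ∑ z ∈ P, (ind (π x = z) * ind (b = x) + ind (π (π x) = z) * ind (b = z))

lemma coincidence_nonneg (P : Finset (Fin n)) (x : Fin n) (π : Equiv.Perm (Fin n))
    (b : Fin n) : 0 ≤ coincidence P x π b := by
  unfold coincidence
  have h := ind_nonneg
  refine add_nonneg (Finset.sum_nonneg fun z _ => Finset.sum_nonneg fun z' _ => ?_)
    (Finset.sum_nonneg fun z _ => ?_)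
  · exact add_nonneg (add_nonneg (mul_nonneg (h _) (h _)) (mul_nonneg (h _) (h _)))
      (mul_nonneg (h _) (h _))
  · exact add_nonneg (mul_nonneg (h _) (h _)) (mul_nonneg (h _) (h _))

lemma one_le_coincidence_pair {P : Finset (Fin n)} {x : Fin n} {π : Equiv.Perm (Fin n)}
    {b z z' : Fin n} (hz : z ∈ P) (hz' : z' ∈ P)
    (h : (π z = b ∧ π x = z') ∨ (π z = z' ∧ b = z') ∨ (π x = z ∧ b = z')) :
    1 ≤ coincidence P x π b := by
  have i := ind_nonneg
  have h0 : ∀ z z', 0 ≤ ind (π z = b) * ind (π x = z') + ind (π z = z') * ind (b = z') +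
      ind (π x = z) * ind (b = z') := fun z z' =>
    add_nonneg (add_nonneg (mul_nonneg (i _) (i _)) (mul_nonneg (i _) (i _)))
      (mul_nonneg (i _) (i _))
  have h1 : 1 ≤ ind (π z = b) * ind (π x = z') + ind (π z = z') * ind (b = z') +
      ind (π x = z) * ind (b = z') := by
    have a1 := mul_nonneg (i (π z = b)) (i (π x = z'))
    have a2 := mul_nonneg (i (π z = z')) (i (b = z'))
    have a3 := mul_nonneg (i (π x = z)) (i (b = z'))
    rcases h with ⟨h, h'⟩ | ⟨h, h'⟩ | ⟨h, h'⟩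
    · rw [ind_true h, ind_true h'] at *; linarith
    · rw [ind_true h, ind_true h'] at *; linarith
    · rw [ind_true h, ind_true h'] at *; linarith
  unfold coincidence
  have h2 : 0 ≤ ∑ z ∈ P, (ind (π x = z) * ind (b = x) + ind (π (π x) = z) * ind (b = z)) :=
    Finset.sum_nonneg fun z _ => add_nonneg (mul_nonneg (i _) (i _)) (mul_nonneg (i _) (i _))
  have h3 := Finset.single_le_sum (f := fun z' => ind (π z = b) * ind (π x = z') +
    ind (π z = z') * ind (b = z') + ind (π x = z) * ind (b = z')) (fun z' _ => h0 z z') hz'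
  have h4 := Finset.single_le_sum (f := fun z => ∑ z' ∈ P, (ind (π z = b) * ind (π x = z') +
    ind (π z = z') * ind (b = z') + ind (π x = z) * ind (b = z')))
    (fun z _ => Finset.sum_nonneg fun z' _ => h0 z z') hz
  linarith

lemma one_le_coincidence_single {P : Finset (Fin n)} {x : Fin n} {π : Equiv.Perm (Fin n)}
    {b z : Fin n} (hz : z ∈ P)
    (h : (π x = z ∧ b = x) ∨ (π (π x) = z ∧ b = z)) :
    1 ≤ coincidence P x π b := by
  have i := ind_nonneg
  have h0 : ∀ z, 0 ≤ ind (π x = z) * ind (b = x) + ind (π (π x) = z) * ind (b = z) := fun z =>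
    add_nonneg (mul_nonneg (i _) (i _)) (mul_nonneg (i _) (i _))
  have h1 : 1 ≤ ind (π x = z) * ind (b = x) + ind (π (π x) = z) * ind (b = z) := by
    have a1 := mul_nonneg (i (π x = z)) (i (b = x))
    have a2 := mul_nonneg (i (π (π x) = z)) (i (b = z))
    rcases h with ⟨h, h'⟩ | ⟨h, h'⟩
    · rw [ind_true h, ind_true h'] at *; linarith
    · rw [ind_true h, ind_true h'] at *; linarith
  have h2 := Finset.single_le_sum (f := fun z => ind (π x = z) * ind (b = x) +
    ind (π (π x) = z) * ind (b = z)) (fun z _ => h0 z) hz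
  unfold coincidence
  have h3 : 0 ≤ ∑ z ∈ P, ∑ z' ∈ P, (ind (π z = b) * ind (π x = z') +
      ind (π z = z') * ind (b = z') + ind (π x = z) * ind (b = z')) :=
    Finset.sum_nonneg fun z _ => Finset.sum_nonneg fun z' _ =>
      add_nonneg (add_nonneg (mul_nonneg (i _) (i _)) (mul_nonneg (i _) (i _)))
        (mul_nonneg (i _) (i _))
  linarith

lemma LongCycles.expect_coincidence_le (hK : LongCycles K) (P : Finset (Fin n)) (x : Fin n) :
    𝔼 π ∈ K, 𝔼 b, coincidence P x π b ≤ 12 * (P.card : ℝ) ^ 2 / n ^ 2 := by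
  have hn := hK.pos
  have hsq : 𝔼 π ∈ K, ∑ z ∈ P, ind (π (π x) = z) ≤ P.card * (4 / n) := by
    rw [Finset.expect_sum_comm, ← nsmul_eq_mul, ← Finset.sum_const]
    refine Finset.sum_le_sum fun z _ => ?_
    have e : ∀ π ∈ K, ind (π (π x) = z) = ∑ w, ind (π x = w) * ind (π w = z) := by
      intro π _
      rw [Finset.sum_eq_single (π x)]
      · simp [ind]
      · intro w _ hw; rw [ind_false (Ne.symm hw), zero_mul]
      · simp
    rw [Finset.expect_congr rfl e, Finset.expect_sum_comm]
    calc _ ≤ ∑ _w : Fin n, (4 / n ^ 2 : ℝ) := by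
          refine Finset.sum_le_sum fun w _ => ?_
          by_cases hw : x = w
          · have : 𝔼 π ∈ K, ind (π x = w) * ind (π w = z) = 0 := by
              rw [← Finset.expect_const_zero (s := K)]
              refine Finset.expect_congr rfl fun π hπ => ?_
              rw [ind_false (fun h => hK.ne_fix π hπ x (h.trans hw.symm)), zero_mul]
            rw [this]; positivity
          · exact hK.edge_two hw
      _ = 4 / n := by
          rw [Finset.sum_const, nsmul_eq_mul, Finset.card_univ, Fintype.card_fin]
          field_simp
  have h1 : ∀ π ∈ K, 𝔼 b, coincidence P x π b =
      (∑ z ∈ P, ∑ z' ∈ P, (1 / n * ind (π x = z') + 1 / n * ind (π z = z') +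
        1 / n * ind (π x = z))) + ∑ z ∈ P, (1 / n * ind (π x = z) +
        1 / n * ind (π (π x) = z)) := by
    intro π _
    unfold coincidence
    simp only [Finset.expect_add_distrib, Finset.expect_sum_comm, ← Finset.mul_expect,
      ← Finset.expect_mul, expect_ind_eq, expect_ind_eq', mul_comm]
  rw [Finset.expect_congr rfl h1]
  simp only [Finset.expect_add_distrib, Finset.expect_sum_comm, ← Finset.mul_expect]
  rw [Finset.sum_add_distrib, ← Finset.mul_sum (f := fun z => 𝔼 π ∈ K, ind (π (π x) = z)),
    ← Finset.expect_sum_comm]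
  have b1 : ∑ z ∈ P, ∑ z' ∈ P, (1 / n * 𝔼 π ∈ K, ind (π x = z') +
      1 / n * 𝔼 π ∈ K, ind (π z = z') + 1 / n * 𝔼 π ∈ K, ind (π x = z)) ≤
      ∑ z ∈ P, ∑ z' ∈ P, (1 / n * (2 / n) + 1 / n * (2 / n) + 1 / n * (2 / n) : ℝ) := by
    gcongr <;> exact hK.edge_one' _ _
  have b2 : ∑ z ∈ P, 1 / n * 𝔼 π ∈ K, ind (π x = z) ≤ ∑ z ∈ P, (1 / n * (2 / n) : ℝ) := by
    gcongr; exact hK.edge_one' _ _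
  have b3 : 1 / n * 𝔼 π ∈ K, ∑ z ∈ P, ind (π (π x) = z) ≤ 1 / n * (P.card * (4 / n)) := by
    gcongr
  refine (add_le_add b1 (add_le_add b2 b3)).trans ?_
  simp only [Finset.sum_const, nsmul_eq_mul]
  have hp : (P.card : ℝ) ≤ (P.card : ℝ) ^ 2 := by
    exact_mod_cast Nat.le_self_pow (by norm_num) _
  have : (12 * (P.card : ℝ) ^ 2 / n ^ 2) = (6 * (P.card : ℝ) ^ 2 + 6 * (P.card : ℝ) ^ 2) / n ^ 2 := by
    ring
  rw [this]
  calc _ = (6 * (P.card : ℝ) ^ 2 + 6 * (P.card : ℝ)) / n ^ 2 := by field_simp; ring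
    _ ≤ _ := by gcongr

/-- Contribution of the first-level coincidences to `Θ π - Θ (cswap π (π x) b)`. -/
noncomputable def flipTerm (P : Finset (Fin n)) (Θ : (Fin n → Fin n) → ℂ) (x : Fin n)
    (π : Equiv.Perm (Fin n)) (b : Fin n) : ℂ :=
  (∑ z ∈ P, ((ind (π z = b) : ℝ) : ℂ) * (Θ π - Θ (Function.update π z (π x)))) +
  (∑ z ∈ P, ((ind (π x = z) : ℝ) : ℂ) * (Θ π - Θ (Function.update π z (π b)))) +
  ∑ z ∈ P, ((ind (b = z) : ℝ) : ℂ) * (Θ π - Θ (Function.update π z (π (π x))))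

lemma flipTerm_eq (P : Finset (Fin n)) (Θ : (Fin n → Fin n) → ℂ) (x : Fin n)
    (π : Equiv.Perm (Fin n)) (b : Fin n) : flipTerm P Θ x π b =
    (if π.symm b ∈ P then (Θ π - Θ (Function.update π (π.symm b) (π x))) else 0) +
    (if π x ∈ P then (Θ π - Θ (Function.update π (π x) (π b))) else 0) +
    (if b ∈ P then (Θ π - Θ (Function.update π b (π (π x)))) else 0) := by
  unfold flipTerm
  rw [sum_ind_mul, sum_ind_mul]
  congr 2
  rw [← sum_ind_mul P (π.symm b) (fun z => Θ π - Θ (Function.update π z (π x)))]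
  refine Finset.sum_congr rfl fun z _ => ?_
  rw [show (π z = b) = (π.symm b = z) from propext (by rw [Equiv.symm_apply_eq, eq_comm])]

lemma norm_flip_sub_le {P : Finset (Fin n)} {Θ : (Fin n → Fin n) → ℂ}
    (hΘ : DependsOn Θ (P : Set (Fin n))) (hM : ∀ U, ‖Θ U‖ ≤ 1) {x : Fin n} (hx : x ∉ P)
    {π : Equiv.Perm (Fin n)} (hfix : ∀ y, π y ≠ y) (b : Fin n) :
    ‖Θ π - Θ (cswap π (π x) b) - flipTerm P Θ x π b‖ ≤ 8 * coincidence P x π b := by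
  have hd : ∀ U V, ‖Θ U - Θ V‖ ≤ 2 := fun U V =>
    (norm_sub_le _ _).trans (by linarith [hM U, hM V])
  by_cases hc : 1 ≤ coincidence P x π b
  · have h1 : ‖flipTerm P Θ x π b‖ ≤ 2 + 2 + 2 := by
      rw [flipTerm_eq]
      refine (norm_add₃_le).trans (add_le_add (add_le_add ?_ ?_) ?_) <;>
      · split_ifs
        · exact hd _ _
        · simp
    refine (norm_sub_le _ _).trans ?_
    linarith [hd π (cswap π (π x) b)]
  · have key : Θ π - Θ (cswap π (π x) b) = flipTerm P Θ x π b := by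
      have hP1 : ∀ z ∈ P, ∀ z' ∈ P, ¬ ((π z = b ∧ π x = z') ∨ (π z = z' ∧ b = z') ∨
          (π x = z ∧ b = z')) := fun z hz z' hz' h => hc (one_le_coincidence_pair hz hz' h)
      have hP2 : ∀ z ∈ P, ¬ ((π x = z ∧ b = x) ∨ (π (π x) = z ∧ b = z)) :=
        fun z hz h => hc (one_le_coincidence_single hz h)
      push Not at hP1 hP2
      rw [flipTerm_eq]
      have hzx : ∀ z ∈ P, π z ≠ π x := fun z hz e => hx (π.injective e ▸ hz)
      have base : ∀ z ∈ P, z ≠ π x → z ≠ b → π z ≠ b → cswap π (π x) b z = π z := by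
        intro z hz h1 h2 h3
        rw [cswap_apply, Equiv.swap_apply_of_ne_of_ne h1 h2,
          Equiv.swap_apply_of_ne_of_ne (hzx z hz) h3]
      by_cases hA : π x ∈ P
      · have hb : b ∉ P := fun hb => (hP1 (π x) hA b hb).2.2 rfl rfl
        have hs : π.symm b ∉ P := fun hs => (hP1 _ hs _ hA).1 (by simp) rfl
        rw [if_neg hb, if_neg hs, if_pos hA, zero_add, add_zero]
        congr 1
        refine hΘ fun z hz => ?_
        by_cases h : z = π x
        · subst h
          have hbx : π b ≠ π x := fun e => (hP2 _ hA).1 rfl (π.injective e)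
          rw [cswap_apply, Equiv.swap_apply_left, Equiv.swap_apply_of_ne_of_ne hbx (hfix b)]
          simp
        · rw [base z hz h (fun e => hb (e ▸ hz))
            (fun e => hs (by rw [← e]; simpa using hz))]
          simp [h]
      · rw [if_neg hA, add_zero]
        by_cases hb : b ∈ P
        · have hs : π.symm b ∉ P := fun hs => (hP1 _ hs _ hb).2.1 (by simp) rfl
          rw [if_neg hs, if_pos hb, zero_add]
          congr 1
          refine hΘ fun z hz => ?_
          by_cases h : z = b
          · subst h
            have hbx : π (π x) ≠ z := fun e => (hP2 _ hb).2 e rfl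
            rw [cswap_apply, Equiv.swap_apply_right,
              Equiv.swap_apply_of_ne_of_ne (hfix _) hbx]
            simp
          · rw [base z hz (fun e => hA (e ▸ hz)) h
              (fun e => hs (by rw [← e]; simpa using hz))]
            simp [h]
        · rw [if_neg hb, add_zero]
          by_cases hs : π.symm b ∈ P
          · rw [if_pos hs]
            congr 1
            refine hΘ fun z hz => ?_
            by_cases h : z = π.symm b
            · have h' : π z = b := by rw [h]; simp
              have h1 : z ≠ π x := fun e => hA (e ▸ hz)
              have h2 : z ≠ b := fun e => hb (e ▸ hz)
              rw [cswap_apply, Equiv.swap_apply_of_ne_of_ne h1 h2, h', Equiv.swap_apply_right, h]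
              simp
            · rw [base z hz (fun e => hA (e ▸ hz)) (fun e => hb (e ▸ hz))
                (fun e => h (by rw [← e]; simp))]
              simp [h]
          · rw [if_neg hs]
            rw [hΘ (x := cswap π (π x) b) (y := π), sub_self]
            intro z hz
            exact base z hz (fun e => hA (e ▸ hz)) (fun e => hb (e ▸ hz))
              (fun e => hs (by rw [← e]; simpa using hz))
    rw [key, sub_self, norm_zero]
    exact mul_nonneg (by norm_num) (coincidence_nonneg _ _ _ _)

end

section

variable {n : ℕ} {K : Finset (Equiv.Perm (Fin n))}

lemma sum_ind_card {α : Type*} (s : Finset α) (p : α → Prop) :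
    ∑ a ∈ s, ind (p a) = ((s.filter p).card : ℝ) := by
  simp only [ind]
  rw [← Finset.sum_filter, Finset.sum_const, nsmul_eq_mul, mul_one]

lemma dependsOn_update {S : Finset (Fin n)} {Θ : (Fin n → Fin n) → ℂ}
    (h : DependsOn Θ (S : Set (Fin n))) (x : Fin n) {T : Finset (Fin n)}
    (hT : S \ {x} ⊆ T) (f : (Fin n → Fin n) → Fin n) (hf : DependsOn f (T : Set (Fin n))) :
    DependsOn (fun U => Θ (Function.update U x (f U))) (T : Set (Fin n)) := by
  intro U V hUV
  refine h fun i hi => ?_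
  by_cases hix : i = x
  · subst hix; simp [hf hUV]
  · have : i ∈ T := hT (by simpa [hix] using hi)
    simp [hix, hUV i this]

lemma expect_ofReal_ind (c : Fin n) : 𝔼 b : Fin n, ((ind (c = b) : ℝ) : ℂ) = 1 / n := by
  rw [← Complex.ofReal_expect, expect_ind_eq']
  simp

lemma expect_perm_apply (π : Equiv.Perm (Fin n)) (f : Fin n → ℂ) :
    𝔼 b, f (π b) = 𝔼 b, f b :=
  Fintype.expect_equiv π _ _ fun _ => rfl

lemma expect_update_apply {P : Finset (Fin n)} {q z : Fin n} {Θ : (Fin n → Fin n) → ℂ}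
    (hΘ : DependsOn Θ (P : Set (Fin n))) (hq : q ∉ P) :
    𝔼 U, Θ (Function.update U z (U q)) = 𝔼 U, Θ U := by
  rw [← expect_update q (fun U => Θ (Function.update U z (U q))), ← expect_update z Θ]
  refine Finset.expect_congr rfl fun U _ => Finset.expect_congr rfl fun b _ => ?_
  refine hΘ fun i hi => ?_
  have : i ≠ q := fun e => hq (e ▸ hi)
  by_cases h : i = z
  · subst h; simp
  · simp [h, this]

section
variable {P P' : Finset (Fin n)} {x : Fin n} {Θ Θ' : (Fin n → Fin n) → ℂ}
    {H : Equiv.Perm (Fin n) → ℂ} {δ : ℝ}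

lemma LongCycles.flip_outgoing (hK : LongCycles K) (hx : x ∈ P)
    (hPP : Disjoint P P') (hc : (P ∪ P').card < n)
    (hΘ : DependsOn Θ (P : Set (Fin n))) (hΘ' : DependsOn Θ' (P' : Set (Fin n)))
    (hM : ∀ U, ‖Θ U‖ ≤ 1) (hM' : ∀ U, ‖Θ' U‖ ≤ 1)
    {c : ℂ} (hJ : ∀ y, ∑ z ∈ P', 𝔼 V, Θ' (Function.update V z y) = c) (hH : SlowVar H δ) :
    ‖𝔼 π ∈ K, 𝔼 b, Θ π * (∑ z ∈ P', ((ind (π z = b) : ℝ) : ℂ) *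
      (Θ' π - Θ' (Function.update π z (π x)))) * H π‖ ≤
      32 * P'.card * ((P ∪ P').card + 1 : ℝ) ^ 2 * (δ + 1 / n) / n := by
  have hn := hK.pos
  have hd : ∀ U V, ‖Θ' U - Θ' V‖ ≤ 2 := fun U V =>
    (norm_sub_le _ _).trans (by linarith [hM' U, hM' V])
  set Ψ : (Fin n → Fin n) → ℂ := fun U =>
    Θ U * ∑ z ∈ P', (Θ' U - Θ' (Function.update U z (U x))) with hΨ
  have e : 𝔼 π ∈ K, 𝔼 b, Θ π * (∑ z ∈ P', ((ind (π z = b) : ℝ) : ℂ) *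
      (Θ' π - Θ' (Function.update π z (π x)))) * H π = 1 / n * 𝔼 π ∈ K, Ψ π * H π := by
    rw [Finset.mul_expect]
    refine Finset.expect_congr rfl fun π _ => ?_
    rw [← Finset.expect_mul, ← Finset.mul_expect, Finset.expect_sum_comm]
    simp only [← Finset.expect_mul, expect_ofReal_ind, ← Finset.mul_sum, hΨ]
    ring
  have hxP' : x ∉ P' := Finset.disjoint_left.mp hPP hx
  have hc' : c = ∑ z ∈ P', 𝔼 V, Θ' V := by
    rw [← expect_const_of_pos x.pos c, ← Finset.expect_congr rfl fun y _ => hJ y,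
      Finset.expect_sum_comm]
    refine Finset.sum_congr rfl fun z _ => ?_
    rw [Finset.expect_comm, expect_update]
  have h0 : 𝔼 U, Ψ U = 0 := by
    have e1 : 𝔼 U, Θ U * ∑ z ∈ P', Θ' (Function.update U z (U x)) = (𝔼 U, Θ U) * c := by
      have e2 : 𝔼 U : Fin n → Fin n, 𝔼 V : Fin n → Fin n,
            Θ V * ∑ z ∈ P', Θ' (Function.update U z (V x)) =
          𝔼 U, Θ U * ∑ z ∈ P', Θ' (Function.update U z (U x)) := by
        rw [expect_resample P']
        rw [← expect_fun_const (n := n) (𝔼 U, Θ U * ∑ z ∈ P', Θ' (Function.update U z (U x)))]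
        refine Finset.expect_congr rfl fun U _ => Finset.expect_congr rfl fun V _ => ?_
        refine congrArg₂ (· * ·) ?_ ?_
        · refine hΘ fun i hi => ?_
          have : i ∉ P' := Finset.disjoint_left.mp hPP hi
          simp [this]
        · refine Finset.sum_congr rfl fun z _ => hΘ' fun i hi => ?_
          have hi' : i ∈ P' := hi
          by_cases h : i = z
          · subst h; simp [hxP']
          · simp [h, hi']
      rw [← e2, Finset.expect_comm, Finset.expect_mul]
      refine Finset.expect_congr rfl fun V _ => ?_
      rw [← Finset.mul_expect, Finset.expect_sum_comm, hJ]
    simp only [hΨ, Finset.sum_sub_distrib, mul_sub]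
    rw [Finset.expect_sub_distrib, e1, hc', Finset.mul_sum]
    simp only [Finset.mul_sum]
    rw [Finset.expect_sum_comm, sub_eq_zero]
    exact Finset.sum_congr rfl fun z _ => expect_mul_of_disjoint hΘ hΘ' hPP
  have hdep : DependsOn Ψ ((P ∪ P' : Finset (Fin n)) : Set (Fin n)) := by
    intro U V hUV
    have hxe : U x = V x := hUV x (by simp [hx])
    have a1 : Θ U = Θ V := hΘ fun i hi => hUV i (by simpa using Or.inl hi)
    have a2 : ∀ i ∈ P', U i = V i := fun i hi => hUV i (by simp [hi])
    simp only [hΨ, a1]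
    congr 1
    refine Finset.sum_congr rfl fun z _ => ?_
    rw [hΘ' (x := U) (y := V) a2, hxe]
    congr 1
    refine hΘ' fun i hi => ?_
    by_cases h : i = z
    · subst h; simp
    · simp [h, a2 i hi]
  have h1 := hK.fluct (P := P ∪ P') hc (Θ := Ψ) (M := 2 * P'.card) hdep (by
    intro U
    rw [hΨ]
    simp only [norm_mul]
    have : ‖∑ z ∈ P', (Θ' U - Θ' (Function.update U z (U x)))‖ ≤ ∑ _z ∈ P', (2 : ℝ) :=
      norm_sum_le_of_le _ fun z _ => hd _ _
    rw [Finset.sum_const, nsmul_eq_mul] at this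
    nlinarith [hM U, norm_nonneg (Θ U),
      norm_nonneg (∑ z ∈ P', (Θ' U - Θ' (Function.update U z (U x))))]) hH
  rw [h0, zero_mul, sub_zero] at h1
  rw [e, norm_mul]
  have : ‖(1 / n : ℂ)‖ = 1 / n := by simp
  rw [this]
  calc _ ≤ 1 / (n : ℝ) * (16 * (2 * P'.card) * ((P ∪ P').card + 1 : ℝ) ^ 2 * (δ + 1 / n)) := by
        gcongr
    _ = _ := by ring

lemma LongCycles.flip_incoming (hK : LongCycles K) (hx : x ∈ P)
    (hPP : Disjoint P P')
    (hΘ : DependsOn Θ (P : Set (Fin n))) (hΘ' : DependsOn Θ' (P' : Set (Fin n)))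
    (hM : ∀ U, ‖Θ U‖ ≤ 1) (hM' : ∀ U, ‖Θ' U‖ ≤ 1) (hH : SlowVar H δ) :
    ‖𝔼 π ∈ K, 𝔼 b, Θ π * (∑ z ∈ P', ((ind (π x = z) : ℝ) : ℂ) *
      (Θ' π - Θ' (Function.update π z (π b)))) * H π‖ ≤
      32 * P'.card * ((P ∪ P').card + 1 : ℝ) ^ 2 * (δ + 1 / n) / n := by
  have hn := hK.pos
  have hδ := hH.nonneg
  have : Nonempty (Fin n) := ⟨x⟩
  have hxP' : x ∉ P' := Finset.disjoint_left.mp hPP hx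
  set T := (P ∪ P').erase x with hT
  have hTc : T.card ≤ (P ∪ P').card := Finset.card_le_card (Finset.erase_subset _ _)
  have hP'T : P' ⊆ T := fun i hi => by
    have : i ≠ x := fun e => hxP' (e ▸ hi)
    simp [hT, this, hi]
  have e : 𝔼 π ∈ K, 𝔼 b, Θ π * (∑ z ∈ P', ((ind (π x = z) : ℝ) : ℂ) *
      (Θ' π - Θ' (Function.update π z (π b)))) * H π =
      ∑ z ∈ P', 𝔼 π ∈ K, ((ind (π x = z) : ℝ) : ℂ) *
        ((Θ (Function.update π x z) * (Θ' π - avgAt z Θ' π)) * H π) := by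
    rw [← Finset.expect_sum_comm]
    refine Finset.expect_congr rfl fun π _ => ?_
    rw [← Finset.expect_mul, ← Finset.mul_expect, Finset.expect_sum_comm, Finset.mul_sum,
      Finset.sum_mul]
    refine Finset.sum_congr rfl fun z _ => ?_
    rw [← Finset.mul_expect, Finset.expect_sub_distrib, Fintype.expect_const,
      expect_perm_apply π (fun y => Θ' (Function.update π z y))]
    by_cases h : π x = z
    · have : Function.update (⇑π) x z = π := by rw [← h]; simp
      rw [this, avgAt]; ring
    · rw [ind_false h]; simp
  rw [e]
  refine (norm_sum_le_of_le (n := fun _ => 32 * ((P ∪ P').card + 1 : ℝ) ^ 2 * (δ + 1 / n) / n)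
    _ fun z hz => ?_).trans ?_
  · set Ψ : (Fin n → Fin n) → ℂ := fun U =>
      Θ (Function.update U x z) * (Θ' U - avgAt z Θ' U) with hΨ
    have d1 : DependsOn (fun U => Θ (Function.update U x z)) (P : Set (Fin n)) :=
      dependsOn_update hΘ x Finset.sdiff_subset (fun _ => z) (fun _ _ _ => rfl)
    have d2 : DependsOn (fun U => Θ' U - avgAt z Θ' U) (P' : Set (Fin n)) := by
      intro U V hUV
      simp only [hΘ' hUV, dependsOn_avgAt z hΘ' hUV]
    have h0 : 𝔼 U, Ψ U = 0 := by
      rw [hΨ, expect_mul_of_disjoint d1 d2 hPP, Finset.expect_sub_distrib, expect_avgAt]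
      simp
    have d3 : DependsOn (fun U => Θ (Function.update U x z)) (T : Set (Fin n)) :=
      dependsOn_update hΘ x (by
        intro i hi
        simp only [Finset.mem_sdiff, Finset.mem_singleton] at hi
        simp [hT, hi.1, hi.2]) (fun _ => z) (fun _ _ _ => rfl)
    have h1 := hK.edge_fluct (P := T) (p₀ := x) (by simp [hT]) z (Θ := Ψ) (M := 2) (by
      intro U V hUV
      have a1 := d3 hUV
      have a2 := d2.mono (by exact_mod_cast hP'T) hUV
      simp only at a1 a2
      simp only [hΨ, a1, a2]) (by
      intro U
      simp only [hΨ, norm_mul]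
      have h4 : ‖Θ' U - avgAt z Θ' U‖ ≤ 2 :=
        (norm_sub_le _ _).trans (by linarith [hM' U, norm_avgAt_le z Θ' 1 hM' U])
      calc _ ≤ 1 * (2 : ℝ) := by
            gcongr
            exact hM _
        _ = 2 := by norm_num) hH
    rw [h0] at h1
    simp only [sub_zero] at h1
    refine h1.trans ?_
    have : (T.card : ℝ) ≤ (P ∪ P').card := by exact_mod_cast hTc
    calc _ ≤ 16 * 2 * ((P ∪ P').card + 1 : ℝ) ^ 2 * (δ + 1 / n) / n := by gcongr
      _ = _ := by ring
  · rw [Finset.sum_const, nsmul_eq_mul]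
    exact le_of_eq (by ring)

lemma LongCycles.flip_second (hK : LongCycles K) (hx : x ∈ P)
    (hPP : Disjoint P P')
    (hΘ : DependsOn Θ (P : Set (Fin n))) (hΘ' : DependsOn Θ' (P' : Set (Fin n)))
    (hM : ∀ U, ‖Θ U‖ ≤ 1) (hM' : ∀ U, ‖Θ' U‖ ≤ 1) (hH : SlowVar H δ) :
    ‖𝔼 π ∈ K, 𝔼 b, Θ π * (∑ z ∈ P', ((ind (b = z) : ℝ) : ℂ) *
      (Θ' π - Θ' (Function.update π z (π (π x))))) * H π‖ ≤
      36 * P'.card * ((P ∪ P').card + 1 : ℝ) ^ 2 * (δ + 1 / n) / n := by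
  have hn := hK.pos
  have hδ := hH.nonneg
  have hd : ∀ U V, ‖Θ' U - Θ' V‖ ≤ 2 := fun U V =>
    (norm_sub_le _ _).trans (by linarith [hM' U, hM' V])
  have hxP' : x ∉ P' := Finset.disjoint_left.mp hPP hx
  set R := P ∪ P' with hR
  have e : 𝔼 π ∈ K, 𝔼 b, Θ π * (∑ z ∈ P', ((ind (b = z) : ℝ) : ℂ) *
      (Θ' π - Θ' (Function.update π z (π (π x))))) * H π =
      ∑ z ∈ P', 1 / (n : ℂ) * ∑ q, 𝔼 π ∈ K, ((ind (π x = q) : ℝ) : ℂ) *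
        ((Θ (Function.update π x q) * (Θ' π - Θ' (Function.update π z (π q)))) * H π) := by
    simp only [← Finset.expect_sum_comm, Finset.mul_expect]
    refine Finset.expect_congr rfl fun π _ => ?_
    rw [← Finset.expect_mul, ← Finset.mul_expect, Finset.expect_sum_comm, Finset.mul_sum,
      Finset.sum_mul]
    refine Finset.sum_congr rfl fun z _ => ?_
    rw [← Finset.expect_mul]
    have h1 : 𝔼 b : Fin n, ((ind (b = z) : ℝ) : ℂ) = 1 / n := by
      rw [← expect_ofReal_ind z]
      exact Finset.expect_congr rfl fun b _ => by rw [show (b = z) = (z = b) from propext eq_comm]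
    rw [h1, Finset.sum_eq_single (π x)]
    · rw [ind_true rfl, Function.update_eq_self]; push_cast; ring
    · intro q _ hq
      rw [ind_false (Ne.symm hq)]; simp
    · simp
  rw [e]
  have hq : ∀ z ∈ P', ∀ q, ‖𝔼 π ∈ K, ((ind (π x = q) : ℝ) : ℂ) *
        ((Θ (Function.update π x q) * (Θ' π - Θ' (Function.update π z (π q)))) * H π)‖ ≤
        32 * (R.card + 1 : ℝ) ^ 2 * (δ + 1 / n) / n + 4 / n * ind (q ∈ R) := by
    intro z hz q
    have hb : ∀ U : Fin n → Fin n, ‖Θ (Function.update U x q) *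
        (Θ' U - Θ' (Function.update U z (U q)))‖ ≤ 2 := by
      intro U
      rw [norm_mul]
      calc _ ≤ 1 * (2 : ℝ) := by
            gcongr
            · exact hM _
            · exact hd _ _
        _ = 2 := by norm_num
    by_cases hqR : q ∈ R
    · rw [ind_true hqR]
      have h1 : ‖𝔼 π ∈ K, ((ind (π x = q) : ℝ) : ℂ) *
        ((Θ (Function.update π x q) * (Θ' π - Θ' (Function.update π z (π q)))) * H π)‖ ≤
          4 / n := by
        calc _ ≤ 𝔼 π ∈ K, ind (π x = q) * 2 := by
              refine hK.norm_expect_le _ _ fun π _ => ?_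
              rw [norm_mul, norm_ind, norm_mul]
              refine mul_le_mul_of_nonneg_left ?_ (ind_nonneg _)
              calc _ ≤ 2 * (1 : ℝ) := by
                    gcongr
                    · exact hb π
                    · exact hH.norm_le π
                _ = 2 := by norm_num
          _ ≤ 2 / n * 2 := by
              rw [← Finset.expect_mul]
              exact mul_le_mul_of_nonneg_right (hK.edge_one' x q) (by norm_num)
          _ = 4 / n := by ring
      have : 0 ≤ 32 * (R.card + 1 : ℝ) ^ 2 * (δ + 1 / n) / n := by positivity
      linarith
    · rw [ind_false hqR, mul_zero, add_zero]
      have hqP : q ∉ P := fun h => hqR (by simp [hR, h])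
      have hqP' : q ∉ P' := fun h => hqR (by simp [hR, h])
      have hqx : x ≠ q := fun h => hqP (h ▸ hx)
      set T := insert q (R.erase x) with hT
      have hTc : T.card ≤ R.card := by
        have h1 : T.card ≤ (R.erase x).card + 1 := Finset.card_insert_le q (R.erase x)
        have h2 := Finset.card_erase_add_one (s := R) (a := x) (by simp [hR, hx])
        omega
      set Ψ : (Fin n → Fin n) → ℂ := fun U =>
        Θ (Function.update U x q) * (Θ' U - Θ' (Function.update U z (U q))) with hΨ
      have d1 : DependsOn (fun U => Θ (Function.update U x q)) (P : Set (Fin n)) :=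
        dependsOn_update hΘ x Finset.sdiff_subset (fun _ => q) (fun _ _ _ => rfl)
      have d2 : DependsOn (fun U => Θ' U - Θ' (Function.update U z (U q)))
          ((insert q P' : Finset (Fin n)) : Set (Fin n)) := by
        intro U V hUV
        have a1 : Θ' U = Θ' V := hΘ'.mono (by simp) hUV
        have a2 := dependsOn_update hΘ' z (T := insert q P')
          (Finset.sdiff_subset.trans (Finset.subset_insert _ _)) (fun U => U q)
          (fun U V h => h q (by simp)) hUV
        simp only at a2
        simp only [a1, a2]
      have h0 : 𝔼 U, Ψ U = 0 := by
        rw [hΨ, expect_mul_of_disjoint d1 d2 (Finset.disjoint_insert_right.mpr ⟨hqP, hPP⟩),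
          Finset.expect_sub_distrib, expect_update_apply hΘ' hqP']
        simp
      have d3 : DependsOn (fun U => Θ (Function.update U x q)) (T : Set (Fin n)) :=
        dependsOn_update hΘ x (by
          intro i hi
          simp only [Finset.mem_sdiff, Finset.mem_singleton] at hi
          simp [hT, hR, hi.1, hi.2]) (fun _ => q) (fun _ _ _ => rfl)
      have hsub : insert q P' ⊆ T := by
        refine Finset.insert_subset_insert _ fun i hi => ?_
        have : i ≠ x := fun e => hxP' (e ▸ hi)
        simp [hR, this, hi]
      have h1 := hK.edge_fluct (P := T) (p₀ := x) (by simp [hT, hqx]) q (Θ := Ψ) (M := 2) (by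
        intro U V hUV
        have a1 := d3 hUV
        have a2 := d2.mono (by exact_mod_cast hsub) hUV
        simp only at a1 a2
        simp only [hΨ, a1, a2]) hb hH
      rw [h0] at h1
      simp only [sub_zero] at h1
      refine h1.trans ?_
      have : (T.card : ℝ) ≤ R.card := by exact_mod_cast hTc
      calc _ ≤ 16 * 2 * (R.card + 1 : ℝ) ^ 2 * (δ + 1 / n) / n := by gcongr
        _ = _ := by ring
  have hz : ∀ z ∈ P', ‖1 / (n : ℂ) * ∑ q, 𝔼 π ∈ K, ((ind (π x = q) : ℝ) : ℂ) *
        ((Θ (Function.update π x q) * (Θ' π - Θ' (Function.update π z (π q)))) * H π)‖ ≤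
        36 * (R.card + 1 : ℝ) ^ 2 * (δ + 1 / n) / n := by
    intro z hz
    rw [norm_mul]
    have h1 : ‖(1 / n : ℂ)‖ = 1 / n := by simp
    have h2 : ∑ q, ind (q ∈ R) = (R.card : ℝ) := by
      rw [sum_ind_card]; simp
    have h3 := norm_sum_le_of_le univ fun q _ => hq z hz q
    rw [Finset.sum_add_distrib, ← Finset.mul_sum, h2, Finset.sum_const, nsmul_eq_mul,
      Finset.card_univ, Fintype.card_fin] at h3
    rw [h1]
    have h5 : (R.card : ℝ) * (1 / n) ≤ (R.card + 1 : ℝ) ^ 2 * (δ + 1 / n) := by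
      have : (0 : ℝ) ≤ R.card := Nat.cast_nonneg _
      gcongr
      · nlinarith
      · linarith
    calc _ ≤ 1 / (n : ℝ) * (n * (32 * (R.card + 1 : ℝ) ^ 2 * (δ + 1 / n) / n) +
          4 / n * R.card) := by gcongr
      _ = (32 * ((R.card + 1 : ℝ) ^ 2 * (δ + 1 / n)) + 4 * (R.card * (1 / n))) / n := by
          field_simp
      _ ≤ (32 * ((R.card + 1 : ℝ) ^ 2 * (δ + 1 / n)) +
            4 * ((R.card + 1 : ℝ) ^ 2 * (δ + 1 / n))) / n := by gcongr
      _ = _ := by ring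
  refine (norm_sum_le_of_le _ hz).trans ?_
  rw [Finset.sum_const, nsmul_eq_mul]
  exact le_of_eq (by ring)

/-- The second-order term for functions of disjoint sets of coordinates is of smaller order. -/
lemma LongCycles.second_order_disjoint (hK : LongCycles K) (hx : x ∈ P)
    (hPP : Disjoint P P') (hc : (P ∪ P').card < n)
    (hΘ : DependsOn Θ (P : Set (Fin n))) (hΘ' : DependsOn Θ' (P' : Set (Fin n)))
    (hM : ∀ U, ‖Θ U‖ ≤ 1) (hM' : ∀ U, ‖Θ' U‖ ≤ 1)
    {c : ℂ} (hJ : ∀ y, ∑ z ∈ P', 𝔼 V, Θ' (Function.update V z y) = c) (hH : SlowVar H δ) :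
    ‖𝔼 π ∈ K, 𝔼 b, Θ π * (Θ' π - Θ' (cswap π (π x) b)) * H π‖ ≤
      200 * ((P ∪ P').card + 1 : ℝ) ^ 3 * (δ + 1 / n) / n := by
  have hn := hK.pos
  have hδ := hH.nonneg
  have hxP' : x ∉ P' := Finset.disjoint_left.mp hPP hx
  have h1 : ‖𝔼 π ∈ K, 𝔼 b, Θ π * (Θ' π - Θ' (cswap π (π x) b)) * H π -
      𝔼 π ∈ K, 𝔼 b, Θ π * flipTerm P' Θ' x π b * H π‖ ≤ 8 * (12 * (P'.card : ℝ) ^ 2 / n ^ 2) := by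
    rw [← Finset.expect_sub_distrib]
    calc _ ≤ 𝔼 π ∈ K, 8 * 𝔼 b, coincidence P' x π b := by
          refine hK.norm_expect_le _ _ fun π hπ => ?_
          rw [← Finset.expect_sub_distrib, Finset.mul_expect]
          refine (RCLike.norm_expect_le (K := ℂ)).trans (Finset.expect_le_expect fun b _ => ?_)
          rw [← sub_mul, ← mul_sub, norm_mul, norm_mul]
          have h2 := norm_flip_sub_le hΘ' hM' hxP' (hK.ne_fix π hπ) b
          calc _ ≤ 1 * (8 * coincidence P' x π b) * 1 := by
                gcongr
                · exact mul_nonneg zero_le_one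
                    (mul_nonneg (by norm_num) (coincidence_nonneg _ _ _ _))
                · exact hM π
                · exact hH.norm_le π
            _ = _ := by ring
      _ ≤ _ := by
          rw [← Finset.mul_expect]
          have := hK.expect_coincidence_le P' x
          gcongr
  have h2 := hK.flip_outgoing hx hPP hc hΘ hΘ' hM hM' hJ hH
  have h3 := hK.flip_incoming hx hPP hΘ hΘ' hM hM' hH
  have h4 := hK.flip_second hx hPP hΘ hΘ' hM hM' hH
  have e : 𝔼 π ∈ K, 𝔼 b, Θ π * flipTerm P' Θ' x π b * H π =
      𝔼 π ∈ K, 𝔼 b, Θ π * (∑ z ∈ P', ((ind (π z = b) : ℝ) : ℂ) *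
        (Θ' π - Θ' (Function.update π z (π x)))) * H π +
      𝔼 π ∈ K, 𝔼 b, Θ π * (∑ z ∈ P', ((ind (π x = z) : ℝ) : ℂ) *
        (Θ' π - Θ' (Function.update π z (π b)))) * H π +
      𝔼 π ∈ K, 𝔼 b, Θ π * (∑ z ∈ P', ((ind (b = z) : ℝ) : ℂ) *
        (Θ' π - Θ' (Function.update π z (π (π x))))) * H π := by
    simp only [← Finset.expect_add_distrib, flipTerm, mul_add, add_mul]
  rw [e] at h1
  have h5 : (P'.card : ℝ) ≤ (P ∪ P').card + 1 := by
    have : P'.card ≤ (P ∪ P').card := Finset.card_le_card Finset.subset_union_right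
    have : (P'.card : ℝ) ≤ (P ∪ P').card := by exact_mod_cast this
    linarith
  set r : ℝ := (P ∪ P').card + 1 with hr
  have hr1 : 1 ≤ r := by
    have : (0 : ℝ) ≤ (P ∪ P').card := Nat.cast_nonneg _
    linarith
  have h6 : (100 * P'.card * r ^ 2 * (δ + 1 / n) / n : ℝ) ≤ 100 * r * r ^ 2 * (δ + 1 / n) / n := by
    gcongr
  have h7 : (8 * (12 * (P'.card : ℝ) ^ 2 / n ^ 2)) ≤ 96 * r ^ 3 * (δ + 1 / n) / n := by
    have h8 : (P'.card : ℝ) ^ 2 ≤ r ^ 3 := by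
      calc (P'.card : ℝ) ^ 2 ≤ r ^ 2 := by gcongr
        _ ≤ r ^ 3 := pow_le_pow_right₀ hr1 (by norm_num)
    calc (8 * (12 * (P'.card : ℝ) ^ 2 / n ^ 2)) = 96 * (P'.card : ℝ) ^ 2 * (0 + 1 / n) / n := by
          field_simp; ring
      _ ≤ _ := by gcongr
  refine (norm_le_norm_add_norm_sub' _ _).trans ((add_le_add
    ((norm_add₃_le).trans (add_le_add (add_le_add h2 h3) h4)) h1).trans ?_)
  have h9 : 0 ≤ r ^ 3 * (δ + 1 / n) / n := by positivity
  calc _ = (100 * P'.card * r ^ 2 * (δ + 1 / n) / n : ℝ) + 8 * (12 * (P'.card : ℝ) ^ 2 / n ^ 2) := by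
        ring
    _ ≤ 100 * r * r ^ 2 * (δ + 1 / n) / n + 96 * r ^ 3 * (δ + 1 / n) / n := add_le_add h6 h7
    _ = 196 * (r ^ 3 * (δ + 1 / n) / n) := by ring
    _ ≤ 200 * (r ^ 3 * (δ + 1 / n) / n) := by gcongr; norm_num
    _ = _ := by ring

end

end

/-- A family of bounded local statistics of words in which each coordinate is used by few members
and whose mean is not affected by prescribing the presence of one letter. -/
structure LocalFamily {n : ℕ} {ι : Type*} (S : Finset ι) (P : ι → Finset (Fin n))
    (θ : ι → (Fin n → Fin n) → ℝ) (k : ℕ) (D : ℝ) : Prop where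
  card_le : ∀ s ∈ S, (P s).card ≤ k
  dep : ∀ s ∈ S, DependsOn (θ s) (P s : Set (Fin n))
  bound : ∀ s ∈ S, ∀ U, |θ s U| ≤ 1
  inc : ∀ s ∈ S, ∃ c : ℂ, ∀ y, ∑ z ∈ P s, 𝔼 V, ((θ s (Function.update V z y) : ℝ) : ℂ) = c
  total : (S.card : ℝ) ≤ D * n
  deg : ∀ z, ((S.filter fun s => z ∈ P s).card : ℝ) ≤ k * D
  scale_pos : 0 < D
  size : 2 * k < n

section
variable {n : ℕ} {K : Finset (Equiv.Perm (Fin n))} {ι : Type*} {S : Finset ι}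
  {P : ι → Finset (Fin n)} {θ : ι → (Fin n → Fin n) → ℝ} {k : ℕ} {D : ℝ}

lemma sum_ind_filter {α : Type*} (s : Finset α) (p : α → Prop) [DecidablePred p] :
    ∑ a ∈ s, ind (p a) = ((s.filter p).card : ℝ) := by
  rw [sum_ind_card]; congr!

/-- Covariance of two statistics of a uniform word. -/
noncomputable def wordCov {n : ℕ} (f g : (Fin n → Fin n) → ℝ) : ℝ :=
  𝔼 U, f U * g U - (𝔼 U, f U) * 𝔼 U, g U

lemma LocalFamily.dep' (h : LocalFamily S P θ k D) {s : ι} (hs : s ∈ S) :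
    DependsOn (fun U => ((θ s U : ℝ) : ℂ)) (P s : Set (Fin n)) :=
  fun _ _ hU => congrArg _ (h.dep s hs hU)

lemma LocalFamily.bound' (h : LocalFamily S P θ k D) {s : ι} (hs : s ∈ S) (U : Fin n → Fin n) :
    ‖((θ s U : ℝ) : ℂ)‖ ≤ 1 := by
  rw [Complex.norm_real]; exact h.bound s hs U

lemma LocalFamily.card_union (h : LocalFamily S P θ k D) {s s' : ι} (hs : s ∈ S) (hs' : s' ∈ S) :
    (P s ∪ P s').card ≤ 2 * k :=
  (Finset.card_union_le _ _).trans (by have := h.card_le s hs; have := h.card_le s' hs'; omega)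

lemma LocalFamily.pair_bound (h : LocalFamily S P θ k D) (hK : LongCycles K)
    {H : Equiv.Perm (Fin n) → ℂ} {δ : ℝ} (hH : SlowVar H δ) {s s' : ι} (hs : s ∈ S)
    (hs' : s' ∈ S) :
    ‖∑ x ∈ P s, 𝔼 π ∈ K, 𝔼 b, tailAvg (x.val + 1) (fun U => ((θ s U : ℝ) : ℂ)) π *
        (((θ s' π : ℝ) : ℂ) - ((θ s' (cswap π (π x) b) : ℝ) : ℂ)) * H π -
      ((wordCov (θ s) (θ s') : ℝ) : ℂ) * 𝔼 π ∈ K, H π‖ ≤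
      200 * (2 * k + 1 : ℝ) ^ 4 * (δ + 1 / n) * (ind (¬ Disjoint (P s) (P s')) + 1 / n) := by
  have hn := hK.pos
  have hδ := hH.nonneg
  have hc := h.card_union hs hs'
  have hcn : (P s ∪ P s').card < n := hc.trans_lt h.size
  have hcR : ((P s ∪ P s').card : ℝ) ≤ 2 * k := by exact_mod_cast hc
  have hcov : ((wordCov (θ s) (θ s') : ℝ) : ℂ) =
      𝔼 U, ((θ s U : ℝ) : ℂ) * ((θ s' U : ℝ) : ℂ) -
        (𝔼 U, ((θ s U : ℝ) : ℂ)) * 𝔼 U, ((θ s' U : ℝ) : ℂ) := by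
    simp only [wordCov, Complex.ofReal_sub, Complex.ofReal_mul, Complex.ofReal_expect]
  have hk1 : (1 : ℝ) ≤ 2 * k + 1 := by
    have : (0 : ℝ) ≤ k := Nat.cast_nonneg k
    linarith
  by_cases hd : Disjoint (P s) (P s')
  · obtain ⟨c, hJ⟩ := h.inc s' hs'
    have h0 : ((wordCov (θ s) (θ s') : ℝ) : ℂ) = 0 := by
      rw [hcov, expect_mul_of_disjoint (h.dep' hs) (h.dep' hs') hd, sub_self]
    rw [h0, zero_mul, sub_zero, ind_false (by simpa using hd), zero_add]
    have hb : ∀ x ∈ P s, ‖𝔼 π ∈ K, 𝔼 b, tailAvg (x.val + 1) (fun U => ((θ s U : ℝ) : ℂ)) π *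
        (((θ s' π : ℝ) : ℂ) - ((θ s' (cswap π (π x) b) : ℝ) : ℂ)) * H π‖ ≤
        200 * (2 * k + 1 : ℝ) ^ 3 * (δ + 1 / n) / n := by
      intro x hx
      refine (hK.second_order_disjoint hx hd hcn
        (dependsOn_tailAvg (x.val + 1) (h.dep' hs)) (h.dep' hs')
        (norm_tailAvg_le _ _ 1 (h.bound' hs)) (h.bound' hs') hJ hH).trans ?_
      gcongr
    refine (norm_sum_le_of_le _ hb).trans ?_
    rw [Finset.sum_const, nsmul_eq_mul]
    have hk : ((P s).card : ℝ) ≤ 2 * k + 1 := by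
      have : ((P s).card : ℝ) ≤ k := by exact_mod_cast h.card_le s hs
      have : (0 : ℝ) ≤ k := Nat.cast_nonneg k
      linarith
    calc _ ≤ (2 * k + 1 : ℝ) * (200 * (2 * k + 1 : ℝ) ^ 3 * (δ + 1 / n) / n) := by gcongr
      _ = _ := by ring
  · rw [ind_true hd, hcov]
    refine (hK.second_order hcn (h.dep' hs) (h.dep' hs') (h.bound' hs) (h.bound' hs') hH).trans ?_
    have h1 : (0 : ℝ) ≤ 1 / n := by positivity
    calc 48 * ((P s ∪ P s').card + 1 : ℝ) ^ 3 * (δ + 1 / n)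
        ≤ 200 * (2 * k + 1 : ℝ) ^ 4 * (δ + 1 / n) := by
          gcongr
          · norm_num
          · calc ((P s ∪ P s').card + 1 : ℝ) ^ 3 ≤ (2 * k + 1 : ℝ) ^ 3 := by gcongr
              _ ≤ _ := pow_le_pow_right₀ hk1 (by norm_num)
      _ = 200 * (2 * k + 1 : ℝ) ^ 4 * (δ + 1 / n) * 1 := by ring
      _ ≤ _ := by gcongr; linarith

lemma LocalFamily.card_meet_le (h : LocalFamily S P θ k D) (Q : Finset (Fin n)) :
    ((S.filter fun s => ¬ Disjoint Q (P s)).card : ℝ) ≤ Q.card * (k * D) := by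
  have h1 : (S.filter fun s => ¬ Disjoint Q (P s)) ⊆ Q.biUnion fun z => S.filter fun s => z ∈ P s := by
    intro s hs
    rw [Finset.mem_filter] at hs
    obtain ⟨z, hz, hz'⟩ := Finset.not_disjoint_iff.mp hs.2
    exact Finset.mem_biUnion.mpr ⟨z, hz, Finset.mem_filter.mpr ⟨hs.1, hz'⟩⟩
  have h2 := (Finset.card_le_card h1).trans Finset.card_biUnion_le
  calc ((S.filter fun s => ¬ Disjoint Q (P s)).card : ℝ)
      ≤ ((∑ z ∈ Q, (S.filter fun s => z ∈ P s).card : ℕ) : ℝ) := by exact_mod_cast h2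
    _ = ∑ z ∈ Q, ((S.filter fun s => z ∈ P s).card : ℝ) := by push_cast; rfl
    _ ≤ ∑ _z ∈ Q, (k * D) := Finset.sum_le_sum fun z _ => h.deg z
    _ = _ := by rw [Finset.sum_const, nsmul_eq_mul]

lemma LocalFamily.sum_meet_le (h : LocalFamily S P θ k D) :
    ∑ s ∈ S, ∑ s' ∈ S, (ind (¬ Disjoint (P s) (P s')) + 1 / (n : ℝ)) ≤
      (k ^ 2 + 1 : ℝ) * (D ^ 2 * n) := by
  have hD := h.scale_pos
  have hn : (0 : ℝ) < n := by
    have := h.size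
    exact_mod_cast (by omega : 0 < n)
  have h1 : ∀ s ∈ S, ∑ s' ∈ S, (ind (¬ Disjoint (P s) (P s')) + 1 / (n : ℝ)) ≤ k * (k * D) + D := by
    intro s hs
    rw [Finset.sum_add_distrib, sum_ind_filter, Finset.sum_const, nsmul_eq_mul]
    have h2 := h.card_meet_le (P s)
    have h3 : ((P s).card : ℝ) ≤ k := by exact_mod_cast h.card_le s hs
    have h4 : ((P s).card : ℝ) * (k * D) ≤ k * (k * D) := by gcongr
    have h5 : (S.card : ℝ) * (1 / n) ≤ D := by
      rw [mul_one_div, div_le_iff₀ hn]; exact h.total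
    linarith
  refine (Finset.sum_le_sum h1).trans ?_
  rw [Finset.sum_const, nsmul_eq_mul]
  calc (S.card : ℝ) * (k * (k * D) + D) ≤ (D * n) * (k * (k * D) + D) := by
        have := h.total; gcongr
    _ = _ := by ring

lemma LocalFamily.sum_pair_bound (h : LocalFamily S P θ k D) (hK : LongCycles K)
    {H : Equiv.Perm (Fin n) → ℂ} {δ : ℝ} (hH : SlowVar H δ) :
    ‖∑ s ∈ S, ∑ s' ∈ S,
        ∑ x ∈ P s, 𝔼 π ∈ K, 𝔼 b, tailAvg (x.val + 1) (fun U => ((θ s U : ℝ) : ℂ)) π *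
        (((θ s' π : ℝ) : ℂ) - ((θ s' (cswap π (π x) b) : ℝ) : ℂ)) * H π -
      ((∑ s ∈ S, ∑ s' ∈ S, wordCov (θ s) (θ s') : ℝ) : ℂ) * 𝔼 π ∈ K, H π‖ ≤
      200 * (2 * k + 1 : ℝ) ^ 4 * (δ + 1 / n) * ((k ^ 2 + 1 : ℝ) * (D ^ 2 * n)) := by
  have hn := hK.pos
  have hδ := hH.nonneg
  push_cast
  simp only [Finset.sum_mul]
  rw [← Finset.sum_sub_distrib]
  simp_rw [← Finset.sum_sub_distrib]
  refine (norm_sum_le_of_le S (n := fun s => ∑ s' ∈ S, 200 * (2 * k + 1 : ℝ) ^ 4 * (δ + 1 / n) *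
    (ind (¬ Disjoint (P s) (P s')) + 1 / n)) fun s hs =>
    norm_sum_le_of_le S fun s' hs' => h.pair_bound hK hH hs hs').trans ?_
  simp_rw [← Finset.mul_sum]
  exact mul_le_mul_of_nonneg_left h.sum_meet_le (by positivity)

lemma LocalFamily.abs_sum_sub_cswap_le (h : LocalFamily S P θ k D) (π : Equiv.Perm (Fin n))
    (a b : Fin n) :
    |∑ s ∈ S, θ s π - ∑ s ∈ S, θ s (cswap π a b)| ≤ 8 * k * D := by
  have hD := h.scale_pos
  set Q : Finset (Fin n) := {a, b, π.symm a, π.symm b} with hQ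
  have hQc : Q.card ≤ 4 := Finset.card_le_four
  have hfix : ∀ z ∉ Q, cswap π a b z = π z := by
    intro z hz
    simp only [hQ, Finset.mem_insert, Finset.mem_singleton, not_or] at hz
    obtain ⟨h1, h2, h3, h4⟩ := hz
    have h5 : π z ≠ a := fun e => h3 (by rw [← e]; simp)
    have h6 : π z ≠ b := fun e => h4 (by rw [← e]; simp)
    rw [cswap_apply, Equiv.swap_apply_of_ne_of_ne h1 h2, Equiv.swap_apply_of_ne_of_ne h5 h6]
  rw [← Finset.sum_sub_distrib]
  have hterm : ∀ s ∈ S, ‖θ s π - θ s (cswap π a b)‖ ≤ 2 * ind (¬ Disjoint Q (P s)) := by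
    intro s hs
    by_cases hd : Disjoint Q (P s)
    · have : θ s π = θ s (cswap π a b) := h.dep s hs fun z hz =>
        (hfix z fun hzQ => Finset.disjoint_left.mp hd hzQ hz).symm
      rw [this, sub_self, norm_zero]
      exact mul_nonneg (by norm_num) (ind_nonneg _)
    · rw [ind_true hd]
      exact (norm_sub_le _ _).trans (by
        have h1 := h.bound s hs π
        have h2 := h.bound s hs (cswap π a b)
        simp only [Real.norm_eq_abs]; linarith)
  refine (norm_sum_le_of_le S hterm).trans ?_
  rw [← Finset.mul_sum, sum_ind_filter]
  have h1 := h.card_meet_le Q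
  have h2 : (Q.card : ℝ) ≤ 4 := by exact_mod_cast hQc
  have h3 : (Q.card : ℝ) * (k * D) ≤ 4 * (k * D) := by gcongr
  linarith

lemma norm_one_sub_exp_add_le (x : ℝ) :
    ‖(1 - Complex.exp (Complex.I * x)) + Complex.I * x‖ ≤ 2 * x ^ 2 := by
  rw [show (1 - Complex.exp (Complex.I * x)) + Complex.I * x =
    -(Complex.exp (Complex.I * x) - 1 - Complex.I * x) by ring, norm_neg]
  have h0 : ‖Complex.I * x‖ = |x| := by simp
  by_cases hx : |x| ≤ 1
  · refine (Complex.norm_exp_sub_one_sub_id_le (by rw [h0]; exact hx)).trans ?_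
    rw [h0, sq_abs]
    nlinarith [sq_nonneg x]
  · push Not at hx
    refine (norm_sub_le _ _).trans ?_
    have h1 : ‖Complex.exp (Complex.I * x) - 1‖ ≤ |x| := Real.norm_exp_I_mul_ofReal_sub_one_le
    rw [h0]
    nlinarith [sq_abs x]

/-- The normalised centered sum of the family. -/
noncomputable def normSum {n : ℕ} {ι : Type*} (S : Finset ι) (θ : ι → (Fin n → Fin n) → ℝ) (D : ℝ)
    (U : Fin n → Fin n) : ℝ :=
  (∑ s ∈ S, θ s U - ∑ s ∈ S, 𝔼 V, θ s V) / (D * √n)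

lemma LocalFamily.abs_normSum_sub_le (h : LocalFamily S P θ k D) (π : Equiv.Perm (Fin n))
    (a b : Fin n) :
    |normSum S θ D π - normSum S θ D (cswap π a b)| ≤ 8 * k / √n := by
  have hD := h.scale_pos
  have hn : (0 : ℝ) < √n := by
    have := h.size
    exact Real.sqrt_pos.mpr (by exact_mod_cast (by omega : 0 < n))
  have h1 := h.abs_sum_sub_cswap_le π a b
  rw [normSum, normSum, ← sub_div, sub_sub_sub_cancel_right, abs_div, abs_of_pos (mul_pos hD hn),
    div_le_div_iff₀ (by positivity) hn]
  calc _ ≤ 8 * k * D * √n := by gcongr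
    _ = _ := by ring

/-- The oscillating exponential of the normalised sum. -/
noncomputable def normExp {n : ℕ} {ι : Type*} (S : Finset ι) (θ : ι → (Fin n → Fin n) → ℝ) (D t : ℝ)
    (U : Fin n → Fin n) : ℂ :=
  Complex.exp (Complex.I * ((t * normSum S θ D U : ℝ) : ℂ))

lemma norm_normExp (S : Finset ι) (θ : ι → (Fin n → Fin n) → ℝ) (D t : ℝ)
    (U : Fin n → Fin n) : ‖normExp S θ D t U‖ = 1 := by
  rw [normExp, mul_comm, Complex.norm_exp_ofReal_mul_I]

lemma normExp_sub (S : Finset ι) (θ : ι → (Fin n → Fin n) → ℝ) (D t : ℝ)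
    (U V : Fin n → Fin n) : normExp S θ D t U - normExp S θ D t V = normExp S θ D t U *
      (1 - Complex.exp (Complex.I * ((t * (normSum S θ D V - normSum S θ D U) : ℝ) : ℂ))) := by
  rw [mul_sub, mul_one, normExp, normExp, ← Complex.exp_add]
  congr 2
  push_cast
  ring

lemma LocalFamily.slowVar (h : LocalFamily S P θ k D) (t : ℝ) :
    SlowVar (fun π : Equiv.Perm (Fin n) => normExp S θ D t π) (8 * k * |t| / √n) where
  norm_le π := (norm_normExp S θ D t π).le
  var_le π a b := by
    rw [normExp_sub, norm_mul, norm_normExp, one_mul, norm_sub_rev]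
    refine Real.norm_exp_I_mul_ofReal_sub_one_le.trans ?_
    rw [Real.norm_eq_abs, abs_mul, abs_sub_comm]
    calc _ ≤ |t| * (8 * k / √n) := by gcongr; exact h.abs_normSum_sub_le π a b
      _ = _ := by ring
  nonneg := by positivity

lemma LocalFamily.norm_normExp_sub_lin_le (h : LocalFamily S P θ k D) (t : ℝ)
    (π : Equiv.Perm (Fin n)) (a b : Fin n) :
    ‖(normExp S θ D t π - normExp S θ D t (cswap π a b)) -
      Complex.I * t * ((normSum S θ D π - normSum S θ D (cswap π a b) : ℝ) : ℂ) *
        normExp S θ D t π‖ ≤ 128 * k ^ 2 * t ^ 2 / n := by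
  have hn : (0 : ℝ) ≤ n := Nat.cast_nonneg n
  set y := t * (normSum S θ D (cswap π a b) - normSum S θ D π) with hy
  have e : (normExp S θ D t π - normExp S θ D t (cswap π a b)) -
      Complex.I * t * ((normSum S θ D π - normSum S θ D (cswap π a b) : ℝ) : ℂ) *
        normExp S θ D t π = normExp S θ D t π *
      ((1 - Complex.exp (Complex.I * (y : ℝ))) + Complex.I * (y : ℝ)) := by
    rw [normExp_sub, hy]; push_cast; ring
  rw [e, norm_mul, norm_normExp, one_mul]
  refine (norm_one_sub_exp_add_le y).trans ?_
  have h1 := h.abs_normSum_sub_le π a b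
  have h2 : (normSum S θ D (cswap π a b) - normSum S θ D π) ^ 2 ≤ (8 * k / √n) ^ 2 := by
    rw [← sq_abs, abs_sub_comm]; gcongr
  calc 2 * y ^ 2 = 2 * t ^ 2 * (normSum S θ D (cswap π a b) - normSum S θ D π) ^ 2 := by
        rw [hy]; ring
    _ ≤ 2 * t ^ 2 * (8 * k / √n) ^ 2 := by gcongr
    _ = _ := by rw [div_pow, Real.sq_sqrt hn]; ring

end

section
variable {n : ℕ} {K : Finset (Equiv.Perm (Fin n))} {ι : Type*} {S : Finset ι}
  {P : ι → Finset (Fin n)} {θ : ι → (Fin n → Fin n) → ℝ} {k : ℕ} {D : ℝ}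

lemma normSum_sub (S : Finset ι) (θ : ι → (Fin n → Fin n) → ℝ) (D : ℝ) (U V : Fin n → Fin n) :
    ((normSum S θ D U - normSum S θ D V : ℝ) : ℂ) =
      ((1 / (D * √n) : ℝ) : ℂ) * ∑ s ∈ S, (((θ s U : ℝ) : ℂ) - ((θ s V : ℝ) : ℂ)) := by
  rw [normSum, normSum, ← sub_div, sub_sub_sub_cancel_right, ← Finset.sum_sub_distrib]
  push_cast
  ring

lemma expect_normSum_mul (S : Finset ι) (θ : ι → (Fin n → Fin n) → ℝ) (D : ℝ)
    (K : Finset (Equiv.Perm (Fin n))) (H : Equiv.Perm (Fin n) → ℂ) :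
    𝔼 π ∈ K, ((normSum S θ D π : ℝ) : ℂ) * H π = ((1 / (D * √n) : ℝ) : ℂ) *
      ∑ s ∈ S, 𝔼 π ∈ K, (((θ s π : ℝ) : ℂ) - 𝔼 V, ((θ s V : ℝ) : ℂ)) * H π := by
  rw [← Finset.expect_sum_comm, Finset.mul_expect]
  refine Finset.expect_congr rfl fun π _ => ?_
  rw [normSum, ← Finset.sum_sub_distrib, ← Finset.sum_mul, ← mul_assoc]
  congr 1
  push_cast [Complex.ofReal_expect]
  ring

lemma expect_linear_eq (S : Finset ι) (P : ι → Finset (Fin n)) (θ : ι → (Fin n → Fin n) → ℝ)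
    (D : ℝ) (K : Finset (Equiv.Perm (Fin n))) (H : Equiv.Perm (Fin n) → ℂ) (c : ℂ) :
    ∑ s ∈ S, ∑ x ∈ P s, 𝔼 π ∈ K, 𝔼 b, tailAvg (x.val + 1) (fun U => ((θ s U : ℝ) : ℂ)) π *
        (c * ((normSum S θ D π - normSum S θ D (cswap π (π x) b) : ℝ) : ℂ) * H π) =
      c * ((1 / (D * √n) : ℝ) : ℂ) * ∑ s ∈ S, ∑ s' ∈ S, ∑ x ∈ P s, 𝔼 π ∈ K, 𝔼 b,
        tailAvg (x.val + 1) (fun U => ((θ s U : ℝ) : ℂ)) π *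
        (((θ s' π : ℝ) : ℂ) - ((θ s' (cswap π (π x) b) : ℝ) : ℂ)) * H π := by
  rw [Finset.mul_sum]
  refine Finset.sum_congr rfl fun s _ => ?_
  rw [Finset.sum_comm, Finset.mul_sum]
  refine Finset.sum_congr rfl fun x _ => ?_
  rw [← Finset.expect_sum_comm, Finset.mul_expect]
  refine Finset.expect_congr rfl fun π _ => ?_
  rw [← Finset.expect_sum_comm, Finset.mul_expect]
  refine Finset.expect_congr rfl fun b _ => ?_
  rw [normSum_sub, ← Finset.sum_mul, ← Finset.mul_sum]
  ring

lemma ode_const_le (k : ℕ) (t : ℝ) :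
    16 * (k : ℝ) ^ 2 + 128 * k ^ 3 * t ^ 2 +
      200 * (2 * k + 1 : ℝ) ^ 4 * (k ^ 2 + 1) * |t| * (8 * k * |t| + 1) ≤
      2000 * (2 * k + 1 : ℝ) ^ 7 * (1 + |t|) ^ 2 := by
  have hk0 : (0 : ℝ) ≤ k := Nat.cast_nonneg k
  set R : ℝ := 2 * k + 1 with hR
  have hR1 : 1 ≤ R := by linarith
  have hkR : (k : ℝ) ≤ R := by linarith
  have ht := abs_nonneg t
  have e1 : 16 * (k : ℝ) ^ 2 ≤ 16 * R ^ 7 := by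
    have : (k : ℝ) ^ 2 ≤ R ^ 7 :=
      (pow_le_pow_left₀ hk0 hkR 2).trans (pow_le_pow_right₀ hR1 (by norm_num))
    linarith
  have e2 : 128 * (k : ℝ) ^ 3 * t ^ 2 ≤ 128 * R ^ 7 * |t| ^ 2 := by
    rw [sq_abs]
    have : (k : ℝ) ^ 3 ≤ R ^ 7 :=
      (pow_le_pow_left₀ hk0 hkR 3).trans (pow_le_pow_right₀ hR1 (by norm_num))
    gcongr
  have e3 : 200 * R ^ 4 * ((k : ℝ) ^ 2 + 1) * |t| * (8 * k * |t| + 1) ≤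
      200 * R ^ 4 * R ^ 2 * |t| * (8 * R * |t| + R) := by
    gcongr
    rw [hR]; nlinarith
  have e4 : 0 ≤ R ^ 7 * |t| := by positivity
  have e5 : 0 ≤ R ^ 7 * |t| ^ 2 := by positivity
  have e6 : 0 ≤ R ^ 7 := by positivity
  nlinarith [e1, e2, e3, e4, e5, e6]

set_option maxHeartbeats 1000000 in
/-- The characteristic function of the normalised sum over `K` nearly satisfies the Gaussian
differential equation. -/
theorem LocalFamily.ode (h : LocalFamily S P θ k D) (hK : LongCycles K) (t : ℝ) :
    ‖𝔼 π ∈ K, ((normSum S θ D π : ℝ) : ℂ) * normExp S θ D t π -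
      Complex.I * t * (((∑ s ∈ S, ∑ s' ∈ S, wordCov (θ s) (θ s')) / (D ^ 2 * n) : ℝ) : ℂ) *
        𝔼 π ∈ K, normExp S θ D t π‖ ≤ 2000 * (2 * k + 1 : ℝ) ^ 7 * (1 + |t|) ^ 2 / √n := by
  have hD := h.scale_pos
  have hn := hK.pos
  have hsn : 0 < √(n : ℝ) := Real.sqrt_pos.mpr hn
  have hs2 : √(n : ℝ) ^ 2 = n := Real.sq_sqrt hn.le
  set H : Equiv.Perm (Fin n) → ℂ := fun π => normExp S θ D t π with hHdef
  have hH : SlowVar H (8 * k * |t| / √n) := h.slowVar t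
  set E1 := ∑ s ∈ S, 𝔼 π ∈ K, (((θ s π : ℝ) : ℂ) - 𝔼 V, ((θ s V : ℝ) : ℂ)) * H π with hE1
  set E2 := ∑ s ∈ S, ∑ x ∈ P s, 𝔼 π ∈ K, 𝔼 b, tailAvg (x.val + 1) (fun U => ((θ s U : ℝ) : ℂ)) π *
        (H π - H (cswap π (π x) b)) with hE2
  set E3 := ∑ s ∈ S, ∑ x ∈ P s, 𝔼 π ∈ K, 𝔼 b, tailAvg (x.val + 1) (fun U => ((θ s U : ℝ) : ℂ)) π *
        (Complex.I * t * ((normSum S θ D π - normSum S θ D (cswap π (π x) b) : ℝ) : ℂ) * H π)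
    with hE3
  set E4 := ∑ s ∈ S, ∑ s' ∈ S, ∑ x ∈ P s, 𝔼 π ∈ K, 𝔼 b,
        tailAvg (x.val + 1) (fun U => ((θ s U : ℝ) : ℂ)) π *
        (((θ s' π : ℝ) : ℂ) - ((θ s' (cswap π (π x) b) : ℝ) : ℂ)) * H π with hE4
  set V : ℝ := ∑ s ∈ S, ∑ s' ∈ S, wordCov (θ s) (θ s') with hV
  have hk0 : (0 : ℝ) ≤ k := Nat.cast_nonneg k
  have hSn : (S.card : ℝ) / n ≤ D := by rw [div_le_iff₀ hn]; exact h.total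
  have h12 : ‖E1 - E2‖ ≤ 16 * k ^ 2 * D := by
    rw [hE1, hE2, ← Finset.sum_sub_distrib]
    have : ∀ s ∈ S, ‖𝔼 π ∈ K, (((θ s π : ℝ) : ℂ) - 𝔼 V, ((θ s V : ℝ) : ℂ)) * H π -
        ∑ x ∈ P s, 𝔼 π ∈ K, 𝔼 b, tailAvg (x.val + 1) (fun U => ((θ s U : ℝ) : ℂ)) π *
        (H π - H (cswap π (π x) b))‖ ≤ 16 * (k : ℝ) ^ 2 / n := by
      intro s hs
      refine (hK.first_order (h.dep' hs) (h.bound' hs) hH.norm_le).trans ?_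
      have : ((P s).card : ℝ) ≤ k := by exact_mod_cast h.card_le s hs
      gcongr
    refine (norm_sum_le_of_le S this).trans ?_
    rw [Finset.sum_const, nsmul_eq_mul]
    calc (S.card : ℝ) * (16 * (k : ℝ) ^ 2 / n) = 16 * k ^ 2 * (S.card / n) := by ring
      _ ≤ _ := by gcongr
  have h23 : ‖E2 - E3‖ ≤ 128 * k ^ 3 * t ^ 2 * D := by
    rw [hE2, hE3, ← Finset.sum_sub_distrib]
    simp_rw [← Finset.sum_sub_distrib, ← Finset.expect_sub_distrib, ← mul_sub]
    have : ∀ s ∈ S, ∀ x ∈ P s,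
        ‖𝔼 π ∈ K, 𝔼 b, tailAvg (x.val + 1) (fun U => ((θ s U : ℝ) : ℂ)) π *
        (H π - H (cswap π (π x) b) -
        Complex.I * t * ((normSum S θ D π - normSum S θ D (cswap π (π x) b) : ℝ) : ℂ) * H π)‖ ≤
        128 * k ^ 2 * t ^ 2 / n := by
      intro s hs x _
      refine norm_expect_le_of_le _ _ _ (by positivity) fun π _ =>
        norm_expect_le_of_le _ _ _ (by positivity) fun b _ => ?_
      rw [norm_mul, ← one_mul (128 * (k : ℝ) ^ 2 * t ^ 2 / n)]
      exact mul_le_mul (norm_tailAvg_le _ _ 1 (h.bound' hs) _)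
        (h.norm_normExp_sub_lin_le t π (π x) b) (norm_nonneg _) zero_le_one
    refine (norm_sum_le_of_le S (n := fun _ => k * (128 * (k : ℝ) ^ 2 * t ^ 2 / n)) fun s hs =>
      (norm_sum_le_of_le (P s) (this s hs)).trans ?_).trans ?_
    · rw [Finset.sum_const, nsmul_eq_mul]
      have : ((P s).card : ℝ) ≤ k := by exact_mod_cast h.card_le s hs
      gcongr
    · rw [Finset.sum_const, nsmul_eq_mul]
      calc (S.card : ℝ) * (k * (128 * (k : ℝ) ^ 2 * t ^ 2 / n)) =
          128 * k ^ 3 * t ^ 2 * (S.card / n) := by ring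
        _ ≤ _ := by gcongr
  have h34 : E3 = Complex.I * t * ((1 / (D * √n) : ℝ) : ℂ) * E4 :=
    expect_linear_eq S P θ D K H (Complex.I * t)
  have h4 : ‖E4 - (V : ℂ) * 𝔼 π ∈ K, H π‖ ≤
      200 * (2 * k + 1 : ℝ) ^ 4 * (8 * k * |t| / √n + 1 / n) * ((k ^ 2 + 1 : ℝ) * (D ^ 2 * n)) :=
    h.sum_pair_bound hK hH
  have hW : 𝔼 π ∈ K, ((normSum S θ D π : ℝ) : ℂ) * H π = ((1 / (D * √n) : ℝ) : ℂ) * E1 :=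
    expect_normSum_mul S θ D K H
  set c : ℝ := 1 / (D * √n) with hc
  have hc0 : 0 < c := by positivity
  have hcc : c * c = 1 / (D ^ 2 * n) := by
    rw [hc, div_mul_div_comm, one_mul, mul_mul_mul_comm, Real.mul_self_sqrt hn.le, ← sq]
  have hVc : (V / (D ^ 2 * n) : ℝ) = c * c * V := by
    rw [hcc]; ring
  have hfin : ((c : ℝ) : ℂ) * E1 - Complex.I * t * ((V / (D ^ 2 * n) : ℝ) : ℂ) * 𝔼 π ∈ K, H π =
      (c : ℂ) * (E1 - E2) + (c : ℂ) * (E2 - E3) +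
        (c : ℂ) * (Complex.I * t * c) * (E4 - (V : ℂ) * 𝔼 π ∈ K, H π) := by
    rw [hVc, h34]; push_cast; ring
  have hnc : ‖(c : ℂ)‖ = c := by rw [Complex.norm_real, Real.norm_of_nonneg hc0.le]
  have hnt : ‖(c : ℂ) * (Complex.I * t * c)‖ = c * c * |t| := by
    rw [norm_mul, norm_mul, norm_mul, hnc, Complex.norm_I, Complex.norm_real, Real.norm_eq_abs]
    ring
  rw [hW, hfin]
  have hn1 : (1 : ℝ) ≤ n := by exact_mod_cast (by have := hK.six_le; omega : 1 ≤ n)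
  have hinv : (1 / n : ℝ) ≤ 1 / √n := by
    rw [div_le_div_iff₀ hn hsn, one_mul, one_mul]
    calc √(n : ℝ) = √n * 1 := (mul_one _).symm
      _ ≤ √n * √n := by gcongr; exact Real.one_le_sqrt.mpr hn1
      _ = n := Real.mul_self_sqrt hn.le
  have b1 : ‖(c : ℂ) * (E1 - E2)‖ ≤ 16 * k ^ 2 / √n := by
    rw [norm_mul, hnc]
    calc _ ≤ c * (16 * k ^ 2 * D) := by gcongr
      _ = _ := by rw [hc]; field_simp
  have b2 : ‖(c : ℂ) * (E2 - E3)‖ ≤ 128 * k ^ 3 * t ^ 2 / √n := by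
    rw [norm_mul, hnc]
    calc _ ≤ c * (128 * k ^ 3 * t ^ 2 * D) := by gcongr
      _ = _ := by rw [hc]; field_simp
  have b3 : ‖(c : ℂ) * (Complex.I * t * c) * (E4 - (V : ℂ) * 𝔼 π ∈ K, H π)‖ ≤
      200 * (2 * k + 1 : ℝ) ^ 4 * (k ^ 2 + 1) * |t| * (8 * k * |t| + 1) / √n := by
    rw [norm_mul, hnt]
    calc _ ≤ c * c * |t| * (200 * (2 * k + 1 : ℝ) ^ 4 * (8 * k * |t| / √n + 1 / √n) *
          ((k ^ 2 + 1 : ℝ) * (D ^ 2 * n))) := by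
          refine mul_le_mul_of_nonneg_left (h4.trans ?_) (by positivity)
          gcongr
      _ = _ := by
          rw [hcc]; field_simp
  refine (norm_add₃_le.trans (add_le_add (add_le_add b1 b2) b3)).trans ?_
  rw [← add_div, ← add_div]
  refine div_le_div_of_nonneg_right ?_ hsn.le
  exact ode_const_le k t

end

/-- Stability of the Gaussian differential equation. -/
lemma norm_sub_gauss_le {φ φ' : ℝ → ℂ} (hφ : ∀ t, HasDerivAt φ (φ' t) t) (h0 : φ 0 = 1)
    {s ε T : ℝ} (hε : ∀ t, |t| ≤ T → ‖φ' t + t * s * φ t‖ ≤ ε) {t : ℝ} (ht : |t| ≤ T) :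
    ‖φ t - Complex.exp (-(s * t ^ 2 / 2 : ℝ))‖ ≤
      ε * Real.exp (|s| * T ^ 2 / 2) * T * Real.exp (|s| * T ^ 2 / 2) := by
  have hT : 0 ≤ T := (abs_nonneg t).trans ht
  have hε0 : 0 ≤ ε := (norm_nonneg _).trans (hε t ht)
  have hb : ∀ x : ℝ, |x| ≤ T → |s * x ^ 2 / 2| ≤ |s| * T ^ 2 / 2 := by
    intro x hx
    rw [abs_div, abs_mul, abs_pow, abs_two]
    gcongr
  set g : ℝ → ℂ := fun x => φ x * ((Real.exp (s * x ^ 2 / 2) : ℝ) : ℂ) with hg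
  have hd : ∀ x, HasDerivAt g ((φ' x + x * s * φ x) * ((Real.exp (s * x ^ 2 / 2) : ℝ) : ℂ)) x := by
    intro x
    have h1 : HasDerivAt (fun x : ℝ => Real.exp (s * x ^ 2 / 2))
        (Real.exp (s * x ^ 2 / 2) * (s * x)) x := by
      have h2 : HasDerivAt (fun x : ℝ => s * x ^ 2 / 2) (s * x) x := by
        have := ((hasDerivAt_pow 2 x).const_mul s).div_const 2
        refine this.congr_deriv ?_
        simp; ring
      exact h2.exp
    have h3 := (hφ x).mul h1.ofReal_comp
    refine h3.congr_deriv ?_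
    push_cast
    ring
  have hbound : ∀ x ∈ Set.Icc (-T) T,
      ‖(φ' x + x * s * φ x) * ((Real.exp (s * x ^ 2 / 2) : ℝ) : ℂ)‖ ≤
        ε * Real.exp (|s| * T ^ 2 / 2) := by
    intro x hx
    have hx' : |x| ≤ T := abs_le.mpr hx
    rw [norm_mul, Complex.norm_real, Real.norm_of_nonneg (Real.exp_pos _).le]
    have := hε x hx'
    have h2 := (le_abs_self _).trans (hb x hx')
    gcongr
  have hmv := (convex_Icc (-T) T).norm_image_sub_le_of_norm_hasDerivWithin_le
    (fun x _ => (hd x).hasDerivWithinAt) hbound (x := 0) (y := t) (by simp [hT]) (abs_le.mp ht)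
  have e0 : g 0 = 1 := by simp [hg, h0]
  rw [e0, sub_zero, Real.norm_eq_abs] at hmv
  have e1 : φ t - Complex.exp (-(s * t ^ 2 / 2 : ℝ)) =
      (g t - 1) * ((Real.exp (-(s * t ^ 2 / 2)) : ℝ) : ℂ) := by
    rw [hg]
    push_cast
    rw [sub_mul, mul_assoc, ← Complex.exp_add]
    simp
  rw [e1, norm_mul, Complex.norm_real, Real.norm_of_nonneg (Real.exp_pos _).le]
  have h3 : -(s * t ^ 2 / 2) ≤ |s| * T ^ 2 / 2 := (neg_le_abs _).trans (hb t ht)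
  have h4 := Real.exp_le_exp.mpr h3
  refine mul_le_mul (hmv.trans ?_) h4 (Real.exp_pos _).le (by positivity)
  gcongr

lemma hasDerivAt_expect_normExp {n : ℕ} {ι : Type*} (K : Finset (Equiv.Perm (Fin n)))
    (S : Finset ι) (θ : ι → (Fin n → Fin n) → ℝ) (D t : ℝ) :
    HasDerivAt (fun t : ℝ => 𝔼 π ∈ K, normExp S θ D t π)
      (Complex.I * 𝔼 π ∈ K, ((normSum S θ D π : ℝ) : ℂ) * normExp S θ D t π) t := by
  have h1 : ∀ π ∈ K, HasDerivAt (fun t : ℝ => normExp S θ D t π)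
      (Complex.I * (((normSum S θ D π : ℝ) : ℂ) * normExp S θ D t π)) t := by
    intro π _
    have h2 : HasDerivAt (fun t : ℝ => ((t * normSum S θ D π : ℝ) : ℂ))
        ((1 * normSum S θ D π : ℝ) : ℂ) t :=
      ((hasDerivAt_id t).mul_const _).ofReal_comp
    refine ((h2.const_mul Complex.I).cexp).congr_deriv ?_
    rw [normExp]; push_cast; ring
  have h3 := (HasDerivAt.fun_sum h1).div_const ((K.card : ℂ))
  simp only [Finset.expect_eq_sum_div_card]
  refine h3.congr_deriv ?_
  rw [← Finset.mul_sum, mul_div_assoc]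

/-- Central limit theorem for local families, in terms of characteristic functions. -/
theorem tendsto_expect_normExp {ι : ℕ → Type*} {S : (n : ℕ) → Finset (ι n)}
    {P : (n : ℕ) → ι n → Finset (Fin n)} {θ : (n : ℕ) → ι n → (Fin n → Fin n) → ℝ} {k : ℕ}
    {D : ℕ → ℝ} {K : (n : ℕ) → Finset (Equiv.Perm (Fin n))}
    (h : ∀ᶠ n in atTop, LocalFamily (S n) (P n) (θ n) k (D n))
    (hK : ∀ᶠ n in atTop, LongCycles (K n)) {s : ℝ}
    (hs : Tendsto (fun n => (∑ a ∈ S n, ∑ b ∈ S n, wordCov (θ n a) (θ n b)) / (D n ^ 2 * n)) atTop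
      (nhds s)) (t : ℝ) :
    Tendsto (fun n => 𝔼 π ∈ K n, normExp (S n) (θ n) (D n) t π) atTop
      (nhds (Complex.exp (-(s * t ^ 2 / 2 : ℝ)))) := by
  set σ : ℕ → ℝ := fun n => (∑ a ∈ S n, ∑ b ∈ S n, wordCov (θ n a) (θ n b)) / (D n ^ 2 * n) with hσ
  set C : ℝ := 2000 * (2 * k + 1 : ℝ) ^ 7 * (1 + |t|) ^ 2 with hC
  have h1 : Tendsto (fun n => Complex.exp (-(σ n * t ^ 2 / 2 : ℝ))) atTop
      (nhds (Complex.exp (-(s * t ^ 2 / 2 : ℝ)))) := by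
    have hc : Continuous fun x : ℝ => Complex.exp (-((x * t ^ 2 / 2 : ℝ) : ℂ)) := by fun_prop
    exact (hc.tendsto s).comp hs
  have h2 : ∀ᶠ n in atTop,
      ‖𝔼 π ∈ K n, normExp (S n) (θ n) (D n) t π - Complex.exp (-(σ n * t ^ 2 / 2 : ℝ))‖ ≤
      C / √n * Real.exp (|σ n| * |t| ^ 2 / 2) * |t| * Real.exp (|σ n| * |t| ^ 2 / 2) := by
    filter_upwards [h, hK] with n hn hKn
    refine norm_sub_gauss_le (φ := fun t => 𝔼 π ∈ K n, normExp (S n) (θ n) (D n) t π)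
      (hasDerivAt_expect_normExp (K n) (S n) (θ n) (D n)) ?_ ?_ le_rfl
    · simp only [normExp, zero_mul, Complex.ofReal_zero, mul_zero, Complex.exp_zero]
      exact Finset.expect_const hKn.nonempty _
    · intro u hu
      have h3 := hn.ode hKn u
      have e : Complex.I * (𝔼 π ∈ K n, ((normSum (S n) (θ n) (D n) π : ℝ) : ℂ) *
            normExp (S n) (θ n) (D n) u π) +
          u * (σ n : ℂ) * (𝔼 π ∈ K n, normExp (S n) (θ n) (D n) u π) =
          Complex.I * (𝔼 π ∈ K n, ((normSum (S n) (θ n) (D n) π : ℝ) : ℂ) *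
            normExp (S n) (θ n) (D n) u π - Complex.I * u * (σ n : ℂ) *
              𝔼 π ∈ K n, normExp (S n) (θ n) (D n) u π) := by
        linear_combination (u * (σ n : ℂ) *
          (𝔼 π ∈ K n, normExp (S n) (θ n) (D n) u π)) * Complex.I_mul_I
      rw [e, norm_mul, Complex.norm_I, one_mul]
      refine h3.trans ?_
      rw [hC]
      gcongr
  have h4 : Tendsto (fun n : ℕ => C / √n * Real.exp (|σ n| * |t| ^ 2 / 2) * |t| *
      Real.exp (|σ n| * |t| ^ 2 / 2)) atTop (nhds 0) := by
    have h5 : Tendsto (fun n => Real.exp (|σ n| * |t| ^ 2 / 2)) atTop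
        (nhds (Real.exp (|s| * |t| ^ 2 / 2))) := by
      have hc : Continuous fun x : ℝ => Real.exp (|x| * |t| ^ 2 / 2) := by fun_prop
      exact (hc.tendsto s).comp hs
    have h6 : Tendsto (fun n : ℕ => C / √(n : ℝ)) atTop (nhds 0) :=
      tendsto_const_nhds.div_atTop (Real.tendsto_sqrt_atTop.comp tendsto_natCast_atTop_atTop)
    simpa using ((h6.mul h5).mul_const |t|).mul h5
  have h7 := squeeze_zero_norm' h2 h4
  simpa using h7.add h1

/-- Strictly increasing words of naturals below `n`, with prescribed adjacencies. -/
noncomputable def incrNat (r : ℕ) (A : Finset ℕ) (n : ℕ) : Finset (Fin r → ℕ) :=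
  (Fintype.piFinset fun _ => range n).filter fun u =>
    StrictMono u ∧ ∀ a ∈ A, ∀ h : a + 1 < r, u ⟨a + 1, h⟩ = u ⟨a, Nat.lt_of_succ_lt h⟩ + 1

/-- Strictly increasing words with prescribed adjacencies. -/
noncomputable def incr (r : ℕ) (A : Finset ℕ) (n : ℕ) : Finset (Fin r → Fin n) :=
  univ.filter fun u => StrictMono u ∧ ∀ a ∈ A, ∀ h : a + 1 < r,
    (u ⟨a + 1, h⟩ : ℕ) = (u ⟨a, Nat.lt_of_succ_lt h⟩ : ℕ) + 1

lemma mem_incrNat {r : ℕ} {A : Finset ℕ} {n : ℕ} {u : Fin r → ℕ} :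
    u ∈ incrNat r A n ↔ (∀ i, u i < n) ∧ StrictMono u ∧ ∀ a ∈ A, ∀ h : a + 1 < r,
      u ⟨a + 1, h⟩ = u ⟨a, Nat.lt_of_succ_lt h⟩ + 1 := by
  simp [incrNat, Fintype.mem_piFinset]

lemma mem_incr {r : ℕ} {A : Finset ℕ} {n : ℕ} {u : Fin r → Fin n} :
    u ∈ incr r A n ↔ StrictMono u ∧ ∀ a ∈ A, ∀ h : a + 1 < r,
      (u ⟨a + 1, h⟩ : ℕ) = (u ⟨a, Nat.lt_of_succ_lt h⟩ : ℕ) + 1 := by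
  simp [incr]

lemma card_incr_eq (r : ℕ) (A : Finset ℕ) (n : ℕ) : (incr r A n).card = (incrNat r A n).card := by
  refine Finset.card_bij (fun u _ i => (u i : ℕ)) ?_ ?_ ?_
  · intro u hu
    rw [mem_incr] at hu
    exact mem_incrNat.mpr ⟨fun i => (u i).isLt, fun i j h => hu.1 h, hu.2⟩
  · intro u _ w _ h
    ext i; exact congrFun h i
  · intro w hw
    rw [mem_incrNat] at hw
    exact ⟨fun i => ⟨w i, hw.1 i⟩, mem_incr.mpr ⟨fun i j h => hw.2.1 h, hw.2.2⟩, rfl⟩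

lemma strictMono_snoc {r : ℕ} {u : Fin r → ℕ} {m : ℕ} :
    StrictMono (Fin.snoc u m : Fin (r + 1) → ℕ) ↔ StrictMono u ∧ ∀ i, u i < m := by
  constructor
  · intro h
    refine ⟨fun i j hij => ?_, fun i => ?_⟩
    · have := h (Fin.castSucc_lt_castSucc_iff.mpr hij)
      simpa using this
    · have := h (Fin.castSucc_lt_last i)
      simpa using this
  · rintro ⟨h, h'⟩ i j hij
    induction j using Fin.lastCases with
    | last =>
      induction i using Fin.lastCases with
      | last => exact absurd hij (lt_irrefl _)
      | cast i => simpa using h' i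
    | cast j =>
      induction i using Fin.lastCases with
      | last => exact absurd hij (by simp [Fin.le_last])
      | cast i => simpa using h (Fin.castSucc_lt_castSucc_iff.mp hij)

lemma snoc_mk {r : ℕ} (u : Fin r → ℕ) (m a : ℕ) (h : a < r) (h' : a < r + 1) :
    (Fin.snoc u m : Fin (r + 1) → ℕ) ⟨a, h'⟩ = u ⟨a, h⟩ := by
  rw [show (⟨a, h'⟩ : Fin (r + 1)) = Fin.castSucc ⟨a, h⟩ from rfl, Fin.snoc_castSucc]

lemma snoc_mk_last {r : ℕ} (u : Fin r → ℕ) (m : ℕ) (h' : r < r + 1) :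
    (Fin.snoc u m : Fin (r + 1) → ℕ) ⟨r, h'⟩ = m := by
  rw [show (⟨r, h'⟩ : Fin (r + 1)) = Fin.last r from rfl, Fin.snoc_last]

lemma snoc_mem_incrNat {r : ℕ} {A : Finset ℕ} {n : ℕ} {u : Fin r → ℕ} {m : ℕ} :
    (Fin.snoc u m : Fin (r + 1) → ℕ) ∈ incrNat (r + 1) A n ↔
      m < n ∧ u ∈ incrNat r A m ∧ ∀ a ∈ A, ∀ h : a + 1 = r, m = u ⟨a, by omega⟩ + 1 := by
  rw [mem_incrNat, mem_incrNat, strictMono_snoc]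
  constructor
  · rintro ⟨h1, ⟨h2, h3⟩, h4⟩
    have hm : m < n := by simpa using h1 (Fin.last r)
    refine ⟨hm, ⟨h3, h2, fun a ha h => ?_⟩, fun a ha h => ?_⟩
    · have := h4 a ha (by omega)
      rwa [snoc_mk _ _ _ h, snoc_mk _ _ _ (by omega)] at this
    · subst h
      have := h4 a ha (by omega)
      rwa [snoc_mk_last, snoc_mk _ _ _ (by omega)] at this
  · rintro ⟨hm, ⟨h3, h2, h4⟩, h5⟩
    refine ⟨fun i => ?_, ⟨h2, h3⟩, fun a ha h => ?_⟩
    · induction i using Fin.lastCases with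
      | last => simpa using hm
      | cast i => simpa using (h3 i).trans hm
    · by_cases hr : a + 1 = r
      · subst hr
        rw [snoc_mk_last, snoc_mk _ _ _ (by omega)]
        exact h5 a ha rfl
      · rw [snoc_mk _ _ _ (by omega), snoc_mk _ _ _ (by omega)]
        exact h4 a ha (by omega)

lemma card_incrNat_free {r : ℕ} {A : Finset ℕ} (hA : ∀ a ∈ A, a + 1 ≠ r) (n : ℕ) :
    (incrNat (r + 1) A n).card = ∑ m ∈ range n, (incrNat r A m).card := by
  rw [← Finset.card_sigma]
  refine Finset.card_bij' (fun u _ => ⟨u (Fin.last r), Fin.init u⟩)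
    (fun p _ => (Fin.snoc p.2 p.1 : Fin (r + 1) → ℕ)) ?_ ?_ ?_ ?_
  · intro u hu
    rw [← Fin.snoc_init_self u] at hu
    have := snoc_mem_incrNat.mp hu
    simpa using ⟨this.1, this.2.1⟩
  · rintro ⟨m, u⟩ h
    rw [Finset.mem_sigma, Finset.mem_range] at h
    exact snoc_mem_incrNat.mpr ⟨h.1, h.2, fun a ha h => absurd h (hA a ha)⟩
  · intro u _
    exact Fin.snoc_init_self u
  · rintro ⟨m, u⟩ _
    simp

lemma card_incrNat_forced {r : ℕ} {A : Finset ℕ} (hA : r ∈ A) (n : ℕ) :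
    (incrNat (r + 2) A n).card = (incrNat (r + 1) A (n - 1)).card := by
  refine Finset.card_bij' (fun u _ => (Fin.init u : Fin (r + 1) → ℕ))
    (fun u _ => (Fin.snoc u (u (Fin.last r) + 1) : Fin (r + 2) → ℕ)) ?_ ?_ ?_ ?_
  · intro u hu
    rw [← Fin.snoc_init_self u] at hu
    obtain ⟨h1, h2, h3⟩ := snoc_mem_incrNat.mp hu
    have h4 := h3 r hA rfl
    rw [mem_incrNat] at h2 ⊢
    refine ⟨fun i => ?_, h2.2⟩
    have := h2.1 i
    omega
  · intro u hu
    refine snoc_mem_incrNat.mpr ⟨?_, ?_, ?_⟩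
    · have := (mem_incrNat.mp hu).1 (Fin.last r)
      omega
    · rw [mem_incrNat] at hu ⊢
      exact ⟨fun i => Nat.lt_succ_of_le (hu.2.1.monotone (Fin.le_last i)), hu.2⟩
    · intro a _ h
      have : a = r := by omega
      subst this; rfl
  · intro u hu
    rw [← Fin.snoc_init_self u] at hu
    obtain ⟨h1, h2, h3⟩ := snoc_mem_incrNat.mp hu
    have h4 := h3 r hA rfl
    conv_rhs => rw [← Fin.snoc_init_self u, h4]
    rfl
  · intro u _
    simp

lemma sum_choose_sub (a j n : ℕ) (h : 1 ≤ j ∨ a = 0) :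
    ∑ m ∈ range n, (m - a).choose j = (n - a).choose (j + 1) := by
  induction n with
  | zero => simp
  | succ n ih =>
    rw [Finset.sum_range_succ, ih]
    by_cases hn : a ≤ n
    · rw [Nat.succ_sub hn, Nat.choose_succ_succ, add_comm]
    · have h1 : n - a = 0 := by omega
      have h2 : n + 1 - a = 0 := by omega
      have h3 : 0 < j := by omega
      rw [h1, h2, Nat.choose_eq_zero_of_lt h3]; simp

lemma card_incrNat (r : ℕ) (A : Finset ℕ) (n : ℕ) :
    (incrNat r A n).card = (n - (A.filter fun a => a + 1 < r).card).choose
      (r - (A.filter fun a => a + 1 < r).card) := by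
  induction r generalizing n with
  | zero => simp [incrNat, Subsingleton.strictMono]
  | succ r ih =>
    have hlt : (A.filter fun a => a + 1 < r).card ≤ r - 1 := by
      calc _ ≤ (range (r - 1)).card := Finset.card_le_card fun a ha => by
            rw [Finset.mem_filter] at ha
            rw [Finset.mem_range]; omega
        _ = r - 1 := by simp
    by_cases hA : ∀ a ∈ A, a + 1 ≠ r
    · have e : (A.filter fun a => a + 1 < r + 1) = A.filter fun a => a + 1 < r :=
        Finset.filter_congr fun a ha => by have := hA a ha; omega
      rw [card_incrNat_free hA, e]
      simp_rw [ih]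
      rw [sum_choose_sub _ _ _ (by omega)]
      congr 1; omega
    · push Not at hA
      obtain ⟨a, ha, rfl⟩ := hA
      have e : (A.filter fun b => b + 1 < a + 1 + 1) = insert a (A.filter fun b => b + 1 < a + 1) := by
        ext b
        simp only [Finset.mem_filter, Finset.mem_insert]
        constructor
        · rintro ⟨hb, h⟩
          by_cases hba : b = a
          · exact Or.inl hba
          · exact Or.inr ⟨hb, by omega⟩
        · rintro (rfl | ⟨hb, h⟩)
          · exact ⟨ha, by omega⟩
          · exact ⟨hb, by omega⟩
      rw [card_incrNat_forced ha, ih, e, Finset.card_insert_of_notMem (by simp)]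
      congr 1 <;> omega

lemma card_incr {r : ℕ} {A : Finset ℕ} (hA : A ⊆ range (r - 1)) (n : ℕ) :
    (incr r A n).card = (n - A.card).choose (r - A.card) := by
  have e : (A.filter fun a => a + 1 < r) = A :=
    Finset.filter_true_of_mem fun a ha => by
      have := Finset.mem_range.mp (hA ha); omega
  rw [card_incr_eq, card_incrNat, e]

/-- An increasing word is determined by one letter and its values next to the free gaps. -/
lemma card_incr_through {k : ℕ} {A : Finset ℕ} (hA : A ⊆ range (k - 1)) {n : ℕ} (l : Fin k)
    (z : Fin n) :
    ((incr k A n).filter fun s => s l = z).card ≤ n ^ (k - A.card - 1) := by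
  have hk : 0 < k := l.pos
  let g : (Fin k → Fin n) → (↥(range (k - 1) \ A) → Fin n) := fun s a =>
    if a.1 < l.val then s ⟨a.1, by
      have := Finset.mem_range.mp (Finset.mem_sdiff.mp a.2).1; omega⟩
    else s ⟨a.1 + 1, by
      have := Finset.mem_range.mp (Finset.mem_sdiff.mp a.2).1; omega⟩
  have hinj : Set.InjOn g ((incr k A n).filter fun s => s l = z) := by
    intro s hs s' hs' h
    rw [Finset.mem_coe, Finset.mem_filter, mem_incr] at hs hs'
    obtain ⟨⟨-, h2⟩, h3⟩ := hs
    obtain ⟨⟨-, h2'⟩, h3'⟩ := hs'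
    have up : ∀ j, ∀ hj : l.val + j < k, s ⟨l.val + j, hj⟩ = s' ⟨l.val + j, hj⟩ := by
      intro j
      induction j with
      | zero => intro hj; exact h3.trans h3'.symm
      | succ j ih =>
        intro hj
        by_cases hja : l.val + j ∈ A
        · have e1 := h2 _ hja hj
          have e2 := h2' _ hja hj
          have e3 := ih (by omega)
          apply Fin.ext
          rw [show (⟨l.val + (j + 1), hj⟩ : Fin k) = ⟨l.val + j + 1, hj⟩ from rfl, e1, e2, e3]
        · have := congrFun h ⟨l.val + j, Finset.mem_sdiff.mpr
            ⟨Finset.mem_range.mpr (by omega), hja⟩⟩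
          simp only [g, not_lt.mpr (Nat.le_add_right _ _), if_false] at this
          exact this
    have down : ∀ j, ∀ i : ℕ, ∀ hi : i < k, i + j = l.val → s ⟨i, hi⟩ = s' ⟨i, hi⟩ := by
      intro j
      induction j with
      | zero =>
        intro i hi hil
        have : (⟨i, hi⟩ : Fin k) = l := Fin.ext (by simpa using hil)
        rw [this, h3, h3']
      | succ j ih =>
        intro i hi hil
        have hl := l.isLt
        by_cases hia : i ∈ A
        · have e1 := h2 _ hia (by omega)
          have e2 := h2' _ hia (by omega)
          have e3 := ih (i + 1) (by omega) (by omega)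
          apply Fin.ext
          rw [e3] at e1
          omega
        · have := congrFun h ⟨i, Finset.mem_sdiff.mpr
            ⟨Finset.mem_range.mpr (by omega), hia⟩⟩
          have hil' : i < l.val := by omega
          simpa [g, hil'] using this
    funext i
    by_cases hi : i.val < l.val
    · exact down (l.val - i.val) i.val i.isLt (by omega)
    · obtain ⟨j, hj⟩ := Nat.exists_eq_add_of_le (not_lt.mp hi)
      have := up j (by omega)
      have e : (⟨l.val + j, by omega⟩ : Fin k) = i := Fin.ext hj.symm
      rwa [e] at this
  calc _ ≤ (univ : Finset (↥(range (k - 1) \ A) → Fin n)).card :=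
        Finset.card_le_card_of_injOn g (fun _ _ => Finset.mem_coe.mpr (Finset.mem_univ _)) hinj
    _ = n ^ (k - A.card - 1) := by
        rw [Finset.card_univ, Fintype.card_fun, Fintype.card_fin, Fintype.card_coe,
          Finset.card_sdiff_of_subset hA, Finset.card_range]
        congr 1; omega

/-- The word `h` has the same relative order as `v`. -/
def IsPattern {k n : ℕ} (v : Equiv.Perm (Fin k)) (h : Fin k → Fin n) : Prop :=
  ∀ a b, h a < h b ↔ v a < v b

lemma isPattern_iff {k n : ℕ} {v : Equiv.Perm (Fin k)} {h : Fin k → Fin n} :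
    IsPattern v h ↔ StrictMono (h ∘ v.symm) := by
  constructor
  · intro H i j hij
    simpa [H (v.symm i) (v.symm j)] using hij
  · intro H a b
    have := H.lt_iff_lt (a := v a) (b := v b)
    simpa using this

lemma IsPattern.injective {k n : ℕ} {v : Equiv.Perm (Fin k)} {h : Fin k → Fin n}
    (H : IsPattern v h) : Function.Injective h := by
  have := (isPattern_iff.mp H).injective.comp v.injective
  simpa [Function.comp_assoc] using this

lemma card_isPattern {k : ℕ} (v : Equiv.Perm (Fin k)) (n : ℕ) :
    (univ.filter fun h : Fin k → Fin n => IsPattern v h).card = n.choose k := by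
  have h1 := card_incr (r := k) (A := ∅) (by simp) n
  simp only [Finset.card_empty, Nat.sub_zero] at h1
  rw [← h1]
  refine Finset.card_bij' (fun h _ => h ∘ v.symm) (fun u _ => u ∘ v) ?_ ?_ ?_ ?_
  · intro h hh
    rw [mem_incr]
    exact ⟨isPattern_iff.mp (by simpa using hh), by simp⟩
  · intro u hu
    rw [mem_incr] at hu
    simp only [Finset.mem_filter, Finset.mem_univ, true_and]
    rw [isPattern_iff]
    simpa [Function.comp_assoc] using hu.1
  · intro h _
    simp [Function.comp_assoc]
  · intro u _
    simp [Function.comp_assoc]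

lemma expect_comp_injective {α γ β E : Type*} [Fintype α] [Fintype γ] [DecidableEq α]
    [DecidableEq γ] [Fintype β] [Nonempty β] [AddCommMonoid E] [Module ℚ≥0 E] {s : α → γ} (hs : Function.Injective s)
    (F : (α → β) → E) : 𝔼 V : γ → β, F (V ∘ s) = 𝔼 h : α → β, F h := by
  let e : (γ → β) ≃ (α → β) × ({x // x ∉ Set.range s} → β) :=
    (Equiv.piEquivPiSubtypeProd (fun x => x ∈ Set.range s) (fun _ => β)).trans
      (Equiv.prodCongr (Equiv.arrowCongr (Equiv.ofInjective s hs).symm (Equiv.refl β))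
        (Equiv.refl _))
  have he : ∀ V, (e V).1 = V ∘ s := by
    intro V; funext a
    simp [e, Equiv.arrowCongr]
  calc 𝔼 V : γ → β, F (V ∘ s) = 𝔼 V : γ → β, F (e V).1 := by simp_rw [he]
    _ = 𝔼 p : (α → β) × ({x // x ∉ Set.range s} → β), F p.1 :=
        Fintype.expect_equiv e _ _ fun _ => rfl
    _ = 𝔼 h : α → β, 𝔼 _w : {x // x ∉ Set.range s} → β, F h :=
        Finset.expect_product' (s := univ) (t := univ) (fun h _ => F h)
    _ = 𝔼 h : α → β, F h := Finset.expect_congr rfl fun h _ => Fintype.expect_const _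

lemma expect_update_fun {α β E : Type*} [Fintype α] [Fintype β] [Nonempty β] [DecidableEq α]
    [AddCommMonoid E] [Module ℚ≥0 E] (x : α) (F : (α → β) → E) :
    𝔼 U : α → β, 𝔼 b, F (Function.update U x b) = 𝔼 U, F U := by
  have e : ∀ G : (α → β) → β → E, 𝔼 U, 𝔼 V, G U V = 𝔼 p : (α → β) × β, G p.1 p.2 := by
    intro G
    exact (Finset.expect_product' (s := univ) (t := univ) G).symm
  calc 𝔼 U : α → β, 𝔼 b, F (Function.update U x b)
      = 𝔼 p : (α → β) × β, F (Function.update p.1 x p.2) := e _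
    _ = 𝔼 p : (α → β) × β, F p.1 := by
        refine Finset.expect_nbij' (fun p => (Function.update p.1 x p.2, p.1 x))
          (fun p => (Function.update p.1 x p.2, p.1 x)) (by simp) (by simp) ?_ ?_ ?_ <;>
        · rintro ⟨U, V⟩ -
          simp
    _ = 𝔼 U : α → β, 𝔼 _b : β, F U := (e fun U _ => F U).symm
    _ = _ := Finset.expect_congr rfl fun h _ => Fintype.expect_const _

/-- The number of occurrences of `v` in words of length `k` using a given letter. -/
lemma card_isPattern_mem {k n : ℕ} (v : Equiv.Perm (Fin k)) (y : Fin n) :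
    (univ.filter fun h : Fin k → Fin n => IsPattern v h ∧ y ∈ Set.range h).card =
      ((univ.powersetCard k).filter fun T : Finset (Fin n) => y ∈ T).card := by
  refine Finset.card_bij (fun h _ => univ.image h) ?_ ?_ ?_
  · intro h hh
    simp only [Finset.mem_filter, Finset.mem_univ, true_and] at hh
    simp only [Finset.mem_filter, Finset.mem_powersetCard, Finset.subset_univ, true_and]
    refine ⟨?_, by simpa using hh.2⟩
    rw [Finset.card_image_of_injective _ hh.1.injective, Finset.card_univ, Fintype.card_fin]
  · intro h hh h' hh' e
    simp only [Finset.mem_filter, Finset.mem_univ, true_and] at hh hh'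
    have e1 : Set.range h = Set.range h' := by
      have := congrArg (fun T : Finset (Fin n) => (T : Set (Fin n))) e
      simpa using this
    have e2 : Set.range (h ∘ v.symm) = Set.range (h' ∘ v.symm) := by
      rw [v.symm.surjective.range_comp, v.symm.surjective.range_comp, e1]
    have e3 := ((isPattern_iff.mp hh.1).range_inj (isPattern_iff.mp hh'.1)).mp e2
    exact v.symm.surjective.injective_comp_right e3
  · intro T hT
    simp only [Finset.mem_filter, Finset.mem_powersetCard, Finset.subset_univ, true_and] at hT
    refine ⟨T.orderEmbOfFin hT.1 ∘ v, ?_, ?_⟩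
    · simp only [Finset.mem_filter, Finset.mem_univ, true_and]
      refine ⟨?_, ?_⟩
      · rw [isPattern_iff]
        simpa [Function.comp_assoc] using (T.orderEmbOfFin hT.1).strictMono
      · rw [v.surjective.range_comp, Finset.range_orderEmbOfFin]
        exact hT.2
    · apply Finset.coe_injective
      rw [Finset.coe_image, Finset.coe_univ, Set.image_univ, v.surjective.range_comp,
        Finset.range_orderEmbOfFin]

lemma card_powersetCard_mem_eq {n : ℕ} (k : ℕ) (y y' : Fin n) :
    ((univ.powersetCard k).filter fun T : Finset (Fin n) => y ∈ T).card =
      ((univ.powersetCard k).filter fun T : Finset (Fin n) => y' ∈ T).card := by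
  have key : ∀ T : Finset (Fin n), (T.map (Equiv.swap y y').toEmbedding).map
      (Equiv.swap y y').toEmbedding = T := by
    intro T
    ext z
    simp
  refine Finset.card_bij' (fun T _ => T.map (Equiv.swap y y').toEmbedding)
    (fun T _ => T.map (Equiv.swap y y').toEmbedding) ?_ ?_ (fun T _ => key T) (fun T _ => key T)
  · intro T hT
    simp only [Finset.mem_filter, Finset.mem_powersetCard, Finset.subset_univ, true_and,
      Finset.card_map] at hT ⊢
    refine ⟨hT.1, ?_⟩
    simp [hT.2]
  · intro T hT
    simp only [Finset.mem_filter, Finset.mem_powersetCard, Finset.subset_univ, true_and,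
      Finset.card_map] at hT ⊢
    refine ⟨hT.1, ?_⟩
    simp [hT.2]

lemma expect_ind {α : Type*} [Fintype α] (p : α → Prop) :
    𝔼 a, ind (p a) = ((univ.filter p).card : ℝ) / Fintype.card α := by
  rw [Finset.expect_eq_sum_div_card, sum_ind_filter, Finset.card_univ]

/-- The probability that a uniform word of length `k` has a given pattern. -/
noncomputable def patProb (k n : ℕ) : ℝ := (n.choose k : ℝ) / (n : ℝ) ^ k

lemma expect_isPattern {k : ℕ} (v : Equiv.Perm (Fin k)) (n : ℕ) :
    𝔼 h : Fin k → Fin n, ind (IsPattern v h) = patProb k n := by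
  rw [expect_ind, patProb, Fintype.card_fun, Fintype.card_fin, Fintype.card_fin]
  have := card_isPattern v n
  push_cast
  congr 2

lemma sum_ind_apply_eq {k n : ℕ} (v : Equiv.Perm (Fin k)) (h : Fin k → Fin n) (y : Fin n) :
    ∑ l, ind (IsPattern v h) * ind (h l = y) = ind (IsPattern v h ∧ y ∈ Set.range h) := by
  by_cases H : IsPattern v h
  · by_cases hy : y ∈ Set.range h
    · obtain ⟨l, rfl⟩ := hy
      rw [Finset.sum_eq_single l]
      · rw [ind_true H, ind_true rfl, ind_true ⟨H, l, rfl⟩, one_mul]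
      · intro l' _ hl
        rw [ind_false (fun e => hl (H.injective e)), mul_zero]
      · simp
    · rw [ind_false (p := IsPattern v h ∧ y ∈ Set.range h) (fun e => hy e.2)]
      refine Finset.sum_eq_zero fun l _ => ?_
      rw [ind_false (fun e => hy ⟨l, e⟩), mul_zero]
  · rw [ind_false (p := IsPattern v h ∧ y ∈ Set.range h) (fun e => H e.1), ind_false H]
    simp

lemma expect_isPattern_mem {k n : ℕ} (v : Equiv.Perm (Fin k)) (y : Fin n) :
    𝔼 h : Fin k → Fin n, ind (IsPattern v h ∧ y ∈ Set.range h) = k * patProb k n / n := by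
  have hn : (0 : ℝ) < n := by exact_mod_cast y.pos
  have hconst : ∀ y', 𝔼 h : Fin k → Fin n, ind (IsPattern v h ∧ y' ∈ Set.range h) =
      𝔼 h : Fin k → Fin n, ind (IsPattern v h ∧ y ∈ Set.range h) := by
    intro y'
    rw [expect_ind, expect_ind]
    congr 2
    have h1 := card_isPattern_mem v y
    have h2 := card_isPattern_mem v y'
    have h3 := card_powersetCard_mem_eq k y y'
    convert h2.trans (h3.symm.trans h1.symm)
  have hsum : ∑ y', 𝔼 h : Fin k → Fin n, ind (IsPattern v h ∧ y' ∈ Set.range h) =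
      k * patProb k n := by
    rw [← Finset.expect_sum_comm, ← expect_isPattern v n, Finset.mul_expect]
    refine Finset.expect_congr rfl fun h _ => ?_
    simp_rw [← sum_ind_apply_eq]
    rw [Finset.sum_comm]
    simp_rw [← Finset.mul_sum, sum_ind_eq']
    simp [mul_comm]
  simp_rw [hconst] at hsum
  rw [Finset.sum_const, Finset.card_univ, Fintype.card_fin, nsmul_eq_mul] at hsum
  rw [← hsum]; field_simp

lemma sum_expect_update {k n : ℕ} (v : Equiv.Perm (Fin k)) (y : Fin n) :
    ∑ l, 𝔼 h : Fin k → Fin n, ind (IsPattern v (Function.update h l y)) = k * patProb k n := by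
  have hn : (0 : ℝ) < n := by exact_mod_cast y.pos
  have : Nonempty (Fin n) := ⟨y⟩
  have h1 : ∀ l : Fin k, 𝔼 h : Fin k → Fin n, ind (IsPattern v (Function.update h l y)) =
      n * 𝔼 h : Fin k → Fin n, ind (IsPattern v h) * ind (h l = y) := by
    intro l
    rw [← expect_update_fun l (fun h : Fin k → Fin n => ind (IsPattern v h) * ind (h l = y)),
      Finset.mul_expect]
    refine Finset.expect_congr rfl fun h _ => ?_
    simp only [Function.update_self]
    rw [Finset.expect_eq_sum_div_card, Finset.card_univ, Fintype.card_fin,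
      Finset.sum_eq_single y, ind_true rfl]
    · field_simp
    · intro b _ hb
      rw [ind_false hb, mul_zero]
    · simp
  simp_rw [h1]
  rw [← Finset.mul_sum, ← Finset.expect_sum_comm]
  simp_rw [sum_ind_apply_eq]
  rw [expect_isPattern_mem]
  field_simp

/-- Indicator that the word `U` realises the pattern `v` at the positions `s`. -/
noncomputable def patStat {k n : ℕ} (v : Equiv.Perm (Fin k)) (s : Fin k → Fin n)
    (U : Fin n → Fin n) : ℝ := ind (IsPattern v (U ∘ s))

lemma vincularCount_eq_sum {k n : ℕ} (v : Equiv.Perm (Fin k)) (A : Finset ℕ)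
    (π : Equiv.Perm (Fin n)) :
    (vincularCount v A π : ℝ) = ∑ s ∈ incr k A n, patStat v s π := by
  unfold patStat
  rw [sum_ind_filter, incr, Finset.filter_filter, vincularCount]
  congr 2
  ext s
  simp only [Finset.mem_filter, Finset.mem_univ, true_and, IsPattern, Function.comp_apply, and_assoc]

lemma expect_patStat {k n : ℕ} (v : Equiv.Perm (Fin k)) {s : Fin k → Fin n}
    (hs : Function.Injective s) : 𝔼 V, patStat v s V = patProb k n := by
  by_cases hn : n = 0
  · subst hn
    have : k = 0 := by
      by_contra hk
      exact (s ⟨0, Nat.pos_of_ne_zero hk⟩).elim0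
    subst this
    rw [← expect_isPattern v 0]
    simp only [patStat]
    have hp : ∀ h : Fin 0 → Fin 0, IsPattern v h := fun h a => a.elim0
    simp [ind_true (hp _)]
  · have : Nonempty (Fin n) := ⟨⟨0, Nat.pos_of_ne_zero hn⟩⟩
    rw [← expect_isPattern v n]
    exact expect_comp_injective hs (fun h => ind (IsPattern v h))

lemma update_comp_injective {k n : ℕ} {s : Fin k → Fin n} (hs : Function.Injective s)
    (V : Fin n → Fin n) (l : Fin k) (y : Fin n) :
    Function.update V (s l) y ∘ s = Function.update (V ∘ s) l y := by
  funext a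
  by_cases h : a = l
  · subst h; simp
  · simp [h, hs.ne h]

lemma incr_injective {k n : ℕ} {A : Finset ℕ} {s : Fin k → Fin n} (hs : s ∈ incr k A n) :
    Function.Injective s := (mem_incr.mp hs).1.injective

theorem localFamily_patStat {k n : ℕ} (v : Equiv.Perm (Fin k)) {A : Finset ℕ}
    (hA : A ⊂ range (k - 1)) (hn : 2 * k < n) :
    LocalFamily (incr k A n) (fun s => univ.image s) (patStat v) k
      ((n : ℝ) ^ (k - A.card - 1)) := by
  have hq : A.card < k - 1 := by simpa using Finset.card_lt_card hA
  have hn0 : 0 < n := by omega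
  have : Nonempty (Fin n) := ⟨⟨0, hn0⟩⟩
  refine ⟨?_, ?_, ?_, ?_, ?_, ?_, by positivity, hn⟩
  · intro s _
    exact Finset.card_image_le.trans (by simp)
  · intro s _ U V hUV
    have : U ∘ s = V ∘ s := by
      funext a
      exact hUV (s a) (by simp)
    simp [patStat, this]
  · intro s _ U
    rw [patStat, abs_of_nonneg (ind_nonneg _)]
    exact ind_le_one _
  · intro s hs
    have hinj := incr_injective hs
    refine ⟨((k * patProb k n : ℝ) : ℂ), fun y => ?_⟩
    rw [← sum_expect_update v y, Finset.sum_image fun a _ b _ h => hinj h]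
    push_cast [Complex.ofReal_expect]
    refine Finset.sum_congr rfl fun l _ => ?_
    simp only [patStat, update_comp_injective hinj]
    exact expect_comp_injective hinj
      (fun h : Fin k → Fin n => ((ind (IsPattern v (Function.update h l y)) : ℝ) : ℂ))
  · rw [card_incr hA.subset, ← pow_succ, show k - A.card - 1 + 1 = k - A.card by omega]
    calc ((n - A.card).choose (k - A.card) : ℝ) ≤ (((n - A.card) ^ (k - A.card) : ℕ) : ℝ) := by
          exact_mod_cast Nat.choose_le_pow _ _
      _ ≤ ((n ^ (k - A.card) : ℕ) : ℝ) := by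
          exact_mod_cast Nat.pow_le_pow_left (Nat.sub_le _ _) _
      _ = _ := by push_cast; rfl
  · intro z
    have h1 : ((incr k A n).filter fun s => z ∈ univ.image s) ⊆
        univ.biUnion fun l => (incr k A n).filter fun s => s l = z := by
      intro s hs
      simp only [Finset.mem_filter, Finset.mem_image, Finset.mem_univ, true_and] at hs
      obtain ⟨h, l, hl⟩ := hs
      exact Finset.mem_biUnion.mpr ⟨l, Finset.mem_univ _, Finset.mem_filter.mpr ⟨h, hl⟩⟩
    have h2 := (Finset.card_le_card h1).trans (Finset.card_biUnion_le_card_mul _ _ _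
      fun l _ => card_incr_through hA.subset l z)
    rw [Finset.card_univ, Fintype.card_fin] at h2
    exact_mod_cast h2

lemma tendsto_choose_div_pow (j : ℕ) :
    Tendsto (fun n : ℕ => (n.choose j : ℝ) / (n : ℝ) ^ j) atTop (nhds (1 / (j.factorial : ℝ))) := by
  have h1 : Tendsto (fun n : ℕ => (n : ℝ) * (1 / (n : ℝ))) atTop (nhds 1) := by
    refine tendsto_const_nhds.congr' ?_
    filter_upwards [eventually_gt_atTop 0] with n hn
    have : (n : ℝ) ≠ 0 := by positivity
    field_simp
  have h2 := ProbabilityTheory.tendsto_choose_mul_pow_atTop j h1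
  rw [one_pow] at h2
  refine h2.congr fun n => ?_
  rw [one_div, inv_pow, div_eq_mul_inv]

lemma tendsto_patProb (k : ℕ) :
    Tendsto (patProb k) atTop (nhds (1 / (k.factorial : ℝ))) := tendsto_choose_div_pow k

lemma tendsto_sub_div (a : ℕ) :
    Tendsto (fun n : ℕ => ((n - a : ℕ) : ℝ) / n) atTop (nhds 1) := by
  have h1 : Tendsto (fun n : ℕ => (1 : ℝ) - a / n) atTop (nhds 1) := by
    simpa using (tendsto_const_div_atTop_nhds_zero_nat (a : ℝ)).const_sub 1
  refine h1.congr' ?_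
  filter_upwards [eventually_gt_atTop a] with n hn
  have : (n : ℝ) ≠ 0 := by
    have : 0 < n := by omega
    positivity
  rw [Nat.cast_sub hn.le]
  field_simp

lemma tendsto_sub_choose_div_pow (a j : ℕ) :
    Tendsto (fun n : ℕ => ((n - a).choose j : ℝ) / (n : ℝ) ^ j) atTop
      (nhds (1 / (j.factorial : ℝ))) := by
  have h1 := (tendsto_choose_div_pow j).comp (tendsto_sub_atTop_nat a)
  have h2 := h1.mul ((tendsto_sub_div a).pow j)
  rw [one_pow, mul_one] at h2
  refine h2.congr' ?_
  filter_upwards [eventually_gt_atTop a] with n hn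
  have h3 : (n : ℝ) ≠ 0 := by
    have : 0 < n := by omega
    positivity
  have h4 : ((n - a : ℕ) : ℝ) ≠ 0 := by
    have : 0 < n - a := by omega
    positivity
  simp only [Function.comp_apply]
  rw [div_pow]
  field_simp

lemma exists_tendsto_choose_div_pow_of_le (a j p : ℕ)
    (h : ∀ᶠ n : ℕ in atTop, ((n - a).choose j : ℝ) ≤ (n : ℝ) ^ p) :
    ∃ c, Tendsto (fun n : ℕ => ((n - a).choose j : ℝ) / (n : ℝ) ^ p) atTop (nhds c) := by
  by_cases hjp : j ≤ p
  · obtain ⟨d, rfl⟩ := Nat.exists_eq_add_of_le hjp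
    have hd : ∃ c, Tendsto (fun n : ℕ => (1 / (n : ℝ)) ^ d) atTop (nhds c) :=
      ⟨_, tendsto_one_div_atTop_nhds_zero_nat.pow d⟩
    obtain ⟨c, hc⟩ := hd
    refine ⟨_, ((tendsto_sub_choose_div_pow a j).mul hc).congr fun n => ?_⟩
    rw [pow_add, one_div, inv_pow, div_mul_eq_div_div, div_eq_mul_inv _ ((n : ℝ) ^ d)]
  · exfalso
    have h1 : Tendsto (fun n : ℕ => (1 / (n : ℝ))) atTop (nhds 0) :=
      tendsto_one_div_atTop_nhds_zero_nat
    have h2 := le_of_tendsto_of_tendsto (tendsto_sub_choose_div_pow a j) h1 (by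
      filter_upwards [h, eventually_gt_atTop 0] with n hn hn0
      have hn1 : (1 : ℝ) ≤ n := by exact_mod_cast hn0
      rw [div_le_div_iff₀ (by positivity) (by positivity), one_mul]
      calc ((n - a).choose j : ℝ) * n ≤ (n : ℝ) ^ p * n := by gcongr
        _ = (n : ℝ) ^ (p + 1) := by ring
        _ ≤ (n : ℝ) ^ j := pow_le_pow_right₀ hn1 (by omega))
    have h3 : (0 : ℝ) < 1 / (j.factorial : ℝ) := by positivity
    linarith

lemma isPattern_unique {r n : ℕ} {w w' : Equiv.Perm (Fin r)} {h : Fin r → Fin n}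
    (H : IsPattern w h) (H' : IsPattern w' h) : w = w' := by
  have h1 : IsPattern w (w' : Fin r → Fin r) := fun a b => (H' a b).symm.trans (H a b)
  have h2 := isPattern_iff.mp h1
  have h3 : (w' : Fin r → Fin r) ∘ w.symm = id :=
    (h2.range_inj strictMono_id).mp (by
      rw [Set.range_id, (w'.surjective.comp w.symm.surjective).range_eq])
  ext a
  have := congrFun h3 (w a)
  simp at this
  rw [this]

lemma IsPattern.comp_iff {k r n : ℕ} {v : Equiv.Perm (Fin k)} {w : Equiv.Perm (Fin r)}
    {h : Fin r → Fin n} (H : IsPattern w h) (σ : Fin k → Fin r) :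
    IsPattern v (h ∘ σ) ↔ IsPattern v ((w : Fin r → Fin r) ∘ σ) :=
  forall_congr' fun a => forall_congr' fun b => by
    simp only [Function.comp_apply, H (σ a) (σ b)]

lemma sum_ind_isPattern_le {r n : ℕ} (h : Fin r → Fin n) :
    ∑ w : Equiv.Perm (Fin r), ind (IsPattern w h) ≤ 1 := by
  by_cases H : ∃ w : Equiv.Perm (Fin r), IsPattern w h
  · obtain ⟨w, hw⟩ := H
    rw [Finset.sum_eq_single w]
    · exact ind_le_one _
    · intro w' _ hne
      exact ind_false fun h' => hne (isPattern_unique h' hw)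
    · simp
  · push Not at H
    rw [Finset.sum_eq_zero fun w _ => ind_false (H w)]
    exact zero_le_one

/-- The probability that two overlapping words both have pattern `v` converges. -/
lemma exists_tendsto_pair {k r : ℕ} (v : Equiv.Perm (Fin k)) (σ τ : Fin k → Fin r) :
    ∃ c, Tendsto (fun n : ℕ => 𝔼 h : Fin r → Fin n,
      ind (IsPattern v (h ∘ σ)) * ind (IsPattern v (h ∘ τ))) atTop (nhds c) := by
  let g : Equiv.Perm (Fin r) → ℝ := fun w =>
    ind (IsPattern v ((w : Fin r → Fin r) ∘ σ)) * ind (IsPattern v ((w : Fin r → Fin r) ∘ τ))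
  have h1 : Tendsto (fun n : ℕ => ∑ w, g w * patProb r n) atTop
      (nhds (∑ w, g w * (1 / (r.factorial : ℝ)))) :=
    tendsto_finsetSum _ fun w _ => (tendsto_patProb r).const_mul _
  have h2 : Tendsto (fun n : ℕ => 1 - ∑ _w : Equiv.Perm (Fin r), patProb r n) atTop (nhds 0) := by
    have : Tendsto (fun n : ℕ => ∑ _w : Equiv.Perm (Fin r), patProb r n) atTop
        (nhds (∑ _w : Equiv.Perm (Fin r), 1 / (r.factorial : ℝ))) :=
      tendsto_finsetSum _ fun w _ => tendsto_patProb r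
    rw [Finset.sum_const, Finset.card_univ, Fintype.card_perm, Fintype.card_fin, nsmul_eq_mul,
      mul_one_div_cancel (by positivity)] at this
    simpa using this.const_sub 1
  refine ⟨∑ w, g w * (1 / (r.factorial : ℝ)), ?_⟩
  have h3 : Tendsto (fun n : ℕ => 𝔼 h : Fin r → Fin n,
      ind (IsPattern v (h ∘ σ)) * ind (IsPattern v (h ∘ τ)) - ∑ w, g w * patProb r n) atTop
      (nhds 0) := by
    refine tendsto_of_tendsto_of_tendsto_of_le_of_le' tendsto_const_nhds h2 ?_ ?_
    all_goals
      filter_upwards [eventually_gt_atTop 0] with n hn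
      have : Nonempty (Fin n) := ⟨⟨0, hn⟩⟩
      have e1 : ∑ w, g w * patProb r n =
          𝔼 h : Fin r → Fin n, ∑ w, g w * ind (IsPattern w h) := by
        rw [Finset.expect_sum_comm]
        exact Finset.sum_congr rfl fun w _ => by rw [← Finset.mul_expect, expect_isPattern]
      have e2 : (1 : ℝ) - ∑ _w : Equiv.Perm (Fin r), patProb r n =
          𝔼 h : Fin r → Fin n, (1 - ∑ w : Equiv.Perm (Fin r), ind (IsPattern w h)) := by
        rw [Finset.expect_sub_distrib, Fintype.expect_const, Finset.expect_sum_comm]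
        simp only [expect_isPattern]
      have e3 : ∀ h : Fin r → Fin n, ∀ w, g w * ind (IsPattern w h) =
          ind (IsPattern v (h ∘ σ)) * ind (IsPattern v (h ∘ τ)) * ind (IsPattern w h) := by
        intro h w
        by_cases hw : IsPattern w h
        · simp only [g, hw.comp_iff]
        · rw [ind_false hw, mul_zero, mul_zero]
      rw [e1, ← Finset.expect_sub_distrib]
    · refine Finset.expect_nonneg fun h _ => ?_
      simp only [e3, ← Finset.mul_sum]
      have a := sum_ind_isPattern_le h
      have b := mul_nonneg (ind_nonneg (IsPattern v (h ∘ σ))) (ind_nonneg (IsPattern v (h ∘ τ)))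
      nlinarith
    · rw [e2]
      refine Finset.expect_le_expect fun h _ => ?_
      simp only [e3, ← Finset.mul_sum]
      have a := sum_ind_isPattern_le h
      have b := mul_le_one₀ (ind_le_one (IsPattern v (h ∘ σ))) (ind_nonneg _)
        (ind_le_one (IsPattern v (h ∘ τ)))
      nlinarith
  simpa using h3.add h1

lemma wordCov_patStat {k r n : ℕ} (v : Equiv.Perm (Fin k)) {σ τ : Fin k → Fin r}
    {u : Fin r → Fin n} (hn : 0 < n) (hσ : Function.Injective σ) (hτ : Function.Injective τ)
    (hu : Function.Injective u) :
    wordCov (patStat v (u ∘ σ)) (patStat v (u ∘ τ)) =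
      𝔼 h : Fin r → Fin n, ind (IsPattern v (h ∘ σ)) * ind (IsPattern v (h ∘ τ)) -
        patProb k n ^ 2 := by
  have : Nonempty (Fin n) := ⟨⟨0, hn⟩⟩
  rw [wordCov, expect_patStat v (hu.comp hσ), expect_patStat v (hu.comp hτ), ← sq]
  congr 1
  exact expect_comp_injective hu
    (fun h : Fin r → Fin n => ind (IsPattern v (h ∘ σ)) * ind (IsPattern v (h ∘ τ)))

lemma wordCov_eq_zero_of_disjoint {n : ℕ} {f g : (Fin n → Fin n) → ℝ} {P Q : Finset (Fin n)}
    (hf : DependsOn f (P : Set (Fin n))) (hg : DependsOn g (Q : Set (Fin n)))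
    (hPQ : Disjoint P Q) : wordCov f g = 0 := by
  have h := expect_mul_of_disjoint (Θ := fun U => ((f U : ℝ) : ℂ)) (Ψ := fun U => ((g U : ℝ) : ℂ))
    (fun _ _ hU => congrArg _ (hf hU)) (fun _ _ hU => congrArg _ (hg hU)) hPQ
  have : ((wordCov f g : ℝ) : ℂ) = 0 := by
    simp only [wordCov, Complex.ofReal_sub, Complex.ofReal_mul, Complex.ofReal_expect]
    rw [h, sub_self]
  exact_mod_cast this

lemma patStat_dependsOn {k n : ℕ} (v : Equiv.Perm (Fin k)) (s : Fin k → Fin n) :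
    DependsOn (patStat v s) ((univ.image s : Finset (Fin n)) : Set (Fin n)) := by
  intro U V hUV
  have : U ∘ s = V ∘ s := by
    funext a
    exact hUV (s a) (by simp)
  simp [patStat, this]

/-- Relative positions of two increasing words of length `k` using `r` letters in total. -/
noncomputable def overlaps (k r : ℕ) : Finset ((Fin k → Fin r) × (Fin k → Fin r)) :=
  univ.filter fun p => StrictMono p.1 ∧ StrictMono p.2 ∧
    ∀ c, c ∈ Set.range p.1 ∨ c ∈ Set.range p.2

/-- Increasing words of length `r` inducing two admissible words of length `k`. -/
noncomputable def jointIncr {k r : ℕ} (A : Finset ℕ) (n : ℕ)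
    (p : (Fin k → Fin r) × (Fin k → Fin r)) : Finset (Fin r → Fin n) :=
  univ.filter fun u => StrictMono u ∧ u ∘ p.1 ∈ incr k A n ∧ u ∘ p.2 ∈ incr k A n

lemma sum_pairs_card_eq (k r : ℕ) (A : Finset ℕ) (n : ℕ)
    (f : (Fin k → Fin n) → (Fin k → Fin n) → ℝ) :
    ∑ p ∈ (incr k A n ×ˢ incr k A n) with (univ.image p.1 ∪ univ.image p.2).card = r, f p.1 p.2 =
      ∑ p ∈ overlaps k r, ∑ u ∈ jointIncr A n p, f (u ∘ p.1) (u ∘ p.2) := by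
  rw [Finset.sum_sigma' (overlaps k r) (fun p => jointIncr A n p)
    (fun p u => f (u ∘ p.1) (u ∘ p.2))]
  symm
  have himg : ∀ p ∈ overlaps k r, ∀ u : Fin r → Fin n,
      univ.image (u ∘ p.1) ∪ univ.image (u ∘ p.2) = univ.image u := by
    intro p hp u
    simp only [overlaps, Finset.mem_filter, Finset.mem_univ, true_and] at hp
    ext z
    simp only [Finset.mem_union, Finset.mem_image, Finset.mem_univ, true_and, Function.comp_apply]
    constructor
    · rintro (⟨a, rfl⟩ | ⟨a, rfl⟩) <;> exact ⟨_, rfl⟩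
    · rintro ⟨c, rfl⟩
      rcases hp.2.2 c with ⟨a, rfl⟩ | ⟨a, rfl⟩
      · exact Or.inl ⟨a, rfl⟩
      · exact Or.inr ⟨a, rfl⟩
  refine Finset.sum_bij (fun x _ => (x.2 ∘ x.1.1, x.2 ∘ x.1.2)) ?_ ?_ ?_ (fun _ _ => rfl)
  · rintro ⟨p, u⟩ hx
    obtain ⟨hp, hu⟩ := Finset.mem_sigma.mp hx
    have hu' := hu
    simp only [jointIncr, Finset.mem_filter, Finset.mem_univ, true_and] at hu'
    rw [Finset.mem_filter, Finset.mem_product]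
    refine ⟨hu'.2, ?_⟩
    rw [himg p hp u, Finset.card_image_of_injective _ hu'.1.injective, Finset.card_univ,
      Fintype.card_fin]
  · rintro ⟨⟨σ, τ⟩, u⟩ hx ⟨⟨σ', τ'⟩, u'⟩ hx' h
    obtain ⟨hp, hu⟩ := Finset.mem_sigma.mp hx
    obtain ⟨hp', hu'⟩ := Finset.mem_sigma.mp hx'
    have e1 := himg _ hp u
    have e2 := himg _ hp' u'
    simp only [jointIncr, Finset.mem_filter, Finset.mem_univ, true_and] at hu hu'
    simp only [Prod.mk.injEq] at h
    simp only at e1 e2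
    rw [h.1, h.2, e2] at e1
    have e3 : Set.range u' = Set.range u := by
      have := congrArg (fun T : Finset (Fin n) => (T : Set (Fin n))) e1
      simpa using this
    have e4 : u' = u := (hu'.1.range_inj hu.1).mp e3
    subst e4
    have e5 := hu.1.injective.comp_left h.1
    have e6 := hu.1.injective.comp_left h.2
    subst e5 e6
    rfl
  · rintro ⟨s, s'⟩ hx
    rw [Finset.mem_filter, Finset.mem_product] at hx
    obtain ⟨⟨hs, hs'⟩, hr⟩ := hx
    simp only at hs hs' hr
    set T := univ.image s ∪ univ.image s' with hT
    have hsT : ∀ a, s a ∈ Set.range (T.orderEmbOfFin hr) := by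
      intro a
      rw [Finset.range_orderEmbOfFin]
      simp [hT]
    have hsT' : ∀ a, s' a ∈ Set.range (T.orderEmbOfFin hr) := by
      intro a
      rw [Finset.range_orderEmbOfFin]
      simp [hT]
    choose σ hσ using hsT
    choose τ hτ using hsT'
    have eσ : (T.orderEmbOfFin hr) ∘ σ = s := funext hσ
    have eτ : (T.orderEmbOfFin hr) ∘ τ = s' := funext hτ
    refine ⟨⟨(σ, τ), T.orderEmbOfFin hr⟩, ?_, ?_⟩
    · rw [Finset.mem_sigma]
      refine ⟨?_, ?_⟩
      · simp only [overlaps, Finset.mem_filter, Finset.mem_univ, true_and]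
        refine ⟨fun a b h => ?_, fun a b h => ?_, fun c => ?_⟩
        · have := (mem_incr.mp hs).1 h
          rw [← hσ, ← hσ] at this
          exact (T.orderEmbOfFin hr).lt_iff_lt.mp this
        · have := (mem_incr.mp hs').1 h
          rw [← hτ, ← hτ] at this
          exact (T.orderEmbOfFin hr).lt_iff_lt.mp this
        · have hc := Finset.orderEmbOfFin_mem T hr c
          rcases Finset.mem_union.mp hc with hc | hc
          · obtain ⟨a, -, ha⟩ := Finset.mem_image.mp hc
            left; exact ⟨a, (T.orderEmbOfFin hr).injective (by rw [hσ, ha])⟩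
          · obtain ⟨a, -, ha⟩ := Finset.mem_image.mp hc
            right; exact ⟨a, (T.orderEmbOfFin hr).injective (by rw [hτ, ha])⟩
      · simp only [jointIncr, Finset.mem_filter, Finset.mem_univ, true_and]
        rw [eσ, eτ]
        exact ⟨(T.orderEmbOfFin hr).strictMono, hs, hs'⟩
    · simp only [eσ, eτ]

lemma sum_pairs_eq (k : ℕ) (A : Finset ℕ) (n : ℕ)
    (f : (Fin k → Fin n) → (Fin k → Fin n) → ℝ) :
    ∑ s ∈ incr k A n, ∑ s' ∈ incr k A n, f s s' =
      ∑ r ∈ range (2 * k + 1), ∑ p ∈ overlaps k r, ∑ u ∈ jointIncr A n p,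
        f (u ∘ p.1) (u ∘ p.2) := by
  rw [← Finset.sum_product', ← Finset.sum_fiberwise_of_maps_to
    (g := fun p => (univ.image p.1 ∪ univ.image p.2).card) (t := range (2 * k + 1))]
  · exact Finset.sum_congr rfl fun r _ => sum_pairs_card_eq k r A n f
  · intro p _
    rw [Finset.mem_range]
    have h1 := Finset.card_union_le (univ.image p.1) (univ.image p.2)
    have h2 := Finset.card_image_le (s := univ) (f := p.1)
    have h3 := Finset.card_image_le (s := univ) (f := p.2)
    rw [Finset.card_univ, Fintype.card_fin] at h2 h3
    omega

lemma comp_mem_incr_iff {k r n : ℕ} {A : Finset ℕ} {σ : Fin k → Fin r} (hσ : StrictMono σ)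
    {u : Fin r → Fin n} (hu : StrictMono u) :
    u ∘ σ ∈ incr k A n ↔ ∀ a ∈ A, ∀ h : a + 1 < k,
      (σ ⟨a + 1, h⟩ : ℕ) = (σ ⟨a, Nat.lt_of_succ_lt h⟩ : ℕ) + 1 ∧
      (u (σ ⟨a + 1, h⟩) : ℕ) = (u (σ ⟨a, Nat.lt_of_succ_lt h⟩) : ℕ) + 1 := by
  rw [mem_incr]
  constructor
  · rintro ⟨-, H⟩ a ha h
    refine ⟨?_, H a ha h⟩
    have h1 : (σ ⟨a, Nat.lt_of_succ_lt h⟩ : ℕ) < σ ⟨a + 1, h⟩ := hσ (by simp [Fin.lt_def])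
    by_contra hne
    let c : Fin r := ⟨(σ ⟨a, Nat.lt_of_succ_lt h⟩ : ℕ) + 1, by
      have := (σ ⟨a + 1, h⟩).isLt; omega⟩
    have h2 : u (σ ⟨a, Nat.lt_of_succ_lt h⟩) < u c := hu (by simp [Fin.lt_def, c])
    have h3 : u c < u (σ ⟨a + 1, h⟩) := hu (by simp only [Fin.lt_def, c]; omega)
    have h4 := H a ha h
    simp only [Function.comp_apply] at h4
    simp only [Fin.lt_def] at h2 h3
    omega
  · intro H
    exact ⟨hu.comp hσ, fun a ha h => (H a ha h).2⟩

lemma card_jointIncr {k r : ℕ} (A : Finset ℕ) {p : (Fin k → Fin r) × (Fin k → Fin r)}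
    (hp : p ∈ overlaps k r) :
    (∀ n, (jointIncr A n p).card = 0) ∨
      ∃ a, ∀ n, (jointIncr A n p).card = (n - a).choose (r - a) := by
  simp only [overlaps, Finset.mem_filter, Finset.mem_univ, true_and] at hp
  obtain ⟨h1, h2, -⟩ := hp
  by_cases H : (∀ a ∈ A, ∀ h : a + 1 < k,
      (p.1 ⟨a + 1, h⟩ : ℕ) = (p.1 ⟨a, Nat.lt_of_succ_lt h⟩ : ℕ) + 1) ∧
    (∀ a ∈ A, ∀ h : a + 1 < k,
      (p.2 ⟨a + 1, h⟩ : ℕ) = (p.2 ⟨a, Nat.lt_of_succ_lt h⟩ : ℕ) + 1)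
  · right
    let A' : Finset ℕ := (range r).filter fun c => ∃ a ∈ A, ∃ h : a + 1 < k,
      (p.1 ⟨a, Nat.lt_of_succ_lt h⟩ : ℕ) = c ∨ (p.2 ⟨a, Nat.lt_of_succ_lt h⟩ : ℕ) = c
    refine ⟨(A'.filter fun a => a + 1 < r).card, fun n => ?_⟩
    rw [← card_incrNat, ← card_incr_eq]
    congr 1
    ext u
    simp only [jointIncr, Finset.mem_filter, Finset.mem_univ, true_and]
    rw [mem_incr (u := u)]
    refine and_congr_right fun hu => ?_
    rw [comp_mem_incr_iff h1 hu, comp_mem_incr_iff h2 hu]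
    constructor
    · rintro ⟨ha1, ha2⟩ c hc hcr
      obtain ⟨-, a, ha, hak, hcase⟩ := Finset.mem_filter.mp hc
      rcases hcase with rfl | rfl
      · obtain ⟨e1, e2⟩ := ha1 a ha hak
        rw [← e2]
        congr 2
        exact Fin.ext e1.symm
      · obtain ⟨e1, e2⟩ := ha2 a ha hak
        rw [← e2]
        congr 2
        exact Fin.ext e1.symm
    · intro h
      refine ⟨fun a ha hak => ⟨H.1 a ha hak, ?_⟩, fun a ha hak => ⟨H.2 a ha hak, ?_⟩⟩
      · have e := H.1 a ha hak
        have := h (p.1 ⟨a, Nat.lt_of_succ_lt hak⟩ : ℕ) (Finset.mem_filter.mpr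
          ⟨Finset.mem_range.mpr (Fin.isLt _), a, ha, hak, Or.inl rfl⟩)
          (by rw [← e]; exact Fin.isLt _)
        rw [← this]
        congr 2
        exact Fin.ext e
      · have e := H.2 a ha hak
        have := h (p.2 ⟨a, Nat.lt_of_succ_lt hak⟩ : ℕ) (Finset.mem_filter.mpr
          ⟨Finset.mem_range.mpr (Fin.isLt _), a, ha, hak, Or.inr rfl⟩)
          (by rw [← e]; exact Fin.isLt _)
        rw [← this]
        congr 2
        exact Fin.ext e
  · left
    intro n
    rw [Finset.card_eq_zero, Finset.eq_empty_iff_forall_notMem]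
    intro u hu
    simp only [jointIncr, Finset.mem_filter, Finset.mem_univ, true_and] at hu
    obtain ⟨hu, hu1, hu2⟩ := hu
    rw [comp_mem_incr_iff h1 hu] at hu1
    rw [comp_mem_incr_iff h2 hu] at hu2
    exact H ⟨fun a ha h => (hu1 a ha h).1, fun a ha h => (hu2 a ha h).1⟩

lemma card_jointIncr_le {k r n : ℕ} {A : Finset ℕ} (hA : A ⊂ range (k - 1))
    {p : (Fin k → Fin r) × (Fin k → Fin r)} (hp : p ∈ overlaps k r) {a b : Fin k}
    (hab : p.1 a = p.2 b) :
    (jointIncr A n p).card ≤ n ^ (2 * (k - A.card - 1) + 1) := by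
  have hq : A.card < k - 1 := by simpa using Finset.card_lt_card hA
  simp only [overlaps, Finset.mem_filter, Finset.mem_univ, true_and] at hp
  have h1 : (jointIncr A n p).card ≤
      ((incr k A n).sigma fun s => (incr k A n).filter fun s' => s' b = s a).card := by
    refine Finset.card_le_card_of_injOn (fun u => ⟨u ∘ p.1, u ∘ p.2⟩) ?_ ?_
    · intro u hu
      simp only [jointIncr, Finset.coe_filter, Finset.mem_univ, true_and, Set.mem_ofPred_eq] at hu
      rw [Finset.mem_coe, Finset.mem_sigma]
      refine ⟨hu.2.1, Finset.mem_filter.mpr ⟨hu.2.2, ?_⟩⟩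
      simp [hab]
    · intro u _ u' _ h
      simp only [Sigma.mk.injEq, heq_eq_eq] at h
      funext c
      rcases hp.2.2 c with ⟨i, rfl⟩ | ⟨i, rfl⟩
      · exact congrFun h.1 i
      · exact congrFun h.2 i
  refine h1.trans ?_
  rw [Finset.card_sigma]
  calc ∑ s ∈ incr k A n, ((incr k A n).filter fun s' => s' b = s a).card
      ≤ ∑ _s ∈ incr k A n, n ^ (k - A.card - 1) :=
        Finset.sum_le_sum fun s _ => card_incr_through hA.subset b (s a)
    _ = (n - A.card).choose (k - A.card) * n ^ (k - A.card - 1) := by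
        rw [Finset.sum_const, card_incr hA.subset, smul_eq_mul]
    _ ≤ n ^ (k - A.card) * n ^ (k - A.card - 1) := by
        gcongr
        exact (Nat.choose_le_pow _ _).trans (Nat.pow_le_pow_left (Nat.sub_le _ _) _)
    _ = n ^ (2 * (k - A.card - 1) + 1) := by
        rw [← pow_add]; congr 1; omega

/-- The normalised variance of the pattern count in a uniform word converges. -/
theorem exists_tendsto_wordCov {k : ℕ} (v : Equiv.Perm (Fin k)) {A : Finset ℕ}
    (hA : A ⊂ range (k - 1)) :
    ∃ c, Tendsto (fun n : ℕ => (∑ s ∈ incr k A n, ∑ s' ∈ incr k A n,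
      wordCov (patStat v s) (patStat v s')) / (((n : ℝ) ^ (k - A.card - 1)) ^ 2 * n))
      atTop (nhds c) := by
  have key : ∀ r, ∀ p ∈ overlaps k r, ∃ c, Tendsto (fun n : ℕ => (∑ u ∈ jointIncr A n p,
      wordCov (patStat v (u ∘ p.1)) (patStat v (u ∘ p.2))) /
        (((n : ℝ) ^ (k - A.card - 1)) ^ 2 * n)) atTop (nhds c) := by
    intro r p hp
    have hp' := hp
    simp only [overlaps, Finset.mem_filter, Finset.mem_univ, true_and] at hp'
    by_cases hab : ∃ a b, p.1 a = p.2 b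
    · obtain ⟨a, b, hab⟩ := hab
      obtain ⟨c₁, hc₁⟩ := exists_tendsto_pair v p.1 p.2
      have hcount : ∃ c, Tendsto (fun n : ℕ => ((jointIncr A n p).card : ℝ) /
          (n : ℝ) ^ (2 * (k - A.card - 1) + 1)) atTop (nhds c) := by
        rcases card_jointIncr A hp with h | ⟨a', h⟩
        · exact ⟨0, by simp [h]⟩
        · simp only [h]
          refine exists_tendsto_choose_div_pow_of_le _ _ _ (Eventually.of_forall fun n => ?_)
          rw [← h n]
          exact_mod_cast card_jointIncr_le hA hp hab
      obtain ⟨c₂, hc₂⟩ := hcount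
      refine ⟨_, (hc₂.mul (hc₁.sub ((tendsto_patProb k).pow 2))).congr' ?_⟩
      filter_upwards [eventually_gt_atTop 0] with n hn
      have hsum : ∑ u ∈ jointIncr A n p,
          wordCov (patStat v (u ∘ p.1)) (patStat v (u ∘ p.2)) =
          (jointIncr A n p).card * (𝔼 h : Fin r → Fin n,
            ind (IsPattern v (h ∘ p.1)) * ind (IsPattern v (h ∘ p.2)) - patProb k n ^ 2) := by
        rw [← nsmul_eq_mul, ← Finset.sum_const]
        refine Finset.sum_congr rfl fun u hu => ?_
        simp only [jointIncr, Finset.mem_filter, Finset.mem_univ, true_and] at hu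
        exact wordCov_patStat v hn hp'.1.injective hp'.2.1.injective hu.1.injective
      rw [hsum, pow_succ, mul_comm 2, pow_mul]
      ring
    · push Not at hab
      refine ⟨0, tendsto_const_nhds.congr fun n => ?_⟩
      rw [Finset.sum_eq_zero, zero_div]
      intro u hu
      simp only [jointIncr, Finset.mem_filter, Finset.mem_univ, true_and] at hu
      refine wordCov_eq_zero_of_disjoint (patStat_dependsOn v _) (patStat_dependsOn v _) ?_
      rw [Finset.disjoint_left]
      rintro z hz hz'
      simp only [Finset.mem_image, Finset.mem_univ, true_and, Function.comp_apply] at hz hz'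
      obtain ⟨a, rfl⟩ := hz
      obtain ⟨b, hb⟩ := hz'
      exact hab a b (hu.1.injective hb).symm
  choose! c hc using key
  refine ⟨∑ r ∈ range (2 * k + 1), ∑ p ∈ overlaps k r, c r p,
    (tendsto_finsetSum _ fun r _ => tendsto_finsetSum _ fun p hp => hc r p hp).congr fun n => ?_⟩
  simp only [sum_pairs_eq, Finset.sum_div]

lemma wordCov_eq_centered {n : ℕ} (f g : (Fin n → Fin n) → ℝ) :
    wordCov f g = 𝔼 U, (f U - 𝔼 V, f V) * (g U - 𝔼 V, g V) := by
  have : Nonempty (Fin n → Fin n) := ⟨id⟩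
  set a := 𝔼 V, f V with ha
  set b := 𝔼 V, g V with hb
  have h1 : ∀ U, (f U - a) * (g U - b) = f U * g U - a * g U - b * f U + a * b := fun U => by ring
  simp_rw [h1]
  rw [Finset.expect_add_distrib, Finset.expect_sub_distrib, Finset.expect_sub_distrib,
    ← Finset.mul_expect, ← Finset.mul_expect, Fintype.expect_const, ← ha, ← hb, wordCov, ← ha, ← hb]
  ring

lemma wordCov_sq_le {n : ℕ} (f g : (Fin n → Fin n) → ℝ) :
    wordCov f g ^ 2 ≤ wordCov f f * wordCov g g := by
  simp only [wordCov_eq_centered]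
  have h := Finset.sum_mul_sq_le_sq_mul_sq univ (fun U => f U - 𝔼 V, f V) (fun U => g U - 𝔼 V, g V)
  simp only [Finset.expect_eq_sum_div_card, Finset.card_univ, ← sq] at h ⊢
  rw [div_pow, div_mul_div_comm, ← sq]
  gcongr

lemma wordCov_sum {n : ℕ} {ι κ : Type*} (S : Finset ι) (T : Finset κ)
    (f : ι → (Fin n → Fin n) → ℝ) (g : κ → (Fin n → Fin n) → ℝ) :
    wordCov (fun U => ∑ s ∈ S, f s U) (fun U => ∑ t ∈ T, g t U) =
      ∑ s ∈ S, ∑ t ∈ T, wordCov (f s) (g t) := by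
  simp only [wordCov, Finset.sum_mul_sum, Finset.expect_sum_comm, Finset.sum_sub_distrib]

/-- Indicator that the letter at position `i` is less than `M`. -/
noncomputable def lowStat {n : ℕ} (M : ℕ) (i : Fin n) (U : Fin n → Fin n) : ℝ :=
  ind ((U i : ℕ) < M)

lemma lowStat_dependsOn {n : ℕ} (M : ℕ) (i : Fin n) :
    DependsOn (lowStat M i) (({i} : Finset (Fin n)) : Set (Fin n)) := by
  intro U V h
  have : U i = V i := h i (by simp)
  simp [lowStat, this]

lemma card_fin_lt {n M : ℕ} (hM : M ≤ n) : (univ.filter fun i : Fin n => (i : ℕ) < M).card = M := by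
  rw [Fin.card_filter_val_lt, min_eq_right hM]

lemma expect_val_lt {n M : ℕ} (hM : M ≤ n) :
    𝔼 y : Fin n, ind ((y : ℕ) < M) = (M : ℝ) / n := by
  rw [expect_ind, Fintype.card_fin]
  congr 2
  convert card_fin_lt hM

lemma expect_lowStat {n M : ℕ} (hM : M ≤ n) (i : Fin n) :
    𝔼 U, lowStat M i U = (M : ℝ) / n := by
  have : Nonempty (Fin n) := ⟨i⟩
  have h1 := expect_comp_injective (β := Fin n) (E := ℝ) (s := fun _ : Fin 1 => i)
    (fun a b _ => Subsingleton.elim a b) (fun h => ind ((h 0 : ℕ) < M))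
  have h2 : 𝔼 h : Fin 1 → Fin n, ind ((h 0 : ℕ) < M) = 𝔼 y : Fin n, ind ((y : ℕ) < M) :=
    Fintype.expect_equiv (Equiv.funUnique (Fin 1) (Fin n)) _ _ fun h => rfl
  rw [h2, expect_val_lt hM] at h1
  exact h1

lemma wordCov_lowStat_le {n M : ℕ} (hM : M ≤ n) :
    ∑ i with (i : Fin n).val < M, ∑ j with (j : Fin n).val < M,
      wordCov (lowStat M i) (lowStat M j) ≤ M * (M / n) := by
  calc _ ≤ ∑ i with (i : Fin n).val < M, (M : ℝ) / n := by
        refine Finset.sum_le_sum fun i hi => ?_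
        rw [Finset.sum_eq_single_of_mem i hi]
        · have h0 : (0 : ℝ) ≤ (𝔼 U, lowStat M i U) * 𝔼 U, lowStat M i U := mul_self_nonneg _
          have h1 : 𝔼 U, lowStat M i U * lowStat M i U ≤ 𝔼 U, lowStat M i U := by
            refine Finset.expect_le_expect fun U _ => ?_
            exact mul_le_of_le_one_right (ind_nonneg _) (ind_le_one _)
          rw [expect_lowStat hM] at h0 h1
          rw [wordCov, expect_lowStat hM]
          linarith
        · intro j _ hj
          exact wordCov_eq_zero_of_disjoint (lowStat_dependsOn M i) (lowStat_dependsOn M j)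
            (by simpa using hj.symm)
    _ = _ := by rw [Finset.sum_const, card_fin_lt hM, nsmul_eq_mul]

/-- The probability that a word has pattern `v` and its letter at `l` is less than `M`. -/
noncomputable def lowProb {k : ℕ} (v : Equiv.Perm (Fin k)) (n M : ℕ) (l : Fin k) : ℝ :=
  𝔼 h : Fin k → Fin n, ind (IsPattern v h) * ind ((h l : ℕ) < M)

lemma wordCov_patStat_lowStat {k n M : ℕ} (v : Equiv.Perm (Fin k)) (hM : M ≤ n)
    {s : Fin k → Fin n} (hs : Function.Injective s) (l : Fin k) :
    wordCov (patStat v s) (lowStat M (s l)) = lowProb v n M l - patProb k n * (M / n) := by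
  have : Nonempty (Fin n) := ⟨s l⟩
  rw [wordCov, expect_patStat v hs, expect_lowStat hM]
  congr 1
  exact expect_comp_injective hs
    (fun h : Fin k → Fin n => ind (IsPattern v h) * ind ((h l : ℕ) < M))

lemma sum_wordCov_patStat_lowStat {k n M : ℕ} (v : Equiv.Perm (Fin k)) (A : Finset ℕ)
    (hM : M ≤ n) :
    ∑ s ∈ incr k A n, ∑ i with (i : Fin n).val < M, wordCov (patStat v s) (lowStat M i) =
      ∑ l, (((incr k A n).filter fun s => (s l).val < M).card : ℝ) *
        (lowProb v n M l - patProb k n * (M / n)) := by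
  have h1 : ∀ s ∈ incr k A n, ∑ i with (i : Fin n).val < M, wordCov (patStat v s) (lowStat M i) =
      ∑ l, ind ((s l).val < M) * (lowProb v n M l - patProb k n * (M / n)) := by
    intro s hs
    have hinj := incr_injective hs
    calc ∑ i with (i : Fin n).val < M, wordCov (patStat v s) (lowStat M i)
        = ∑ i, ind (i.val < M) * wordCov (patStat v s) (lowStat M i) := by
          rw [Finset.sum_filter]
          refine Finset.sum_congr rfl fun i _ => ?_
          by_cases hi : i.val < M
          · rw [if_pos hi, ind_true hi, one_mul]
          · rw [if_neg hi, ind_false hi, zero_mul]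
      _ = ∑ i ∈ univ.image s, ind (i.val < M) * wordCov (patStat v s) (lowStat M i) := by
          symm
          refine Finset.sum_subset (Finset.subset_univ _) fun i _ hi => ?_
          rw [wordCov_eq_zero_of_disjoint (patStat_dependsOn v s) (lowStat_dependsOn M i)
            (by simpa using hi), mul_zero]
      _ = ∑ l, ind ((s l).val < M) * wordCov (patStat v s) (lowStat M (s l)) :=
          Finset.sum_image fun a _ b _ h => hinj h
      _ = _ := by simp only [wordCov_patStat_lowStat v hM hinj]
  rw [Finset.sum_congr rfl h1, Finset.sum_comm]
  refine Finset.sum_congr rfl fun l _ => ?_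
  rw [← Finset.sum_mul, sum_ind_filter]

lemma cov_low_sq_le {k n M : ℕ} (v : Equiv.Perm (Fin k)) (A : Finset ℕ) (hM : M ≤ n) :
    (∑ l, (((incr k A n).filter fun s => (s l).val < M).card : ℝ) *
        (lowProb v n M l - patProb k n * (M / n))) ^ 2 ≤
      (∑ s ∈ incr k A n, ∑ s' ∈ incr k A n, wordCov (patStat v s) (patStat v s')) *
        (M * (M / n)) := by
  rw [← sum_wordCov_patStat_lowStat v A hM, ← wordCov_sum, ← wordCov_sum]
  refine (wordCov_sq_le _ _).trans ?_
  have h1 : 0 ≤ wordCov (fun U => ∑ s ∈ incr k A n, patStat v s U)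
      (fun U => ∑ s ∈ incr k A n, patStat v s U) := by
    rw [wordCov_eq_centered]
    exact Finset.expect_nonneg fun U _ => mul_self_nonneg _
  refine mul_le_mul_of_nonneg_left ?_ h1
  rw [wordCov_sum]
  exact wordCov_lowStat_le hM

lemma sum_lowProb {k n M : ℕ} (v : Equiv.Perm (Fin k)) (hM : M ≤ n) :
    ∑ l, lowProb v n M l = k * patProb k n * (M / n) := by
  have h1 : ∀ h : Fin k → Fin n, ∑ l, ind (IsPattern v h) * ind ((h l : ℕ) < M) =
      ∑ y with (y : Fin n).val < M, ind (IsPattern v h ∧ y ∈ Set.range h) := by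
    intro h
    simp_rw [← sum_ind_apply_eq]
    rw [Finset.sum_comm]
    refine Finset.sum_congr rfl fun l _ => ?_
    rw [← Finset.mul_sum]
    congr 1
    by_cases hl : (h l : ℕ) < M
    · rw [ind_true hl, Finset.sum_eq_single_of_mem (h l) (by simpa using hl), ind_true rfl]
      intro b _ hb
      exact ind_false fun e => hb e.symm
    · rw [ind_false hl, Finset.sum_eq_zero]
      intro y hy
      refine ind_false fun e => hl ?_
      rw [e]; simpa using hy
  simp only [lowProb]
  rw [← Finset.expect_sum_comm]
  simp_rw [h1]
  rw [Finset.expect_sum_comm]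
  simp only [expect_isPattern_mem]
  rw [Finset.sum_const, card_fin_lt hM, nsmul_eq_mul]
  ring

lemma lowProb_nonneg {k n M : ℕ} (v : Equiv.Perm (Fin k)) (l : Fin k) : 0 ≤ lowProb v n M l :=
  Finset.expect_nonneg fun _ _ => mul_nonneg (ind_nonneg _) (ind_nonneg _)

lemma expect_apply_low {k n M : ℕ} (hn : 0 < n) (hM : M ≤ n) (l : Fin k) :
    𝔼 h : Fin k → Fin n, ind ((h l : ℕ) < M) = (M : ℝ) / n := by
  have : Nonempty (Fin n) := ⟨⟨0, hn⟩⟩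
  rw [← expect_update_fun l (fun h : Fin k → Fin n => ind ((h l : ℕ) < M))]
  simp only [Function.update_self]
  rw [Fintype.expect_const, expect_val_lt hM]

lemma expect_apply_low_low {k n M : ℕ} (hn : 0 < n) (hM : M ≤ n) {l l' : Fin k} (hl : l ≠ l') :
    𝔼 h : Fin k → Fin n, ind ((h l : ℕ) < M) * ind ((h l' : ℕ) < M) = ((M : ℝ) / n) ^ 2 := by
  have : Nonempty (Fin n) := ⟨⟨0, hn⟩⟩
  rw [← expect_update_fun l
    (fun h : Fin k → Fin n => ind ((h l : ℕ) < M) * ind ((h l' : ℕ) < M))]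
  simp only [Function.update_self, Function.update_of_ne hl.symm]
  simp_rw [← Finset.expect_mul, expect_val_lt hM]
  rw [← Finset.mul_expect, expect_apply_low hn hM, sq]

lemma lowProb_le {k n M : ℕ} (v : Equiv.Perm (Fin k)) (hn : 0 < n) (hM : M ≤ n) (l : Fin k) :
    lowProb v n M l ≤ M / n := by
  rw [← expect_apply_low hn hM l]
  exact Finset.expect_le_expect fun h _ => mul_le_of_le_one_left (ind_nonneg _) (ind_le_one _)

lemma lowProb_le_sq {k n M : ℕ} (v : Equiv.Perm (Fin k)) (hn : 0 < n) (hM : M ≤ n) {l l' : Fin k}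
    (hl : v l' < v l) : lowProb v n M l ≤ ((M : ℝ) / n) ^ 2 := by
  have hne : l' ≠ l := fun e => by simp [e] at hl
  rw [← expect_apply_low_low hn hM hne]
  refine Finset.expect_le_expect fun h _ => ?_
  by_cases H : IsPattern v h ∧ (h l : ℕ) < M
  · rw [ind_true H.1, ind_true H.2, ind_true]
    have := (H.1 l' l).mpr hl
    rw [Fin.lt_def] at this
    exact this.trans H.2
  · have : ind (IsPattern v h) * ind ((h l : ℕ) < M) = 0 := by
      by_cases h1 : IsPattern v h
      · rw [ind_false (fun h2 => H ⟨h1, h2⟩), mul_zero]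
      · rw [ind_false h1, zero_mul]
    rw [this]
    exact mul_nonneg (ind_nonneg _) (ind_nonneg _)

lemma le_abs_sum_lowProb {k n M : ℕ} (v : Equiv.Perm (Fin k)) (hn : 0 < n) (hM : M ≤ n)
    (hp : (M : ℝ) / n ≤ patProb k n) {L : Finset (Fin k)} (hL : L.Nonempty) (hL' : Lᶜ.Nonempty) :
    (M : ℝ) / n * (patProb k n - M / n) ≤
      |∑ l ∈ L, (lowProb v n M l - patProb k n * (M / n))| := by
  have hk : 0 < k := hL.choose.pos
  set m : ℝ := (M : ℝ) / n with hm
  have hm0 : 0 ≤ m := by positivity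
  set l₀ : Fin k := v.symm ⟨0, hk⟩ with hl0
  have key : ∀ T : Finset (Fin k), T.Nonempty → l₀ ∉ T →
      ∑ l ∈ T, (lowProb v n M l - patProb k n * m) ≤ -(m * (patProb k n - m)) := by
    intro T hT h0
    have h1 : ∀ l ∈ T, lowProb v n M l - patProb k n * m ≤ -(m * (patProb k n - m)) := by
      intro l hl
      have hne : l ≠ l₀ := fun e => h0 (e ▸ hl)
      have hlt : v l₀ < v l := by
        rw [hl0, Equiv.apply_symm_apply, Fin.lt_def]
        refine Nat.pos_of_ne_zero fun e => hne ?_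
        rw [hl0, Equiv.eq_symm_apply]
        exact Fin.ext e
      have := lowProb_le_sq v hn hM hlt
      rw [← hm] at this
      nlinarith
    have h2 := Finset.sum_le_card_nsmul T _ _ h1
    have h3 : (1 : ℝ) ≤ T.card := by exact_mod_cast hT.card_pos
    have h4 : 0 ≤ m * (patProb k n - m) := mul_nonneg hm0 (by linarith)
    rw [nsmul_eq_mul] at h2
    nlinarith
  have hzero : ∑ l, (lowProb v n M l - patProb k n * m) = 0 := by
    rw [Finset.sum_sub_distrib, sum_lowProb v hM, Finset.sum_const, Finset.card_univ,
      Fintype.card_fin, nsmul_eq_mul]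
    ring
  rw [← Finset.sum_add_sum_compl L] at hzero
  by_cases h0 : l₀ ∈ L
  · have := key Lᶜ hL' (by simpa using h0)
    exact le_trans (by linarith) (le_abs_self _)
  · have := key L hL h0
    exact le_trans (by linarith) (neg_le_abs _)

/-- The number of admissible words whose letter at `l` is less than `M`. -/
noncomputable def lowCount {k : ℕ} (A : Finset ℕ) (n M : ℕ) (l : Fin k) : ℕ :=
  ((incr k A n).filter fun s => (s l).val < M).card

lemma lowCount_anti {k : ℕ} (A : Finset ℕ) (n M : ℕ) {l l' : Fin k} (h : l ≤ l') :
    lowCount A n M l' ≤ lowCount A n M l := by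
  refine Finset.card_le_card fun s hs => ?_
  rw [Finset.mem_filter] at hs ⊢
  exact ⟨hs.1, lt_of_le_of_lt ((mem_incr.mp hs.1).1.monotone h) hs.2⟩

lemma incr_apply_block {k n a₀ : ℕ} {A : Finset ℕ} (hA : ∀ a < a₀, a ∈ A) {s : Fin k → Fin n}
    (hs : s ∈ incr k A n) (hk : 0 < k) : ∀ l : ℕ, ∀ hl : l < k, l ≤ a₀ →
      (s ⟨l, hl⟩ : ℕ) = (s ⟨0, hk⟩ : ℕ) + l := by
  intro l
  induction l with
  | zero => intro hl _; rfl
  | succ l ih =>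
    intro hl hla
    rw [(mem_incr.mp hs).2 l (hA l (by omega)) hl, ih (by omega) (by omega)]
    omega

lemma lowCount_zero_le {k n M : ℕ} {A : Finset ℕ} (hA : A ⊆ range (k - 1)) (hk : 0 < k) :
    (n - A.card).choose (k - A.card) ≤
      lowCount A n M (⟨0, hk⟩ : Fin k) + (n - M - A.card).choose (k - A.card) := by
  rw [← card_incr hA, ← card_incr hA, card_incr_eq k A (n - M),
    ← Finset.card_filter_add_card_filter_not (s := incr k A n) (fun s => (s ⟨0, hk⟩).val < M)]
  refine Nat.add_le_add le_rfl ?_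
  refine Finset.card_le_card_of_injOn (fun s l => (s l : ℕ) - M) ?_ ?_
  · intro s hs
    rw [Finset.mem_coe, Finset.mem_filter, not_lt] at hs
    obtain ⟨hs, h0⟩ := hs
    rw [mem_incr] at hs
    have hge : ∀ l, M ≤ (s l : ℕ) := fun l =>
      h0.trans (hs.1.monotone (Fin.le_def.mpr (Nat.zero_le _)))
    rw [Finset.mem_coe, mem_incrNat]
    refine ⟨fun l => ?_, fun a b h => ?_, fun a ha h => ?_⟩
    · have := (s l).isLt
      have := hge l
      show (s l : ℕ) - M < n - M
      omega
    · have h1 : (s a : ℕ) < s b := hs.1 h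
      have := hge a
      show (s a : ℕ) - M < s b - M
      omega
    · have := hs.2 a ha h
      have := hge ⟨a, Nat.lt_of_succ_lt h⟩
      show (s _ : ℕ) - M = s _ - M + 1
      omega
  · intro s hs s' hs' h
    rw [Finset.mem_coe, Finset.mem_filter, not_lt] at hs hs'
    funext l
    have h1 := hs.2.trans ((mem_incr.mp hs.1).1.monotone (Fin.le_def.mpr (Nat.zero_le l.val)))
    have h2 := hs'.2.trans ((mem_incr.mp hs'.1).1.monotone (Fin.le_def.mpr (Nat.zero_le l.val)))
    have h3 := congrFun h l
    simp only at h3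
    apply Fin.ext
    change M ≤ (s l : ℕ) at h1
    change M ≤ (s' l : ℕ) at h2
    omega

lemma lowCount_zero_le_block {k n M a₀ : ℕ} {A : Finset ℕ} (hA : A ⊆ range (k - 1)) (hk : 0 < k)
    (h₀ : ∀ a < a₀, a ∈ A) {l : Fin k} (hl : l.val ≤ a₀) :
    lowCount A n M (⟨0, hk⟩ : Fin k) ≤ lowCount A n M l + k * n ^ (k - A.card - 1) := by
  have h1 : ((incr k A n).filter fun s => (s ⟨0, hk⟩).val < M) ⊆
      ((incr k A n).filter fun s => (s l).val < M) ∪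
        (univ.filter fun z : Fin n => z.val < M ∧ M ≤ z.val + l.val).biUnion fun z =>
          (incr k A n).filter fun s => s ⟨0, hk⟩ = z := by
    intro s hs
    rw [Finset.mem_filter] at hs
    have h2 := incr_apply_block h₀ hs.1 hk l.val l.isLt hl
    by_cases h3 : (s l).val < M
    · exact Finset.mem_union_left _ (Finset.mem_filter.mpr ⟨hs.1, h3⟩)
    · refine Finset.mem_union_right _ (Finset.mem_biUnion.mpr ⟨s ⟨0, hk⟩, ?_, ?_⟩)
      · rw [Finset.mem_filter]
        refine ⟨Finset.mem_univ _, hs.2, ?_⟩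
        rw [← h2]
        exact not_lt.mp h3
      · exact Finset.mem_filter.mpr ⟨hs.1, rfl⟩
  refine (Finset.card_le_card h1).trans ((Finset.card_union_le _ _).trans ?_)
  refine Nat.add_le_add le_rfl ((Finset.card_biUnion_le_card_mul _ _ _
    fun z _ => card_incr_through hA _ z).trans ?_)
  refine Nat.mul_le_mul_right _ ?_
  calc (univ.filter fun z : Fin n => z.val < M ∧ M ≤ z.val + l.val).card
      ≤ (range l.val).card := by
        refine Finset.card_le_card_of_injOn (fun z => M - 1 - z.val) ?_ ?_
        · intro z hz
          rw [Finset.mem_coe, Finset.mem_filter] at hz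
          rw [Finset.mem_coe, Finset.mem_range]
          show M - 1 - z.val < l.val
          omega
        · intro z hz z' hz' h
          rw [Finset.mem_coe, Finset.mem_filter] at hz hz'
          simp only at h
          apply Fin.ext
          omega
    _ ≤ k := by rw [Finset.card_range]; exact l.isLt.le

lemma lowCount_le_of_gap {k n M a₀ : ℕ} {A : Finset ℕ} (hA : A ⊆ range (k - 1))
    (ha₀ : a₀ ∉ A) (hk : a₀ + 1 < k) (hM : M ≤ n) {l : Fin k} (hl : a₀ < l.val) :
    lowCount A n M l ≤ M ^ 2 * n ^ (k - A.card - 2) := by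
  refine (lowCount_anti A n M (show (⟨a₀ + 1, hk⟩ : Fin k) ≤ l from hl)).trans ?_
  have hk0 : 0 < k := by omega
  let R := (range (k - 1) \ A).erase a₀
  have hmem : a₀ ∈ range (k - 1) \ A :=
    Finset.mem_sdiff.mpr ⟨Finset.mem_range.mpr (by omega), ha₀⟩
  have hR : R.card = k - A.card - 2 := by
    rw [Finset.card_erase_of_mem hmem, Finset.card_sdiff_of_subset hA, Finset.card_range]
    omega
  have hRlt : ∀ a : R, a.1 + 1 < k := by
    intro a
    have := Finset.mem_range.mp (Finset.mem_sdiff.mp (Finset.mem_of_mem_erase a.2)).1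
    omega
  let g : (Fin k → Fin n) → Fin n × Fin n × (R → Fin n) := fun s =>
    (s ⟨0, hk0⟩, s ⟨a₀ + 1, hk⟩, fun a => s ⟨a.1 + 1, hRlt a⟩)
  have h1 : lowCount A n M (⟨a₀ + 1, hk⟩ : Fin k) ≤
      ((univ.filter fun z : Fin n => z.val < M) ×ˢ (univ.filter fun z : Fin n => z.val < M) ×ˢ
        (univ : Finset (R → Fin n))).card := by
    refine Finset.card_le_card_of_injOn g ?_ ?_
    · intro s hs
      rw [Finset.mem_coe, Finset.mem_filter] at hs
      have h0 : (s ⟨0, hk0⟩).val < M :=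
        lt_of_le_of_lt ((mem_incr.mp hs.1).1.monotone (Fin.le_def.mpr (Nat.zero_le _))) hs.2
      simp only [g, Finset.coe_product, Set.mem_prod, Finset.coe_filter, Finset.mem_univ, true_and,
        Set.mem_ofPred_eq, Finset.coe_univ, Set.mem_univ, and_true]
      exact ⟨h0, hs.2⟩
    · intro s hs s' hs' h
      rw [Finset.mem_coe, Finset.mem_filter, mem_incr] at hs hs'
      simp only [g, Prod.mk.injEq] at h
      obtain ⟨e0, e1, e2⟩ := h
      have key : ∀ j, ∀ hj : j < k, s ⟨j, hj⟩ = s' ⟨j, hj⟩ := by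
        intro j
        induction j with
        | zero => intro _; exact e0
        | succ j ih =>
          intro hj
          by_cases hjA : j ∈ A
          · apply Fin.ext
            rw [hs.1.2 j hjA hj, hs'.1.2 j hjA hj, ih (by omega)]
          · by_cases hja : j = a₀
            · subst hja; exact e1
            · exact congrFun e2 ⟨j, Finset.mem_erase.mpr ⟨hja, Finset.mem_sdiff.mpr
                ⟨Finset.mem_range.mpr (by omega), hjA⟩⟩⟩
      funext i
      exact key i.val i.isLt
  refine h1.trans (le_of_eq ?_)
  rw [Finset.card_product, Finset.card_product, card_fin_lt hM, Finset.card_univ, Fintype.card_fun,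
    Fintype.card_fin, Fintype.card_coe, hR]
  ring

lemma abs_lowProb_sub_le {k n M : ℕ} (v : Equiv.Perm (Fin k)) (hn : 0 < n) (hM : M ≤ n)
    (hp : patProb k n ≤ 1) (l : Fin k) :
    |lowProb v n M l - patProb k n * (M / n)| ≤ M / n := by
  have h1 := lowProb_le v hn hM l
  have h2 := lowProb_nonneg (n := n) (M := M) v l
  have h3 : (0 : ℝ) ≤ M / n := by positivity
  have h4 : 0 ≤ patProb k n := by unfold patProb; positivity
  have h5 : patProb k n * (M / n) ≤ M / n := mul_le_of_le_one_left h3 hp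
  have h6 : 0 ≤ patProb k n * (M / n) := mul_nonneg h4 h3
  rw [abs_le]
  constructor <;> linarith

lemma patProb_le {k n : ℕ} : patProb k n ≤ 1 / (k.factorial : ℝ) := by
  by_cases hn : (n : ℝ) ^ k = 0
  · rw [patProb, hn, div_zero]; positivity
  · have h1 : (0 : ℝ) < (n : ℝ) ^ k := lt_of_le_of_ne (by positivity) (Ne.symm hn)
    rw [patProb, div_le_iff₀ h1, one_div_mul_eq_div]
    exact Nat.choose_le_pow_div k n

lemma patProb_le_one {k n : ℕ} : patProb k n ≤ 1 := by
  refine patProb_le.trans ?_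
  rw [div_le_one (by positivity)]
  exact_mod_cast Nat.one_le_iff_ne_zero.mpr k.factorial_ne_zero

/-- Lower bound for the covariance with the number of low letters in low positions. -/
lemma le_abs_cov_low {k n M : ℕ} (v : Equiv.Perm (Fin k)) {A : Finset ℕ} (hA : A ⊂ range (k - 1))
    (hn : 0 < n) (hM : M ≤ n) (hp : (M : ℝ) / n ≤ patProb k n) :
    ((n - A.card).choose (k - A.card) - (n - M - A.card).choose (k - A.card) : ℝ) *
        ((M : ℝ) / n * (patProb k n - M / n)) -
      k * (k * (n : ℝ) ^ (k - A.card - 1)) * (M / n) -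
      k * ((M : ℝ) ^ 2 * (n : ℝ) ^ (k - A.card - 2)) * (M / n) ≤
    |∑ l, (((incr k A n).filter fun s => (s l).val < M).card : ℝ) *
        (lowProb v n M l - patProb k n * (M / n))| := by
  change _ ≤ |∑ l, (lowCount A n M l : ℝ) * (lowProb v n M l - patProb k n * (M / n))|
  have hex : ∃ a, a ∉ A ∧ a + 1 < k := by
    obtain ⟨a, ha, ha'⟩ := Finset.exists_of_ssubset hA
    exact ⟨a, ha', by have := Finset.mem_range.mp ha; omega⟩
  obtain ⟨ha, hak⟩ := Nat.find_spec hex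
  have hmin : ∀ a < Nat.find hex, a ∈ A := by
    intro a h
    by_contra hc
    exact Nat.find_min hex h ⟨hc, by omega⟩
  set a₀ := Nat.find hex
  have hk : 0 < k := by omega
  set m : ℝ := (M : ℝ) / n with hm
  have hm0 : 0 ≤ m := by positivity
  set δ : Fin k → ℝ := fun l => lowProb v n M l - patProb k n * m with hδ
  have hδm : ∀ l, |δ l| ≤ m := fun l => abs_lowProb_sub_le v hn hM patProb_le_one l
  set C0 : ℝ := ((lowCount A n M (⟨0, hk⟩ : Fin k) : ℕ) : ℝ) with hC0
  set L : Finset (Fin k) := univ.filter fun l => l.val ≤ a₀ with hL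
  set E₁ : ℝ := k * (n : ℝ) ^ (k - A.card - 1) with hE₁
  set E₂ : ℝ := (M : ℝ) ^ 2 * (n : ℝ) ^ (k - A.card - 2) with hE₂
  have hE₁0 : 0 ≤ E₁ := by positivity
  have hE₂0 : 0 ≤ E₂ := by positivity
  have hLne : L.Nonempty := ⟨⟨0, hk⟩, by simp [hL]⟩
  have hLne' : Lᶜ.Nonempty := ⟨⟨a₀ + 1, hak⟩, by simp [hL]⟩
  have hmain := le_abs_sum_lowProb v hn hM hp hLne hLne'
  have hsplit : ∑ l, (lowCount A n M l : ℝ) * δ l =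
      C0 * ∑ l ∈ L, δ l + (∑ l ∈ L, ((lowCount A n M l : ℝ) - C0) * δ l +
        ∑ l ∈ Lᶜ, (lowCount A n M l : ℝ) * δ l) := by
    rw [← Finset.sum_add_sum_compl L, Finset.mul_sum, ← add_assoc, ← Finset.sum_add_distrib]
    congr 1
    exact Finset.sum_congr rfl fun l _ => by ring
  have hr : |∑ l ∈ L, ((lowCount A n M l : ℝ) - C0) * δ l +
        ∑ l ∈ Lᶜ, (lowCount A n M l : ℝ) * δ l| ≤ k * E₁ * m + k * E₂ * m := by
    have hcard : ∀ T : Finset (Fin k), (T.card : ℝ) ≤ k := fun T => by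
      exact_mod_cast (Finset.card_le_univ T).trans (by simp)
    refine (abs_add_le _ _).trans (add_le_add ?_ ?_)
    · refine (Finset.abs_sum_le_sum_abs _ _).trans ?_
      have h1 : ∀ l ∈ L, |((lowCount A n M l : ℝ) - C0) * δ l| ≤ E₁ * m := by
        intro l hl
        have hl' : l.val ≤ a₀ := by simpa [hL] using hl
        rw [abs_mul]
        refine mul_le_mul ?_ (hδm l) (abs_nonneg _) hE₁0
        have h2 : (lowCount A n M l : ℝ) ≤ C0 := by
          rw [hC0]
          exact_mod_cast lowCount_anti A n M (Fin.le_def.mpr (Nat.zero_le _))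
        have h3 : C0 ≤ lowCount A n M l + E₁ := by
          rw [hC0, hE₁]
          exact_mod_cast lowCount_zero_le_block (n := n) (M := M) hA.subset hk hmin hl'
        rw [abs_le]
        constructor <;> linarith
      refine (Finset.sum_le_card_nsmul _ _ _ h1).trans ?_
      rw [nsmul_eq_mul, mul_assoc (k : ℝ) E₁ m]
      exact mul_le_mul_of_nonneg_right (hcard L) (mul_nonneg hE₁0 hm0)
    · refine (Finset.abs_sum_le_sum_abs _ _).trans ?_
      have h1 : ∀ l ∈ Lᶜ, |(lowCount A n M l : ℝ) * δ l| ≤ E₂ * m := by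
        intro l hl
        have hl' : a₀ < l.val := by simpa [hL] using hl
        rw [abs_mul, Nat.abs_cast]
        refine mul_le_mul ?_ (hδm l) (abs_nonneg _) hE₂0
        rw [hE₂]
        exact_mod_cast lowCount_le_of_gap hA.subset ha hak hM hl'
      refine (Finset.sum_le_card_nsmul _ _ _ h1).trans ?_
      rw [nsmul_eq_mul, mul_assoc (k : ℝ) E₂ m]
      exact mul_le_mul_of_nonneg_right (hcard Lᶜ) (mul_nonneg hE₂0 hm0)
  have hC : ((n - A.card).choose (k - A.card) - (n - M - A.card).choose (k - A.card) : ℝ) ≤ C0 := by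
    rw [sub_le_iff_le_add, hC0]
    exact_mod_cast lowCount_zero_le (n := n) (M := M) hA.subset hk
  have hC0' : 0 ≤ C0 := by positivity
  have h5 : 0 ≤ m * (patProb k n - m) := mul_nonneg hm0 (by linarith)
  have h6 := mul_le_mul_of_nonneg_right hC h5
  have h7 := mul_le_mul_of_nonneg_left hmain hC0'
  rw [hsplit]
  have h8 := abs_sub_abs_le_abs_sub (C0 * ∑ l ∈ L, δ l)
    (-(∑ l ∈ L, ((lowCount A n M l : ℝ) - C0) * δ l + ∑ l ∈ Lᶜ, (lowCount A n M l : ℝ) * δ l))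
  rw [sub_neg_eq_add, abs_neg, abs_mul, abs_of_nonneg hC0'] at h8
  linarith

lemma sub_choose_le {n M m : ℝ} {N M' q B : ℕ} (hN : n = N) (hM : M = M') (hMN : M' ≤ N)
    (hn : 0 < n) (hm : M / n = m) (hB : B ≠ 0) :
    ((N - M' - q).choose B : ℝ) ≤ n ^ B * ((1 - m) / B.factorial) := by
  have h0 : (0 : ℝ) ≤ 1 - m := by
    rw [← hm, sub_nonneg, div_le_one hn, hN, hM]
    exact_mod_cast hMN
  have hm0 : 0 ≤ m := by
    rw [← hm, hM]
    positivity
  have h1 : ((N - M' - q).choose B : ℝ) ≤ ((N - M' : ℕ) : ℝ) ^ B / B.factorial :=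
    (Nat.choose_le_pow_div _ _).trans
      (div_le_div_of_nonneg_right (pow_le_pow_left₀ (by positivity)
        (by exact_mod_cast Nat.sub_le _ _) _) (by positivity))
  refine h1.trans ?_
  have h2 : ((N - M' : ℕ) : ℝ) = n * (1 - m) := by
    rw [Nat.cast_sub hMN, ← hN, ← hM, ← hm]
    field_simp
  rw [h2, mul_pow, mul_div_assoc]
  have h3 : (1 - m) ^ B ≤ 1 - m := pow_le_of_le_one h0 (by linarith) hB
  gcongr

/-- The limiting variance of the pattern count of a random word is positive. -/
lemma pos_of_tendsto_wordCov {k : ℕ} (v : Equiv.Perm (Fin k)) {A : Finset ℕ}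
    (hA : A ⊂ Finset.range (k - 1)) {c : ℝ}
    (h : Tendsto (fun n : ℕ => (∑ s ∈ incr k A n, ∑ s' ∈ incr k A n,
      wordCov (patStat v s) (patStat v s')) / (((n : ℝ) ^ (k - A.card - 1)) ^ 2 * n))
      atTop (nhds c)) : 0 < c := by
  have hq : A.card < k - 1 := by simpa using Finset.card_lt_card hA
  obtain ⟨B, hB⟩ : ∃ B, k - A.card = B + 2 := ⟨k - A.card - 2, by omega⟩
  have hB1 : k - A.card - 1 = B + 1 := by omega
  have hB2 : k - A.card - 2 = B := by omega
  set β : ℝ := 1 / ((B + 2).factorial : ℝ) with hβ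
  set κ : ℝ := 1 / (k.factorial : ℝ) with hκ
  have hβ0 : 0 < β := by positivity
  have hκ0 : 0 < κ := by positivity
  obtain ⟨t, ht⟩ := exists_nat_gt ((β + k) / (κ * β))
  have ht0 : (0 : ℝ) < t := lt_of_le_of_lt (by positivity) ht
  have ht0' : 0 < t := by exact_mod_cast ht0
  set m : ℝ := 1 / t with hm
  have hm0 : 0 < m := by positivity
  have hmk : m * (β + k) < κ * β := by
    rw [div_lt_iff₀ (by positivity)] at ht
    rw [hm, one_div, inv_mul_lt_iff₀ ht0]
    exact ht
  have hmκ : m < κ := by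
    have h1 : 0 ≤ m * k := by positivity
    have : m * β < κ * β := by linarith
    exact lt_of_mul_lt_mul_right this hβ0.le
  set g : ℕ → ℝ := fun n => (((n - A.card).choose (B + 2) : ℝ) / (n : ℝ) ^ (B + 2) -
    (1 - m) * β) * (m * (patProb k n - m)) - k * k * m * (1 / (n : ℝ)) - k * m ^ 3 with hg
  set b : ℝ := (β - (1 - m) * β) * (m * (κ - m)) - k * k * m * 0 - k * m ^ 3 with hb
  have hgb : Tendsto g atTop (nhds b) :=
    ((((tendsto_sub_choose_div_pow A.card (B + 2)).sub_const _).mul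
      (((tendsto_patProb k).sub_const m).const_mul m)).sub
      (tendsto_one_div_atTop_nhds_zero_nat.const_mul _)).sub_const _
  have hb0 : 0 < b := by
    have : b = m ^ 2 * (κ * β - m * (β + k)) := by rw [hb]; ring
    rw [this]
    have := sub_pos.mpr hmk
    positivity
  have hsub : Tendsto (fun M : ℕ => t * M) atTop atTop :=
    tendsto_atTop_mono (fun M => Nat.le_mul_of_pos_left M ht0') tendsto_id
  have hg' := hgb.comp hsub
  have h' := h.comp hsub
  have hp := ((tendsto_patProb k).comp hsub).eventually_const_lt hmκ
  have hfin : b ^ 2 ≤ m ^ 2 * c := by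
    refine le_of_tendsto_of_tendsto (hg'.pow 2) (h'.const_mul (m ^ 2)) ?_
    filter_upwards [hp, hg'.eventually_const_lt hb0, eventually_gt_atTop 0] with M hpM hgM hM0
    simp only [Function.comp_apply] at hpM hgM ⊢
    have hMn : M ≤ t * M := Nat.le_mul_of_pos_left M ht0'
    have hMm : (M : ℝ) / ((t * M : ℕ) : ℝ) = m := by
      have : (M : ℝ) ≠ 0 := by positivity
      rw [hm]
      push_cast
      field_simp
    have hn0 : 0 < t * M := by positivity
    generalize t * M = n at *
    have hnr : (0 : ℝ) < n := by exact_mod_cast hn0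
    have hMr : (M : ℝ) = m * n := by rw [← hMm]; field_simp
    have e1 := cov_low_sq_le (k := k) v A hMn
    have e2 := le_abs_cov_low v hA hn0 hMn (by rw [hMm]; exact hpM.le)
    have e3 := sub_choose_le (q := A.card) (B := B + 2) rfl rfl hMn hnr hMm (by omega)
    rw [hMm] at e1 e2
    rw [hB1, hB2, hB] at e2
    rw [hB1]
    set V := ∑ s ∈ incr k A n, ∑ s' ∈ incr k A n, wordCov (patStat v s) (patStat v s')
    rw [← sq_abs] at e1
    set S := |∑ l, (((incr k A n).filter fun s => (s l).val < M).card : ℝ) *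
      (lowProb v n M l - patProb k n * m)|
    have e4 : (n : ℝ) ^ (B + 2) * g n ≤ S := by
      refine le_trans ?_ e2
      have e5 : 0 ≤ m * (patProb k n - m) := mul_nonneg hm0.le (by linarith)
      have e6 := mul_le_mul_of_nonneg_right e3 e5
      have e7 : (n : ℝ) ^ (B + 2) * g n = ((n - A.card).choose (B + 2) : ℝ) *
          (m * (patProb k n - m)) - (n : ℝ) ^ (B + 2) * ((1 - m) * β) * (m * (patProb k n - m)) -
          k * (k * (n : ℝ) ^ (B + 1)) * m - k * (((m * n) ^ 2) * (n : ℝ) ^ B) * m := by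
        rw [hg]
        field_simp
        ring
      rw [e7, hMr]
      rw [hβ]
      rw [mul_one_div]
      linarith
    have e8 : ((n : ℝ) ^ (B + 2) * g n) ^ 2 ≤ V * (M * m) :=
      (pow_le_pow_left₀ (by positivity) e4 2).trans e1
    rw [← mul_div_assoc, le_div_iff₀ (by positivity)]
    rw [hMr] at e8
    refine le_of_mul_le_mul_right ?_ hnr
    calc _ = ((n : ℝ) ^ (B + 2) * g n) ^ 2 := by ring
      _ ≤ _ := e8
      _ = _ := by ring
  have : 0 < m ^ 2 * c := lt_of_lt_of_le (by positivity) hfin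
  exact pos_of_mul_pos_right this (by positivity)

lemma fullCycleType_conj {n : ℕ} (π τ : Equiv.Perm (Fin n)) :
    fullCycleType (τ * π * τ⁻¹) = fullCycleType π := by
  unfold fullCycleType
  rw [Equiv.Perm.cycleType_conj, Equiv.Perm.card_support_conj]

lemma longCycles_KClass {n : ℕ} {lam : Nat.Partition n} (h1 : Multiset.count 1 lam.parts = 0)
    (h2 : Multiset.count 2 lam.parts = 0) (hn : 6 ≤ n) : LongCycles (KClass lam) where
  nonempty := by
    obtain ⟨π, hπ⟩ := (Equiv.Perm.exists_with_cycleType_iff (Fin n) (m := lam.parts)).mpr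
      ⟨by rw [lam.parts_sum, Fintype.card_fin], fun a ha => by
        have := lam.parts_pos ha
        have : a ≠ 1 := fun e => Multiset.count_eq_zero.mp h1 (e ▸ ha)
        omega⟩
    refine ⟨π, Finset.mem_filter.mpr ⟨Finset.mem_univ _, ?_⟩⟩
    rw [fullCycleType, ← Equiv.Perm.sum_cycleType, hπ, lam.parts_sum, Nat.sub_self,
      Multiset.replicate_zero, add_zero]
  conj π hπ a b := by
    have h := (Finset.mem_filter.mp hπ).2
    refine Finset.mem_filter.mpr ⟨Finset.mem_univ _, ?_⟩
    rw [← h, ← fullCycleType_conj π (Equiv.swap a b), Equiv.swap_inv, cswap]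
  ne_fix π hπ x hx := by
    have h := (Finset.mem_filter.mp hπ).2
    rw [← h, fullCycleType, Multiset.count_add, Multiset.count_replicate_self] at h1
    have h3 : π.support.card < n := by
      simpa using Finset.card_lt_univ_of_notMem
        (fun h4 => (Equiv.Perm.mem_support.mp h4) hx : x ∉ π.support)
    omega
  ne_two π hπ x hx := by
    have h := (Finset.mem_filter.mp hπ).2
    by_cases hfix : π x = x
    · rw [← h, fullCycleType, Multiset.count_add, Multiset.count_replicate_self] at h1
      have h3 : π.support.card < n := by
        simpa using Finset.card_lt_univ_of_notMem
          (fun h4 => (Equiv.Perm.mem_support.mp h4) hfix : x ∉ π.support)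
      omega
    · rw [← h, fullCycleType, Multiset.count_add] at h2
      have hc : (π.cycleOf x).IsCycle := Equiv.Perm.isCycle_cycleOf π hfix
      have h5 : (π.cycleOf x) ^ 2 = 1 := by
        refine hc.pow_eq_one_iff.mpr ⟨x, ?_, ?_⟩
        · rwa [Equiv.Perm.cycleOf_apply_self]
        · rw [Equiv.Perm.cycleOf_pow_apply_self, sq, Equiv.Perm.mul_apply, hx]
      have h6 : (π.cycleOf x).support.card = 2 := by
        have h7 := hc.two_le_card_support
        have h8 := orderOf_dvd_of_pow_eq_one h5
        rw [hc.orderOf] at h8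
        exact le_antisymm (Nat.le_of_dvd two_pos h8) h7
      have h9 : 2 ∈ π.cycleType := by
        rw [Equiv.Perm.cycleType_def, Multiset.mem_map]
        exact ⟨π.cycleOf x, Finset.mem_val.mpr <| Equiv.Perm.cycleOf_mem_cycleFactorsFinset_iff.mpr
          (Equiv.Perm.mem_support.mpr hfix), h6⟩
      have := Multiset.count_pos.mpr h9
      omega
  six_le := hn

lemma eventually_count_eq_zero {lam : (n : ℕ) → Nat.Partition n} {i : ℕ}
    (h : Tendsto (fun n : ℕ => (Multiset.count i (lam n).parts : ℝ)) atTop (nhds 0)) :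
    ∀ᶠ n in atTop, Multiset.count i (lam n).parts = 0 := by
  filter_upwards [h.eventually_lt_const one_pos] with n hn
  have : Multiset.count i (lam n).parts < 1 := by exact_mod_cast hn
  omega

/-- The law of `W` under the uniform distribution on `K`. -/
noncomputable def unifLaw {Ω : Type*} (K : Finset Ω) (W : Ω → ℝ) : MeasureTheory.Measure ℝ :=
  ∑ π ∈ K, (K.card : ENNReal)⁻¹ • MeasureTheory.Measure.dirac (W π)

lemma isProbabilityMeasure_unifLaw {Ω : Type*} {K : Finset Ω} (hK : K.Nonempty) (W : Ω → ℝ) :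
    MeasureTheory.IsProbabilityMeasure (unifLaw K W) := by
  refine ⟨?_⟩
  have h : (K.card : ENNReal) ≠ 0 := by exact_mod_cast hK.card_pos.ne'
  simp only [unifLaw, MeasureTheory.Measure.coe_finsetSum, Finset.sum_apply,
    MeasureTheory.Measure.smul_apply, MeasureTheory.measure_univ, smul_eq_mul, mul_one,
    Finset.sum_const, nsmul_eq_mul]
  exact ENNReal.mul_inv_cancel h (ENNReal.natCast_ne_top _)

lemma integral_unifLaw {Ω E : Type*} [NormedAddCommGroup E] [NormedSpace ℝ E] [CompleteSpace E]
    {K : Finset Ω} (W : Ω → ℝ) (F : ℝ → E) :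
    ∫ x, F x ∂(unifLaw K W) = ((K.card : ℝ)⁻¹) • ∑ π ∈ K, F (W π) := by
  by_cases hK : K.Nonempty
  swap
  · rw [Finset.not_nonempty_iff_eq_empty.mp hK]
    simp [unifLaw]
  have h : (K.card : ENNReal) ≠ 0 := by exact_mod_cast hK.card_pos.ne'
  rw [unifLaw, MeasureTheory.integral_finsetSum_measure]
  · simp only [MeasureTheory.integral_smul_measure, MeasureTheory.integral_dirac,
      ENNReal.toReal_inv, ENNReal.toReal_natCast, ← Finset.smul_sum]
  · intro π _
    refine MeasureTheory.Integrable.smul_measure ?_ (ENNReal.inv_ne_top.mpr h)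
    exact MeasureTheory.integrable_dirac (by simp)

lemma tendsto_expect_gaussian {Ω : ℕ → Type*} {K : (n : ℕ) → Finset (Ω n)}
    (hK : ∀ n, (K n).Nonempty) (W : (n : ℕ) → Ω n → ℝ) (v : NNReal)
    (h : ∀ t : ℝ, Tendsto (fun n => 𝔼 π ∈ K n, Complex.exp (Complex.I * ((t * W n π : ℝ) : ℂ)))
      atTop (nhds (Complex.exp (-(v * t ^ 2 / 2 : ℝ)))))
    (F : BoundedContinuousFunction ℝ ℝ) :
    Tendsto (fun n => (∑ π ∈ K n, F (W n π)) / (K n).card) atTop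
      (nhds (∫ x, F x ∂(ProbabilityTheory.gaussianReal 0 v))) := by
  let μ : ℕ → MeasureTheory.ProbabilityMeasure ℝ :=
    fun n => ⟨unifLaw (K n) (W n), isProbabilityMeasure_unifLaw (hK n) _⟩
  let μ₀ : MeasureTheory.ProbabilityMeasure ℝ := ⟨ProbabilityTheory.gaussianReal 0 v, inferInstance⟩
  have h1 : Tendsto μ atTop (nhds μ₀) := by
    refine MeasureTheory.ProbabilityMeasure.tendsto_of_tendsto_charFun fun t => ?_
    have h2 : MeasureTheory.charFun (μ₀ : MeasureTheory.Measure ℝ) t =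
        Complex.exp (-(v * t ^ 2 / 2 : ℝ)) := by
      change MeasureTheory.charFun (ProbabilityTheory.gaussianReal 0 v) t = _
      rw [ProbabilityTheory.charFun_gaussianReal]
      push_cast
      ring_nf
    rw [h2]
    refine (h t).congr fun n => ?_
    change _ = MeasureTheory.charFun (unifLaw (K n) (W n)) t
    rw [MeasureTheory.charFun_apply_real, integral_unifLaw (W n),
      Finset.expect_eq_sum_div_card, div_eq_inv_mul, Complex.real_smul]
    push_cast
    congr 1
    refine Finset.sum_congr rfl fun π _ => ?_
    rw [mul_comm]
  have h2 := MeasureTheory.ProbabilityMeasure.tendsto_iff_forall_integral_tendsto.mp h1 F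
  refine h2.congr fun n => ?_
  change ∫ x, F x ∂(unifLaw (K n) (W n)) = _
  rw [integral_unifLaw (W n), smul_eq_mul, div_eq_inv_mul]

/-- The mean of the pattern count of a random word, up to lower-order terms. -/
lemma abs_mean_sub_le {k q n : ℕ} (hqk : q < k) (hn : k ≤ n) (hn0 : 0 < n) :
    |((n - q).choose (k - q) : ℝ) * patProb k n -
      (n : ℝ) ^ (k - q) / ((k.factorial : ℝ) * ((k - q).factorial : ℝ))| ≤
      (2 * k * k) * (n : ℝ) ^ (k - q - 1) := by
  obtain ⟨B, hB⟩ : ∃ B, k - q = B + 1 := ⟨k - q - 1, by omega⟩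
  have hnr : (0 : ℝ) < n := by exact_mod_cast hn0
  set x : ℝ := ((n - k : ℕ) : ℝ) with hx
  have hxn : x = n * (1 + -(k / n : ℝ)) := by
    rw [hx, Nat.cast_sub hn]; field_simp; ring
  have hkn : (k : ℝ) / n ≤ 1 := by
    rw [div_le_one hnr]; exact_mod_cast hn
  have hx0 : 0 ≤ x := by positivity
  rw [hB, Nat.add_sub_cancel]
  have hf1 : (1 : ℝ) ≤ k.factorial := by exact_mod_cast k.factorial_pos
  have hf2 : (1 : ℝ) ≤ (B + 1).factorial := by exact_mod_cast (B + 1).factorial_pos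
  have hu : ((n - q).choose (B + 1) : ℝ) * patProb k n ≤
      (n : ℝ) ^ (B + 1) / (k.factorial * (B + 1).factorial) := by
    have h1 : ((n - q).choose (B + 1) : ℝ) ≤ (n : ℝ) ^ (B + 1) / (B + 1).factorial :=
      (Nat.choose_le_pow_div _ _).trans
        (div_le_div_of_nonneg_right (pow_le_pow_left₀ (by positivity)
          (by exact_mod_cast Nat.sub_le _ _) _) (by positivity))
    refine (mul_le_mul h1 patProb_le (by unfold patProb; positivity) (by positivity)).trans ?_
    rw [div_mul_div_comm, mul_one, mul_comm ((B + 1).factorial : ℝ)]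
  have hl1 : x ^ (B + 1) / (B + 1).factorial ≤ ((n - q).choose (B + 1) : ℝ) := by
    refine le_trans ?_ (Nat.pow_le_choose (B + 1) (n - q))
    refine div_le_div_of_nonneg_right (pow_le_pow_left₀ hx0 ?_ _) (by positivity)
    rw [hx]
    exact_mod_cast (by omega : n - k ≤ n - q + 1 - (B + 1))
  have hl2 : x ^ k / k.factorial / (n : ℝ) ^ k ≤ patProb k n := by
    rw [patProb]
    refine div_le_div_of_nonneg_right (le_trans ?_ (Nat.pow_le_choose k n)) (by positivity)
    refine div_le_div_of_nonneg_right (pow_le_pow_left₀ hx0 ?_ _) (by positivity)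
    rw [hx]
    exact_mod_cast (by omega : n - k ≤ n + 1 - k)
  have hl := mul_le_mul hl1 hl2 (by positivity) (by positivity)
  have hber := one_add_mul_le_pow (a := -(k / n : ℝ)) (by linarith) (B + 1 + k)
  set y : ℝ := 1 + -(k / n : ℝ) with hy
  have e1 : x ^ (B + 1) / (B + 1).factorial * (x ^ k / k.factorial / (n : ℝ) ^ k) =
      (n : ℝ) ^ (B + 1) / (k.factorial * (B + 1).factorial) * y ^ (B + 1 + k) := by
    rw [hxn, mul_pow, mul_pow, pow_add y]
    field_simp
    ring
  rw [e1] at hl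
  set Q : ℝ := (n : ℝ) ^ (B + 1) / (k.factorial * (B + 1).factorial) with hQ
  have hQ0 : 0 ≤ Q := by positivity
  have e2 := mul_le_mul_of_nonneg_left hber hQ0
  have hQn : Q ≤ (n : ℝ) ^ (B + 1) :=
    div_le_self (by positivity) (by nlinarith)
  have e3 : Q * (((B + 1 + k : ℕ) : ℝ) * (k / n)) ≤ 2 * k * k * (n : ℝ) ^ B := by
    have h1 : ((B + 1 + k : ℕ) : ℝ) ≤ 2 * k := by
      exact_mod_cast (by omega : B + 1 + k ≤ 2 * k)
    calc Q * (((B + 1 + k : ℕ) : ℝ) * (k / n)) ≤ (n : ℝ) ^ (B + 1) * (2 * k * (k / n)) := by gcongr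
      _ = _ := by field_simp; ring
  rw [abs_sub_comm, abs_of_nonneg (by linarith)]
  linarith

/-- The deterministic centering error of the pattern count. -/
noncomputable def meanShift {k : ℕ} (v : Equiv.Perm (Fin k)) (A : Finset ℕ) (n : ℕ) : ℝ :=
  (∑ s ∈ incr k A n, 𝔼 V : Fin n → Fin n, patStat v s V -
    (n : ℝ) ^ (k - A.card) / ((k.factorial : ℝ) * ((k - A.card).factorial : ℝ))) /
    ((n : ℝ) ^ (k - A.card - 1) * √n)

lemma tendsto_meanShift {k : ℕ} (v : Equiv.Perm (Fin k)) {A : Finset ℕ}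
    (hA : A ⊂ Finset.range (k - 1)) : Tendsto (meanShift v A) atTop (nhds 0) := by
  have hq : A.card < k - 1 := by simpa using Finset.card_lt_card hA
  have h0 : Tendsto (fun n : ℕ => (2 * k * k : ℝ) / √n) atTop (nhds 0) :=
    (Real.tendsto_sqrt_atTop.comp tendsto_natCast_atTop_atTop).const_div_atTop _
  refine squeeze_zero_norm' ?_ h0
  filter_upwards [eventually_ge_atTop k, eventually_gt_atTop 0] with n hn hn0
  have hnr : (0 : ℝ) < n := by exact_mod_cast hn0
  have h1 : ∑ s ∈ incr k A n, 𝔼 V : Fin n → Fin n, patStat v s V =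
      ((n - A.card).choose (k - A.card) : ℝ) * patProb k n := by
    rw [Finset.sum_congr rfl fun s hs => expect_patStat v (incr_injective hs), Finset.sum_const,
      nsmul_eq_mul, card_incr hA.subset]
  rw [meanShift, h1, Real.norm_eq_abs, abs_div, abs_of_pos (by positivity : 0 <
    (n : ℝ) ^ (k - A.card - 1) * √n), div_le_div_iff₀ (by positivity) (by positivity)]
  have h2 := abs_mean_sub_le (q := A.card) (by omega) hn hn0
  calc _ ≤ (2 * k * k) * (n : ℝ) ^ (k - A.card - 1) * √n := by gcongr
    _ = _ := by ring

lemma vincularCount_normalized {k n : ℕ} (v : Equiv.Perm (Fin k)) {A : Finset ℕ}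
    (hA : A ⊂ Finset.range (k - 1)) (hn : 0 < n) (π : Equiv.Perm (Fin n)) :
    ((vincularCount v A π : ℝ) -
        (n : ℝ) ^ (k - A.card) / ((k.factorial : ℝ) * ((k - A.card).factorial : ℝ))) /
      (n : ℝ) ^ ((k : ℝ) - (A.card : ℝ) - 1 / 2) =
    normSum (incr k A n) (patStat v) ((n : ℝ) ^ (k - A.card - 1)) π + meanShift v A n := by
  have hq : A.card < k - 1 := by simpa using Finset.card_lt_card hA
  have hnr : (0 : ℝ) < n := by exact_mod_cast hn
  have h1 : (n : ℝ) ^ ((k : ℝ) - (A.card : ℝ) - 1 / 2) = (n : ℝ) ^ (k - A.card - 1) * √n := by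
    rw [Real.sqrt_eq_rpow, ← Real.rpow_natCast, ← Real.rpow_add hnr, Nat.cast_sub (by omega),
      Nat.cast_sub (by omega)]
    congr 1
    push_cast
    ring
  rw [h1, vincularCount_eq_sum, normSum, meanShift, ← add_div]
  congr 1
  ring

lemma tendsto_charFun_shift {Ω : ℕ → Type*} {K : (n : ℕ) → Finset (Ω n)} {W : (n : ℕ) → Ω n → ℝ}
    {a : ℕ → ℝ} (ha : Tendsto a atTop (nhds 0)) {t : ℝ} {z : ℂ}
    (h : Tendsto (fun n => 𝔼 π ∈ K n, Complex.exp (Complex.I * ((t * W n π : ℝ) : ℂ)))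
      atTop (nhds z)) :
    Tendsto (fun n => 𝔼 π ∈ K n, Complex.exp (Complex.I * ((t * (W n π + a n) : ℝ) : ℂ)))
      atTop (nhds z) := by
  have h1 : Tendsto (fun n => Complex.exp (Complex.I * ((t * a n : ℝ) : ℂ))) atTop (nhds 1) := by
    have h2 : Continuous fun x : ℝ => Complex.exp (Complex.I * ((t * x : ℝ) : ℂ)) := by fun_prop
    simpa [Function.comp_def] using (h2.tendsto 0).comp ha
  have h3 := h.mul h1
  rw [mul_one] at h3
  refine h3.congr fun n => ?_
  rw [Finset.expect_mul]
  refine Finset.expect_congr rfl fun π _ => ?_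
  rw [← Complex.exp_add]
  congr 1
  push_cast
  ring

open MeasureTheory ProbabilityTheory in
/-- Theorem `our-long-cycles`.  Let `v ∈ S_k`, `A ⊊ [k-1]` with `|A| = q`,
and let `λ⁽ⁿ⁾ ⊢ n` be a sequence of partitions with no short cycles (`m_i(λ⁽ⁿ⁾) → 0` for all
`i`).  For `Σ_n` uniform on `K_{λ⁽ⁿ⁾}`, there is `σ_{v,A} > 0` such that
`(N_{v,A}(Σ_n) - n^{k-q}/(k!(k-q)!)) / n^{k-q-1/2}` converges in distribution to
`N(0, σ_{v,A}²)` (convergence in distribution stated via bounded continuous test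
functions). -/
theorem statement19 {k : ℕ} (v : Equiv.Perm (Fin k)) (A : Finset ℕ)
    (hA : A ⊂ Finset.range (k - 1))
    (lam : (n : ℕ) → Nat.Partition n)
    (hshort : ∀ i : ℕ, Filter.Tendsto
      (fun n : ℕ => (Multiset.count i (lam n).parts : ℝ)) Filter.atTop (nhds 0)) :
    ∃ σ : NNReal, 0 < σ ∧
      ∀ F : BoundedContinuousFunction ℝ ℝ,
        Filter.Tendsto (fun n : ℕ =>
            expect (lam n) (fun π =>
              F (((vincularCount v A π : ℝ) -
                    (n : ℝ) ^ (k - A.card) /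
                      ((k.factorial : ℝ) * ((k - A.card).factorial : ℝ))) /
                  (n : ℝ) ^ ((k : ℝ) - (A.card : ℝ) - 1 / 2))))
          Filter.atTop
          (nhds (∫ x, F x ∂(gaussianReal 0 (σ ^ 2)))) := by
  obtain ⟨c, hc⟩ := exists_tendsto_wordCov v hA
  have hc0 := pos_of_tendsto_wordCov v hA hc
  have hK : ∀ᶠ n in atTop, LongCycles (KClass (lam n)) := by
    filter_upwards [eventually_count_eq_zero (hshort 1), eventually_count_eq_zero (hshort 2),
      eventually_ge_atTop 6] with n h1 h2 hn
    exact longCycles_KClass h1 h2 hn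
  have hloc : ∀ᶠ n in atTop, LocalFamily (incr k A n) (fun s => univ.image s) (patStat v) k
      ((n : ℝ) ^ (k - A.card - 1)) := by
    filter_upwards [eventually_gt_atTop (2 * k)] with n hn
    exact localFamily_patStat v hA hn
  obtain ⟨N, hN⟩ := eventually_atTop.mp hK
  set σ : NNReal := NNReal.sqrt c.toNNReal with hσ
  have hσ2 : ((σ ^ 2 : NNReal) : ℝ) = c := by
    rw [hσ, NNReal.sq_sqrt, Real.coe_toNNReal _ hc0.le]
  refine ⟨σ, NNReal.sqrt_pos.mpr (Real.toNNReal_pos.mpr hc0), fun F => ?_⟩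
  obtain ⟨W, hW⟩ : ∃ W : (n : ℕ) → Equiv.Perm (Fin n) → ℝ, ∀ n π, W n π =
      normSum (incr k A n) (patStat v) ((n : ℝ) ^ (k - A.card - 1)) π + meanShift v A n :=
    ⟨_, fun _ _ => rfl⟩
  have hchar : ∀ t : ℝ, Tendsto (fun n => 𝔼 π ∈ KClass (lam n),
      Complex.exp (Complex.I * ((t * W n π : ℝ) : ℂ))) atTop
      (nhds (Complex.exp (-(((σ ^ 2 : NNReal) : ℝ) * t ^ 2 / 2 : ℝ)))) := by
    intro t
    simp_rw [hσ2, hW]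
    exact tendsto_charFun_shift (tendsto_meanShift v hA) (tendsto_expect_normExp hloc hK hc t)
  have hlim := tendsto_expect_gaussian (K := fun n => KClass (lam (n + (N + 1))))
    (fun n => (hN _ (by omega)).nonempty) (fun n => W (n + (N + 1))) (σ ^ 2)
    (fun t => (tendsto_add_atTop_iff_nat (N + 1)
      (f := fun n => 𝔼 π ∈ KClass (lam n), Complex.exp (Complex.I * ((t * W n π : ℝ) : ℂ)))).mpr
      (hchar t)) F
  rw [← tendsto_add_atTop_iff_nat (N + 1)]
  refine hlim.congr fun n => ?_
  have hn : 0 < n + (N + 1) := by omega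
  generalize n + (N + 1) = m at hn ⊢
  rw [expect]
  congr 1
  refine Finset.sum_congr rfl fun π _ => ?_
  rw [vincularCount_normalized v hA hn π, hW]

end PaperStmt
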